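/- (Chudnovsky) Let ω₁, ω₂ ∈ ℂ be linearly independent over ℝ, let L = ℤω₁ + ℤω₂ be the lattice they generate, and suppose the Eisenstein invariants g₂ = 60·∑_{ω ∈ L∖{0}} ω⁻⁴ and g₃ = 140·∑_{ω ∈ L∖{0}} ω⁻⁶ are algebraic numbers and that the quotient ω₂/ω₁ is algebraic over ℚ (the CM case). Then π and ω₁ are algebraically independent over ℚ; consequently the field ℚ(π, ω₁, ω₂) has transcendence degree 2 over ℚ. -/

import Mathlib

open Polynomial in
/-- The length of an integer polynomial: the sum of the absolute values of its coefficients. -/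
noncomputable def plen (P : ℤ[X]) : ℝ := ∑ i ∈ P.support, |(P.coeff i : ℝ)|

section PolynomialLength

open Polynomial

theorem plen_eq_sum_range {P : ℤ[X]} {N : ℕ} (h : P.natDegree < N) :
    plen P = ∑ i ∈ Finset.range N, |(P.coeff i : ℝ)| := by
  unfold plen
  refine Finset.sum_subset (fun i hi => ?_) (fun i _ hi => ?_)
  · exact Finset.mem_range.2 (lt_of_le_of_lt (le_natDegree_of_mem_supp i hi) h)
  · simp [notMem_support_iff.1 hi]

theorem plen_nonneg (P : ℤ[X]) : 0 ≤ plen P := Finset.sum_nonneg fun _ _ => abs_nonneg _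

@[simp] theorem plen_zero : plen 0 = 0 := by simp [plen]

theorem plen_monomial (i : ℕ) (a : ℤ) : plen (monomial i a) = |(a : ℝ)| := by
  by_cases ha : a = 0
  · simp [ha]
  · simp [plen, support_monomial _ ha]

theorem plen_C (a : ℤ) : plen (C a) = |(a : ℝ)| := plen_monomial 0 a

theorem plen_one : plen 1 = 1 := by
  have := plen_C 1
  simpa using this

theorem plen_add_le (P Q : ℤ[X]) : plen (P + Q) ≤ plen P + plen Q := by
  set N := max P.natDegree Q.natDegree + 1
  have h := natDegree_add_le P Q
  rw [plen_eq_sum_range (N := N) (by omega), plen_eq_sum_range (N := N) (P := P) (by omega),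
    plen_eq_sum_range (N := N) (P := Q) (by omega), ← Finset.sum_add_distrib]
  refine Finset.sum_le_sum fun i _ => ?_
  rw [coeff_add]
  push_cast
  exact abs_add_le _ _

theorem plen_neg (P : ℤ[X]) : plen (-P) = plen P := by
  simp [plen]

theorem plen_sum_le {ι : Type*} (s : Finset ι) (f : ι → ℤ[X]) :
    plen (∑ i ∈ s, f i) ≤ ∑ i ∈ s, plen (f i) := by
  classical
  induction s using Finset.induction_on with
  | empty => simp
  | insert a s ha ih =>
    rw [Finset.sum_insert ha, Finset.sum_insert ha]
    exact (plen_add_le _ _).trans (by gcongr)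

theorem plen_monomial_mul (i : ℕ) (a : ℤ) (Q : ℤ[X]) :
    plen (monomial i a * Q) ≤ |(a : ℝ)| * plen Q := by
  have h : monomial i a * Q = ∑ j ∈ Q.support, monomial (i + j) (a * Q.coeff j) := by
    conv_lhs => rw [Q.as_sum_support, Finset.mul_sum]
    simp [monomial_mul_monomial]
  rw [h]
  refine (plen_sum_le _ _).trans (le_of_eq ?_)
  simp only [plen_monomial, Int.cast_mul, abs_mul]
  rw [plen, Finset.mul_sum]

theorem plen_mul_le (P Q : ℤ[X]) : plen (P * Q) ≤ plen P * plen Q := by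
  conv_lhs => rw [P.as_sum_support, Finset.sum_mul]
  refine (plen_sum_le _ _).trans ?_
  conv_rhs => rw [plen, Finset.sum_mul]
  exact Finset.sum_le_sum fun i _ => plen_monomial_mul _ _ _

theorem plen_prod_le {ι : Type*} (s : Finset ι) (f : ι → ℤ[X]) :
    plen (∏ i ∈ s, f i) ≤ ∏ i ∈ s, plen (f i) := by
  classical
  induction s using Finset.induction_on with
  | empty => simp [plen_one]
  | insert a s ha ih =>
    rw [Finset.prod_insert ha, Finset.prod_insert ha]
    exact (plen_mul_le _ _).trans (mul_le_mul_of_nonneg_left ih (plen_nonneg _))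

theorem abs_coeff_le_plen (P : ℤ[X]) (i : ℕ) : |(P.coeff i : ℝ)| ≤ plen P := by
  by_cases h : i ∈ P.support
  · exact Finset.single_le_sum (f := fun i => |(P.coeff i : ℝ)|) (fun _ _ => abs_nonneg _) h
  · simp [notMem_support_iff.1 h, plen_nonneg]

theorem norm_aeval_le_plen (P : ℤ[X]) {D : ℕ} (hD : P.natDegree ≤ D) (θ : ℂ) :
    ‖aeval θ P‖ ≤ plen P * max 1 ‖θ‖ ^ D := by
  rw [aeval_eq_sum_range, plen_eq_sum_range (Nat.lt_succ_self _), Finset.sum_mul]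
  refine (norm_sum_le _ _).trans (Finset.sum_le_sum fun i hi => ?_)
  rw [zsmul_eq_mul, norm_mul, norm_pow, Complex.norm_intCast]
  gcongr
  calc ‖θ‖ ^ i ≤ max 1 ‖θ‖ ^ i := by gcongr; exact le_max_right _ _
    _ ≤ max 1 ‖θ‖ ^ D := by
      gcongr
      · exact le_max_left _ _
      · exact (Nat.lt_succ_iff.1 (Finset.mem_range.1 hi)).trans hD

theorem plen_le_of_dvd {A R : ℤ[X]} (hR : R ≠ 0) (h : A ∣ R) (i : ℕ) :
    |(A.coeff i : ℝ)| ≤ 2 ^ R.natDegree * plen R := by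
  obtain ⟨B, rfl⟩ := h
  set ι := Int.castRingHom ℂ
  have hι : Isometry ι := by
    refine Isometry.of_dist_eq fun x y => ?_
    simp [ι, dist_eq_norm, ← Int.cast_sub, Complex.norm_intCast, Int.norm_eq_abs]
  have hA : A ≠ 0 := left_ne_zero_of_mul hR
  have hB : B ≠ 0 := right_ne_zero_of_mul hR
  have h1 := norm_coeff_le_choose_mul_mapMahlerMeasure (v := ι) hι i A
  have h2 := mapMahlerMeasure_le_sum_norm_coeff (v := ι) (A * B) hι
  have h3 := one_le_mahlerMeasure_of_ne_zero hB
  have h4 := mapMahlerMeasure_mul (v := ι) A B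
  have h5 : ((A.natDegree.choose i : ℕ) : ℝ) ≤ 2 ^ (A * B).natDegree := by
    rw [natDegree_mul hA hB]
    calc ((A.natDegree.choose i : ℕ) : ℝ) ≤ 2 ^ A.natDegree := by
          exact_mod_cast Nat.choose_le_two_pow _ _
      _ ≤ _ := by gcongr <;> simp
  have h6 : (0 : ℝ) ≤ A.mapMahlerMeasure ι := mapMahlerMeasure_nonneg ..
  have h3' : 1 ≤ B.mapMahlerMeasure ι := h3
  have h7 : A.mapMahlerMeasure ι ≤ plen (A * B) := by
    calc _ ≤ A.mapMahlerMeasure ι * B.mapMahlerMeasure ι := le_mul_of_one_le_right h6 h3'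
      _ = _ := h4.symm
      _ ≤ _ := h2
      _ = _ := by simp [plen, Polynomial.sum, Int.norm_eq_abs]
  calc |(A.coeff i : ℝ)| = ‖A.coeff i‖ := by simp [Int.norm_eq_abs]
    _ ≤ _ := h1
    _ ≤ _ := by gcongr

end PolynomialLength

section Resultant

open Polynomial

theorem norm_det_mul_norm_le {ι : Type*} [Fintype ι] [DecidableEq ι] (A : Matrix ι ι ℂ)
    (e f : ι → ℂ) (hAe : A.mulVec e = f) {H ε : ℝ} (hH : 1 ≤ H) (hA : ∀ i j, ‖A i j‖ ≤ H)
    (hf : ∀ i, ‖f i‖ ≤ ε) (i : ι) :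
    ‖A.det‖ * ‖e i‖ ≤
      Fintype.card ι * (Fintype.card ι).factorial * H ^ Fintype.card ι * ε := by
  have h1 : A.adjugate.mulVec f = A.det • e := by
    rw [← hAe, Matrix.mulVec_mulVec, Matrix.adjugate_mul, Matrix.smul_mulVec, Matrix.one_mulVec]
  have h2 : A.det * e i = ∑ j, A.adjugate i j * f j := by
    have := congrFun h1 i
    simpa [Matrix.mulVec, dotProduct] using this.symm
  have h3 : ∀ i j, ‖A.adjugate i j‖ ≤ (Fintype.card ι).factorial * H ^ Fintype.card ι := by
    intro i j
    rw [Matrix.adjugate_apply]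
    have := Matrix.det_le (A := A.updateRow j (Pi.single i 1)) (abv :=
      IsAbsoluteValue.toAbsoluteValue (fun z : ℂ => ‖z‖)) (x := H) (fun a b => ?_)
    · simpa [nsmul_eq_mul] using this
    · change ‖A.updateRow j (Pi.single i 1) a b‖ ≤ H
      rw [Matrix.updateRow_apply]
      split_ifs with h
      · rw [Pi.single_apply]
        split_ifs
        · simpa using hH
        · simpa using zero_le_one.trans hH
      · exact hA a b
  rw [← norm_mul, h2]
  calc ‖∑ j, A.adjugate i j * f j‖ ≤ ∑ j : ι, (Fintype.card ι).factorial * H ^ Fintype.card ι * ε := by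
        refine (norm_sum_le _ _).trans (Finset.sum_le_sum fun j _ => ?_)
        rw [norm_mul]
        exact mul_le_mul (h3 i j) (hf j) (norm_nonneg _) ((norm_nonneg _).trans (h3 i j))
    _ = _ := by simp; ring

theorem sum_coeff_shift (g : ℤ[X]) (θ : ℂ) (j N : ℕ) (h : j + g.natDegree < N) :
    ∑ i ∈ Finset.range N, ((if i ∈ Set.Icc j (j + g.natDegree) then g.coeff (i - j) else 0 : ℤ) : ℂ)
      * θ ^ i = θ ^ j * aeval θ g := by
  rw [aeval_eq_sum_range, Finset.mul_sum]
  have h1 : ∑ i ∈ Finset.range N, ((if i ∈ Set.Icc j (j + g.natDegree) then g.coeff (i - j) else 0 : ℤ) : ℂ)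
      * θ ^ i = ∑ i ∈ Finset.Ico j (j + (g.natDegree + 1)), (g.coeff (i - j) : ℂ) * θ ^ i := by
    symm
    refine Finset.sum_subset_zero_on_sdiff (fun i hi => ?_) (fun i hi => ?_) (fun i hi => ?_)
    · simp at hi ⊢; omega
    · simp only [Finset.mem_sdiff, Finset.mem_range, Finset.mem_Ico] at hi
      rw [if_neg]
      · simp
      · simp only [Set.mem_Icc]; omega
    · simp only [Finset.mem_Ico] at hi
      rw [if_pos]
      simp only [Set.mem_Icc]; omega
  rw [h1, Finset.sum_Ico_eq_sum_range]
  simp only [add_tsub_cancel_left]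
  refine Finset.sum_congr rfl fun i _ => ?_
  rw [zsmul_eq_mul, pow_add]; ring

theorem one_le_of_isCoprime_map {A B : ℤ[X]}
    (hAB : IsCoprime (A.map (Int.castRingHom ℚ)) (B.map (Int.castRingHom ℚ)))
    {N : ℕ} (hN : N = A.natDegree + B.natDegree) (hN0 : 0 < N) {H ε : ℝ} (hH : 1 ≤ H)
    (hA : ∀ i, |(A.coeff i : ℝ)| ≤ H) (hB : ∀ i, |(B.coeff i : ℝ)| ≤ H) (θ : ℂ)
    (hAθ : ‖aeval θ A‖ ≤ ε) (hBθ : ‖aeval θ B‖ ≤ ε) :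
    1 ≤ N * N.factorial * H ^ N * (max 1 ‖θ‖ ^ N * ε) := by
  subst hN
  set m := A.natDegree
  set n := B.natDegree
  have hdet : resultant A B ≠ 0 := by
    intro h0
    have h1 := resultant_ne_zero _ _ hAB
    have hinj : Function.Injective (Int.castRingHom ℚ) := Int.cast_injective
    rw [natDegree_map_eq_of_injective hinj, natDegree_map_eq_of_injective hinj,
      resultant_map_map, h0] at h1
    simp at h1
  set S : Matrix (Fin (m + n)) (Fin (m + n)) ℤ := sylvester A B m n
  set M : Matrix (Fin (m + n)) (Fin (m + n)) ℂ := (S.map (Int.castRingHom ℂ)).transpose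
  have hMdet : 1 ≤ ‖M.det‖ := by
    have h2 : M.det = ((resultant A B : ℤ) : ℂ) := by
      rw [Matrix.det_transpose]
      exact ((Int.castRingHom ℂ).map_det S).symm
    rw [h2, Complex.norm_intCast]
    exact_mod_cast Int.one_le_abs hdet
  have hM : ∀ i j, ‖M i j‖ ≤ H := by
    intro i j
    have h0 : (0 : ℝ) ≤ H := by linarith
    simp only [M, S, Matrix.transpose_apply, Matrix.map_apply, eq_intCast, Complex.norm_intCast]
    refine Fin.addCases (fun j => ?_) (fun j => ?_) i
    · simp only [sylvester, Matrix.of_apply, Fin.addCases_left]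
      split_ifs
      · exact hB _
      · simpa using h0
    · simp only [sylvester, Matrix.of_apply, Fin.addCases_right]
      split_ifs
      · exact hA _
      · simpa using h0
  have hε : 0 ≤ ε := (norm_nonneg _).trans hAθ
  have hpow : ∀ j, j ≤ m + n → ‖θ‖ ^ j ≤ max 1 ‖θ‖ ^ (m + n) := fun j hj =>
    calc ‖θ‖ ^ j ≤ max 1 ‖θ‖ ^ j := by gcongr; exact le_max_right _ _
      _ ≤ _ := by gcongr; exact le_max_left _ _
  have hf : ∀ i, ‖M.mulVec (fun i => θ ^ (i : ℕ)) i‖ ≤ max 1 ‖θ‖ ^ (m + n) * ε := by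
    intro i
    simp only [Matrix.mulVec, dotProduct, M, S, Matrix.transpose_apply, Matrix.map_apply,
      eq_intCast]
    refine Fin.addCases (fun j => ?_) (fun j => ?_) i
    · simp only [sylvester, Matrix.of_apply, Fin.addCases_left]
      rw [Fin.sum_univ_eq_sum_range (fun i => ((if i ∈ Set.Icc (j : ℕ) (j + n) then
        B.coeff (i - j) else 0 : ℤ) : ℂ) * θ ^ i), sum_coeff_shift _ _ _ _ (by omega), norm_mul,
        norm_pow]
      gcongr
      exact hpow _ (by omega)
    · simp only [sylvester, Matrix.of_apply, Fin.addCases_right]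
      rw [Fin.sum_univ_eq_sum_range (fun i => ((if i ∈ Set.Icc (j : ℕ) (j + m) then
        A.coeff (i - j) else 0 : ℤ) : ℂ) * θ ^ i), sum_coeff_shift _ _ _ _ (by omega), norm_mul,
        norm_pow]
      gcongr
      exact hpow _ (by omega)
  have key := norm_det_mul_norm_le M _ _ rfl hH hM hf ⟨0, hN0⟩
  simp only [pow_zero, norm_one, mul_one, Fintype.card_fin] at key
  exact hMdet.trans key

theorem isCoprime_map_of_isRelPrime {A B : ℤ[X]} (hA : A ≠ 0) (hB : B ≠ 0)
    (h : IsRelPrime A B) : IsCoprime (A.map (Int.castRingHom ℚ)) (B.map (Int.castRingHom ℚ)) := by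
  have hinj : Function.Injective (Int.castRingHom ℚ) := Int.cast_injective
  refine isCoprime_of_irreducible_dvd (fun h0 => hA ?_) fun p hp hpA hpB => ?_
  · exact (Polynomial.map_eq_zero_iff hinj).1 h0.1
  obtain ⟨b, hb0, hb⟩ := IsLocalization.integerNormalization_spec (nonZeroDivisors ℤ) p
  set q := IsLocalization.integerNormalization (nonZeroDivisors ℤ) p
  have hb0' : b ≠ 0 := nonZeroDivisors.ne_zero hb0
  have hq0 : q ≠ 0 := by
    intro h0
    rw [h0] at hb
    have : p = 0 := by simpa [hb0', eq_comm] using hb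
    exact hp.ne_zero this
  have hmap : Associated (q.primPart.map (Int.castRingHom ℚ)) p := by
    have h1 : C ((b : ℤ) : ℚ) * p = C ((q.content : ℤ) : ℚ) * q.primPart.map (Int.castRingHom ℚ) := by
      have h2 : (C ((b : ℤ) : ℚ) * p) = q.map (Int.castRingHom ℚ) := by
        have := hb
        rw [show algebraMap ℤ ℚ = Int.castRingHom ℚ from rfl] at this
        rw [this]
        ext i
        simp
      rw [h2]
      conv_lhs => rw [q.eq_C_content_mul_primPart]
      simp
    have hu1 : IsUnit (C ((b : ℤ) : ℚ)) := by
      rw [isUnit_C]; exact (Int.cast_ne_zero.2 hb0').isUnit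
    have hu2 : IsUnit (C ((q.content : ℤ) : ℚ)) := by
      rw [isUnit_C]; exact (Int.cast_ne_zero.2 (mt content_eq_zero_iff.1 hq0)).isUnit
    have e1 := (associated_isUnit_mul_left_iff (a := p) hu1).2 (Associated.refl p)
    have e2 := (associated_isUnit_mul_left_iff hu2).2
      (Associated.refl (q.primPart.map (Int.castRingHom ℚ)))
    rw [h1] at e1
    exact e2.symm.trans e1
  have hdvd : ∀ F : ℤ[X], F ≠ 0 → p ∣ F.map (Int.castRingHom ℚ) → q.primPart ∣ F := by
    intro F _ hpF
    exact (q.isPrimitive_primPart.dvd_iff_fraction_map_dvd_fraction_map ℚ).2 (hmap.dvd.trans hpF)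
  have hu := h (hdvd A hA hpA) (hdvd B hB hpB)
  exact hp.not_isUnit (hmap.isUnit (hu.map (mapRingHom (Int.castRingHom ℚ))))

end Resultant

section GelfondCriterion

open Polynomial

theorem exists_prime_pow_dvd_of_small {θ : ℂ} {R : ℤ[X]} {δ : ℝ} (hR : R ≠ 0) (hδ : 0 < δ)
    (hδ1 : δ ≤ 1)
    (hsep : ∀ a b : ℤ[X], a * b = R → IsRelPrime a b → ‖aeval θ a‖ < δ → ‖aeval θ b‖ < δ → False)
    (hRδ : ‖aeval θ R‖ < δ ^ 3) :
    ∃ (Q : ℤ[X]) (s : ℕ), Prime Q ∧ Q ^ s ∣ R ∧ ‖aeval θ Q‖ ^ s ≤ ‖aeval θ R‖ / δ := by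
  have main : ∀ a : ℤ[X], ∀ b : ℤ[X], a * b = R → IsRelPrime a b → ‖aeval θ a‖ < δ →
      ∃ (Q : ℤ[X]) (s : ℕ), Prime Q ∧ Q ^ s ∣ R ∧ ‖aeval θ Q‖ ^ s ≤ ‖aeval θ R‖ / δ := by
    intro a
    induction a using UniqueFactorizationMonoid.induction_on_coprime with
    | h0 => intro b hb; exact absurd (by simpa using hb.symm) hR
    | @h1 x hx =>
      intro b _ _ hlt
      exfalso
      have h1 : (1 : ℝ) ≤ ‖aeval θ x‖ := by
        obtain ⟨u, hu, rfl⟩ := Polynomial.isUnit_iff.1 hx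
        rw [aeval_C, algebraMap_int_eq, eq_intCast, Complex.norm_intCast]
        exact_mod_cast Int.one_le_abs hu.ne_zero
      linarith
    | @hpr p i hp =>
      intro b hb hrel hlt
      refine ⟨p, i, hp, ⟨b, hb.symm⟩, ?_⟩
      have hbδ : δ ≤ ‖aeval θ b‖ := by
        by_contra h
        exact hsep _ _ hb hrel hlt (not_le.1 h)
      rw [le_div_iff₀ hδ, ← hb, map_mul, norm_mul, map_pow, norm_pow]
      gcongr
    | @hcp x y hxy hPx hPy =>
      intro b hb hrel hlt
      have hbδ : δ ≤ ‖aeval θ b‖ := by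
        by_contra h
        exact hsep _ _ hb hrel hlt (not_le.1 h)
      have hxyle : ‖aeval θ x‖ * ‖aeval θ y‖ < δ * δ := by
        have h2 : ‖aeval θ x‖ * ‖aeval θ y‖ * ‖aeval θ b‖ < δ ^ 3 := by
          rw [← norm_mul, ← norm_mul, ← map_mul, ← map_mul, hb]; exact hRδ
        by_contra h
        push Not at h
        have : δ * δ * δ ≤ ‖aeval θ x‖ * ‖aeval θ y‖ * ‖aeval θ b‖ := by gcongr
        nlinarith
      by_cases hx : ‖aeval θ x‖ < δ
      · exact hPx (y * b) (by rw [← hb]; ring) (hxy.mul_right hrel.of_mul_left_left) hx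
      · have hy : ‖aeval θ y‖ < δ := by
          by_contra hy
          push Not at hx hy
          have : δ * δ ≤ ‖aeval θ x‖ * ‖aeval θ y‖ := by gcongr
          linarith
        exact hPy (x * b) (by rw [← hb]; ring)
          ((isRelPrime_comm.1 hxy).mul_right hrel.of_mul_left_right) hy
  refine main R 1 (mul_one R) isRelPrime_one_right (hRδ.trans_le ?_)
  nlinarith [mul_le_one₀ hδ1 hδ.le hδ1]

theorem one_le_exp_mul_of_isRelPrime (θ : ℂ) {C : ℝ} (hC : 1 ≤ C) :
    ∃ c : ℝ, 0 < c ∧ ∀ n : ℕ, 1 ≤ n → ∀ R R' A B : ℤ[X], R ≠ 0 → R' ≠ 0 →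
      (R.natDegree : ℝ) ≤ C * n ^ 10 → (R'.natDegree : ℝ) ≤ C * n ^ 10 →
      plen R ≤ Real.exp (C * n ^ 11) → plen R' ≤ Real.exp (C * n ^ 11) →
      A ∣ R → B ∣ R' → IsRelPrime A B → ∀ ε : ℝ, ‖aeval θ A‖ ≤ ε → ‖aeval θ B‖ ≤ ε →
      1 ≤ Real.exp (c * n ^ 21) * ε := by
  set t := Real.log (max 1 ‖θ‖)
  have ht : 0 ≤ t := Real.log_nonneg (le_max_left _ _)
  have hΘ : max 1 ‖θ‖ = Real.exp t := (Real.exp_log (by positivity)).symm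
  refine ⟨2 * C + 2 * C * (2 * C) + 2 * C * (2 * C) + 2 * C * t, by positivity, ?_⟩
  intro n hn R R' A B hR hR' hdR hdR' hlR hlR' hAR hBR hrel ε hA hB
  have hn' : (1 : ℝ) ≤ n := by exact_mod_cast hn
  have hA0 : A ≠ 0 := fun h => hR (by simpa [h] using hAR)
  have hB0 : B ≠ 0 := fun h => hR' (by simpa [h] using hBR)
  have hε : 0 ≤ ε := (norm_nonneg _).trans hA
  have hdA : (A.natDegree : ℝ) ≤ C * n ^ 10 :=
    le_trans (by exact_mod_cast natDegree_le_of_dvd hAR hR) hdR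
  have hdB : (B.natDegree : ℝ) ≤ C * n ^ 10 :=
    le_trans (by exact_mod_cast natDegree_le_of_dvd hBR hR') hdR'
  have hexp1 : 1 ≤ Real.exp ((2 * C + 2 * C * (2 * C) + 2 * C * (2 * C) + 2 * C * t) * n ^ 21) :=
    Real.one_le_exp (by positivity)
  rcases Nat.eq_zero_or_pos (A.natDegree + B.natDegree) with h0 | hpos
  · have hA1 : (1 : ℝ) ≤ ‖aeval θ A‖ := by
      rw [eq_C_of_natDegree_eq_zero (by omega : A.natDegree = 0)] at hA0 ⊢
      rw [aeval_C, algebraMap_int_eq, eq_intCast, Complex.norm_intCast]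
      exact_mod_cast Int.one_le_abs (fun h => hA0 (by rw [h, C_0]))
    nlinarith
  · set N := A.natDegree + B.natDegree with hN
    have hNle : (N : ℝ) ≤ 2 * C * n ^ 10 := by rw [hN]; push_cast; linarith
    set H := Real.exp (2 * C * n ^ 11)
    have hcoef : ∀ (S F : ℤ[X]), S ≠ 0 → (S.natDegree : ℝ) ≤ C * n ^ 10 →
        plen S ≤ Real.exp (C * n ^ 11) → F ∣ S → ∀ i, |(F.coeff i : ℝ)| ≤ H := by
      intro S F hS hd hl hF i
      refine (plen_le_of_dvd hS hF i).trans ?_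
      have h2 : (2 : ℝ) ^ S.natDegree ≤ Real.exp (C * n ^ 11) := by
        calc (2 : ℝ) ^ S.natDegree ≤ Real.exp 1 ^ S.natDegree := by
              gcongr; linarith [Real.add_one_le_exp 1]
          _ = Real.exp (S.natDegree) := by rw [← Real.exp_nat_mul, mul_one]
          _ ≤ _ := by
            gcongr
            refine hd.trans ?_
            gcongr
            norm_num
      calc _ ≤ Real.exp (C * n ^ 11) * Real.exp (C * n ^ 11) := by
            gcongr
            exact plen_nonneg _
        _ = H := by rw [← Real.exp_add]; congr 1; ring
    have key := one_le_of_isCoprime_map (isCoprime_map_of_isRelPrime hA0 hB0 hrel) hN hpos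
      (Real.one_le_exp (by positivity)) (hcoef R A hR hdR hlR hAR) (hcoef R' B hR' hdR' hlR' hBR)
      θ hA hB
    refine key.trans ?_
    rw [← mul_assoc]
    gcongr
    have hNe : (N : ℝ) ≤ Real.exp N := by linarith [Real.add_one_le_exp (N : ℝ)]
    have hfac : (N.factorial : ℝ) ≤ Real.exp (N * N) := by
      calc (N.factorial : ℝ) ≤ (N : ℝ) ^ N := by exact_mod_cast Nat.factorial_le_pow N
        _ ≤ Real.exp N ^ N := by gcongr
        _ = _ := by rw [← Real.exp_nat_mul]
    calc (N : ℝ) * N.factorial * H ^ N * max 1 ‖θ‖ ^ N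
        ≤ Real.exp N * Real.exp (N * N) * H ^ N * max 1 ‖θ‖ ^ N := by gcongr
      _ = Real.exp (N + N * N + N * (2 * C * n ^ 11) + N * t) := by
        rw [hΘ, ← Real.exp_nat_mul, ← Real.exp_nat_mul, ← Real.exp_add, ← Real.exp_add,
          ← Real.exp_add]
      _ ≤ _ := by
        gcongr
        have p10 : (n : ℝ) ^ 10 ≤ n ^ 21 := pow_le_pow_right₀ hn' (by norm_num)
        have p20 : (n : ℝ) ^ 20 ≤ n ^ 21 := pow_le_pow_right₀ hn' (by norm_num)
        have e1 : (N : ℝ) ≤ 2 * C * n ^ 21 := hNle.trans (by gcongr)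
        have e2 : (N : ℝ) * N ≤ 2 * C * (2 * C) * n ^ 21 := by
          calc (N : ℝ) * N ≤ (2 * C * n ^ 10) * (2 * C * n ^ 10) := by gcongr
            _ = 2 * C * (2 * C) * n ^ 20 := by ring
            _ ≤ _ := by gcongr
        have e3 : (N : ℝ) * (2 * C * n ^ 11) ≤ 2 * C * (2 * C) * n ^ 21 := by
          calc (N : ℝ) * (2 * C * n ^ 11) ≤ (2 * C * n ^ 10) * (2 * C * n ^ 11) := by gcongr
            _ = _ := by ring
        have e4 : (N : ℝ) * t ≤ 2 * C * t * n ^ 21 := by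
          calc (N : ℝ) * t ≤ (2 * C * n ^ 21) * t := by gcongr
            _ = _ := by ring
        linarith

theorem associated_norm_aeval_eq {θ : ℂ} {P Q : ℤ[X]} (h : Associated P Q) :
    ‖aeval θ P‖ = ‖aeval θ Q‖ := by
  obtain ⟨u, rfl⟩ := h
  obtain ⟨v, hv, huv⟩ := Polynomial.isUnit_iff.1 u.isUnit
  rw [← huv, map_mul, norm_mul, aeval_C, algebraMap_int_eq, eq_intCast, Complex.norm_intCast]
  rcases Int.isUnit_iff.1 hv with rfl | rfl <;> simp

/-- A form of Gelfond's transcendence criterion. -/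
theorem gelfond_criterion {θ : ℂ} (hθ : Transcendental ℤ θ) {C : ℝ} (hC : 1 ≤ C) (n₀ : ℕ)
    (h : ∀ n : ℕ, n₀ ≤ n → ∃ R : ℤ[X], R ≠ 0 ∧ (R.natDegree : ℝ) ≤ C * n ^ 10 ∧
      plen R ≤ Real.exp (C * n ^ 11) ∧ ‖aeval θ R‖ ≤ Real.exp (-(n ^ 22 / C))) : False := by
  obtain ⟨c, hc, hsep⟩ := one_le_exp_mul_of_isRelPrime θ hC
  obtain ⟨n₁, hn₁⟩ := exists_nat_gt (4 * C * (c * 2 ^ 21 + 1))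
  set n₂ := max (max n₀ n₁) 1
  set δ : ℕ → ℝ := fun n => Real.exp (-(c * n ^ 21 + 1)) with hδ
  have hδpos : ∀ n, 0 < δ n := fun n => Real.exp_pos _
  have hδ1 : ∀ n, δ n ≤ 1 := fun n => Real.exp_le_one_iff.2 (by
    have : 0 ≤ c * (n : ℝ) ^ 21 := by positivity
    linarith)
  have hδsep : ∀ n : ℕ, Real.exp (c * n ^ 21) * δ n < 1 := fun n => by
    rw [hδ, ← Real.exp_add, Real.exp_lt_one_iff]; linarith
  have hbig : ∀ n : ℕ, n₂ ≤ n → 4 * (c * (n + 1) ^ 21 + 1) < n ^ 22 / C := by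
    intro n hn
    have hn1 : (1 : ℝ) ≤ n := by exact_mod_cast (le_max_right _ _).trans hn
    have hnn : (n₁ : ℝ) ≤ n := by
      exact_mod_cast ((le_max_right n₀ n₁).trans (le_max_left _ _)).trans hn
    rw [lt_div_iff₀ (by linarith)]
    have e1 : ((n : ℝ) + 1) ^ 21 ≤ 2 ^ 21 * n ^ 21 := by
      rw [← mul_pow]; gcongr; linarith
    have e2 : (1 : ℝ) ≤ n ^ 21 := one_le_pow₀ hn1
    calc 4 * (c * ((n : ℝ) + 1) ^ 21 + 1) * C ≤ 4 * (c * (2 ^ 21 * n ^ 21) + n ^ 21) * C := by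
          gcongr
      _ = 4 * C * (c * 2 ^ 21 + 1) * n ^ 21 := by ring
      _ < n * n ^ 21 := by
          gcongr
          linarith
      _ = _ := by ring
  have hmono : ∀ n : ℕ, c * (n : ℝ) ^ 21 ≤ c * (n + 1) ^ 21 := fun n => by gcongr; linarith
  have hprime : ∀ n : ℕ, ∃ Q : ℤ[X], n₂ ≤ n → ∃ (R : ℤ[X]) (s : ℕ), R ≠ 0 ∧
      (R.natDegree : ℝ) ≤ C * n ^ 10 ∧ plen R ≤ Real.exp (C * n ^ 11) ∧ Prime Q ∧ Q ^ s ∣ R ∧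
      ‖aeval θ Q‖ ^ s ≤ Real.exp (-(n ^ 22 / (2 * C))) := by
    intro n
    by_cases hn : n₂ ≤ n
    swap
    · exact ⟨0, fun h => absurd h hn⟩
    obtain ⟨R, hR, hd, hl, hsm⟩ := h n (((le_max_left n₀ n₁).trans (le_max_left _ _)).trans hn)
    have hb := hbig n hn
    have hm := hmono n
    obtain ⟨Q, s, hQ, hQR, hQs⟩ := exists_prime_pow_dvd_of_small (θ := θ) hR (hδpos n) (hδ1 n) (by
      intro a b hab hrel ha hb
      have := hsep n ((le_max_right _ _).trans hn) R R a b hR hR hd hd hl hl ⟨b, hab.symm⟩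
        ⟨a, by rw [← hab, mul_comm]⟩ hrel _ ha.le hb.le
      linarith [hδsep n]) (by
      refine hsm.trans_lt ?_
      rw [hδ, ← Real.exp_nat_mul, Real.exp_lt_exp]
      push_cast
      have : 0 ≤ c * (n : ℝ) ^ 21 := by positivity
      linarith)
    refine ⟨Q, fun _ => ⟨R, s, hR, hd, hl, hQ, hQR, hQs.trans ?_⟩⟩
    rw [div_le_iff₀ (hδpos n), hδ, ← Real.exp_add]
    refine hsm.trans (Real.exp_le_exp.2 ?_)
    have : (n : ℝ) ^ 22 / (2 * C) = n ^ 22 / C / 2 := by field_simp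
    rw [this]
    have : 0 ≤ c * (n : ℝ) ^ 21 := by positivity
    linarith
  choose Q hQ using hprime
  have hsucc : ∀ n, n₂ ≤ n → Associated (Q (n + 1)) (Q n) := by
    intro n hn
    by_contra hne
    obtain ⟨R, s, hR, hd, hl, hQp, hQR, hQs⟩ := hQ n hn
    obtain ⟨R', s', hR', hd', hl', hQp', hQR', hQs'⟩ := hQ (n + 1) (by omega)
    have hrel : IsRelPrime (Q n) (Q (n + 1)) := by
      rw [hQp.irreducible.isRelPrime_iff_not_dvd]
      intro hdvd
      exact hne ((hQp.associated_of_dvd hQp' hdvd).symm)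
    have hle : ((n : ℝ)) ≤ ((n + 1 : ℕ) : ℝ) := by push_cast; linarith
    have hn0 : (0 : ℝ) ≤ n := by positivity
    have := hsep (n + 1) (by omega) R R' _ _ hR hR' (hd.trans (by gcongr)) hd'
      (hl.trans (by gcongr)) hl' hQR hQR' (hrel.pow) (Real.exp (-(n ^ 22 / (2 * C))))
      (by rw [map_pow, norm_pow]; exact hQs) (by
        rw [map_pow, norm_pow]
        refine hQs'.trans ?_
        gcongr)
    rw [← Real.exp_add, Real.one_le_exp_iff] at this
    have hb := hbig n hn
    have : (n : ℝ) ^ 22 / (2 * C) = n ^ 22 / C / 2 := by field_simp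
    push_cast at *
    have : 0 ≤ c * ((n : ℝ) + 1) ^ 21 := by positivity
    linarith
  have hall : ∀ n, n₂ ≤ n → Associated (Q n) (Q n₂) := by
    intro n hn
    induction n, hn using Nat.le_induction with
    | base => exact Associated.refl _
    | succ k hk ih => exact (hsucc k hk).trans ih
  obtain ⟨-, -, -, -, -, hQp, -⟩ := hQ n₂ le_rfl
  have hQpos : 0 < ‖aeval θ (Q n₂)‖ := by
    rw [norm_pos_iff]
    exact fun h0 => hQp.ne_zero ((transcendental_iff.1 hθ) _ h0)
  have hbound : ∀ n, n₂ ≤ n → ‖aeval θ (Q n₂)‖ ≤ Real.exp (-(n ^ 12 / (2 * C * C))) := by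
    intro n hn
    have hn1 : (1 : ℝ) ≤ n := by exact_mod_cast (le_max_right _ _).trans hn
    rw [← associated_norm_aeval_eq (hall n hn)]
    obtain ⟨R, s, hR, hd, hl, hQp, hQR, hQs⟩ := hQ n hn
    have hlt1 : ‖aeval θ (Q n)‖ ^ s < 1 := by
      refine hQs.trans_lt (Real.exp_lt_one_iff.2 (by
        have : 0 < (n : ℝ) ^ 22 / (2 * C) := by positivity
        linarith))
    have hs0 : s ≠ 0 := by rintro rfl; simp at hlt1
    have hQ1 : ‖aeval θ (Q n)‖ < 1 := by
      by_contra h1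
      exact absurd hlt1 (not_lt.2 (one_le_pow₀ (not_lt.1 h1)))
    have hdeg : 1 ≤ (Q n).natDegree := by
      by_contra hd0
      have hc := eq_C_of_natDegree_eq_zero (by omega : (Q n).natDegree = 0)
      rw [hc, aeval_C, algebraMap_int_eq, eq_intCast, Complex.norm_intCast] at hQ1
      have h2 : (Q n).coeff 0 ≠ 0 := fun h => hQp.ne_zero (by rw [hc, h, C_0])
      have : (1 : ℝ) ≤ |((Q n).coeff 0 : ℝ)| := by exact_mod_cast Int.one_le_abs h2
      linarith
    have hs : (s : ℝ) ≤ C * n ^ 10 := by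
      refine le_trans ?_ hd
      have := natDegree_le_of_dvd hQR hR
      rw [natDegree_pow] at this
      exact_mod_cast (Nat.le_mul_of_pos_right s hdeg).trans this
    refine le_of_pow_le_pow_left₀ hs0 (Real.exp_pos _).le (hQs.trans ?_)
    rw [← Real.exp_nat_mul, Real.exp_le_exp, mul_neg, neg_le_neg_iff]
    calc (s : ℝ) * (n ^ 12 / (2 * C * C)) ≤ (C * n ^ 10) * (n ^ 12 / (2 * C * C)) := by gcongr
      _ = _ := by field_simp
  obtain ⟨n₃, hn₃⟩ := exists_nat_gt (2 * C * C * (-Real.log ‖aeval θ (Q n₂)‖))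
  set n := max n₂ n₃
  have hn1 : (1 : ℝ) ≤ n := by
    exact_mod_cast (le_max_right (max n₀ n₁) 1).trans (le_max_left _ _)
  have h3 : (n₃ : ℝ) ≤ n := by exact_mod_cast le_max_right _ _
  have := hbound n (le_max_left _ _)
  rw [← Real.log_le_iff_le_exp hQpos] at this
  have h12 : (n : ℝ) ≤ n ^ 12 := le_self_pow₀ hn1 (by norm_num)
  have : (n : ℝ) ^ 12 ≤ 2 * C * C * (-Real.log ‖aeval θ (Q n₂)‖) := by
    have h4 : (n : ℝ) ^ 12 / (2 * C * C) ≤ -Real.log ‖aeval θ (Q n₂)‖ := by linarith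
    rwa [div_le_iff₀' (by positivity)] at h4
  linarith

end GelfondCriterion

section Representation

open Polynomial

/-- Linear independence over `ℤ[θ]` of a finite family of complex numbers, `θ` being transcendental:
no nontrivial relation with coefficients polynomials in `θ`. -/
def PolyIndep (θ : ℂ) {n : ℕ} (e : Fin n → ℂ) : Prop :=
  ∀ c : Fin n → ℤ[X], ∑ j, aeval θ (c j) * e j = 0 → c = 0

/-- `v` acts on the span of `e` by a matrix over `ℤ[θ]` whose entries have degree at most `D` and
whose rows have total length at most `H`. -/
def MatRep (θ : ℂ) {n : ℕ} (e : Fin n → ℂ) (v : ℂ) (D : ℕ) (H : ℝ) : Prop :=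
  ∃ A : Matrix (Fin n) (Fin n) ℤ[X], (∀ i j, (A i j).natDegree ≤ D) ∧
    (∀ i, ∑ j, plen (A i j) ≤ H) ∧ ∀ i, v * e i = ∑ j, aeval θ (A i j) * e j

variable {θ : ℂ} {n : ℕ} {e : Fin n → ℂ}

theorem PolyIndep.ne_zero (he : PolyIndep θ e) (i : Fin n) : e i ≠ 0 := by
  intro h
  have := he (Pi.single i 1) (by
    refine Finset.sum_eq_zero fun j _ => ?_
    by_cases hj : j = i
    · subst hj; simp [h]
    · simp [hj])
  have h2 := congrFun this i
  simp at h2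

theorem MatRep.mono {v : ℂ} {D D' : ℕ} {H H' : ℝ} (h : MatRep θ e v D H) (hD : D ≤ D') (hH : H ≤ H') :
    MatRep θ e v D' H' := by
  obtain ⟨A, h1, h2, h3⟩ := h
  exact ⟨A, fun i j => (h1 i j).trans hD, fun i => (h2 i).trans hH, h3⟩

theorem MatRep.add {v w : ℂ} {D : ℕ} {H H' : ℝ} (h : MatRep θ e v D H) (h' : MatRep θ e w D H') :
    MatRep θ e (v + w) D (H + H') := by
  obtain ⟨A, h1, h2, h3⟩ := h
  obtain ⟨B, k1, k2, k3⟩ := h'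
  refine ⟨A + B, fun i j => ?_, fun i => ?_, fun i => ?_⟩
  · exact (natDegree_add_le _ _).trans (max_le (h1 i j) (k1 i j))
  · refine le_trans ?_ (add_le_add (h2 i) (k2 i))
    rw [← Finset.sum_add_distrib]
    exact Finset.sum_le_sum fun j _ => plen_add_le _ _
  · rw [add_mul, h3, k3, ← Finset.sum_add_distrib]
    exact Finset.sum_congr rfl fun j _ => by rw [Matrix.add_apply, map_add, add_mul]

theorem MatRep.mul {v w : ℂ} {D D' : ℕ} {H H' : ℝ} (h : MatRep θ e v D H) (h' : MatRep θ e w D' H')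
    (hH : 0 ≤ H) :
    MatRep θ e (v * w) (D + D') (H * H') := by
  obtain ⟨A, h1, h2, h3⟩ := h
  obtain ⟨B, k1, k2, k3⟩ := h'
  refine ⟨B * A, fun i j => ?_, fun i => ?_, fun i => ?_⟩
  · rw [Matrix.mul_apply]
    refine natDegree_sum_le_of_forall_le _ _ fun k _ => ?_
    refine natDegree_mul_le.trans ?_
    have := h1 k j; have := k1 i k
    omega
  · calc ∑ j, plen ((B * A) i j) ≤ ∑ j, ∑ k, plen (B i k) * plen (A k j) := by
          refine Finset.sum_le_sum fun j _ => ?_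
          rw [Matrix.mul_apply]
          exact (plen_sum_le _ _).trans (Finset.sum_le_sum fun k _ => plen_mul_le _ _)
      _ = ∑ k, plen (B i k) * ∑ j, plen (A k j) := by
          rw [Finset.sum_comm]
          simp_rw [Finset.mul_sum]
      _ ≤ ∑ k, plen (B i k) * H := Finset.sum_le_sum fun k _ =>
          mul_le_mul_of_nonneg_left (h2 k) (plen_nonneg _)
      _ ≤ H' * H := by
          rw [← Finset.sum_mul]
          exact mul_le_mul_of_nonneg_right (k2 i) hH
      _ = _ := mul_comm _ _
  · rw [mul_assoc, k3, Finset.mul_sum]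
    simp_rw [Matrix.mul_apply, map_sum, map_mul, Finset.sum_mul]
    rw [Finset.sum_comm]
    refine Finset.sum_congr rfl fun k _ => ?_
    rw [mul_left_comm, h3, Finset.mul_sum]
    exact Finset.sum_congr rfl fun j _ => by ring

theorem MatRep.poly (c : ℤ[X]) : MatRep θ e (aeval θ c) c.natDegree (plen c) := by
  refine ⟨Matrix.diagonal fun _ => c, fun i j => ?_, fun i => ?_, fun i => ?_⟩
  · rw [Matrix.diagonal_apply]
    split_ifs <;> simp
  · rw [Finset.sum_eq_single i (fun j _ hj => by rw [Matrix.diagonal_apply_ne' _ hj, plen_zero])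
      (by simp), Matrix.diagonal_apply_eq]
  · rw [Finset.sum_eq_single i
      (fun j _ hj => by rw [Matrix.diagonal_apply_ne' _ hj, map_zero, zero_mul]) (by simp),
      Matrix.diagonal_apply_eq]

theorem MatRep.one : MatRep θ e 1 0 1 := by
  have := MatRep.poly (θ := θ) (e := e) 1
  simpa [plen_one] using this

theorem MatRep.zero : MatRep θ e 0 0 0 := by
  have := MatRep.poly (θ := θ) (e := e) 0
  simpa using this

theorem MatRep.intCast (a : ℤ) : MatRep θ e a 0 |(a : ℝ)| := by
  have := MatRep.poly (θ := θ) (e := e) (C a)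
  rw [plen_C, aeval_C, natDegree_C] at this
  simpa using this

theorem MatRep.neg {v : ℂ} {D : ℕ} {H : ℝ} (h : MatRep θ e v D H) : MatRep θ e (-v) D H := by
  have := (MatRep.intCast (θ := θ) (e := e) (-1)).mul h (abs_nonneg _)
  simpa using this

theorem MatRep.sum {ι : Type*} (s : Finset ι) {v : ι → ℂ} {D : ℕ} {H : ι → ℝ}
    (h : ∀ i ∈ s, MatRep θ e (v i) D (H i)) : MatRep θ e (∑ i ∈ s, v i) D (∑ i ∈ s, H i) := by
  classical
  induction s using Finset.induction_on with
  | empty => simpa using MatRep.zero.mono (Nat.zero_le D) le_rfl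
  | insert a s ha ih =>
    rw [Finset.sum_insert ha, Finset.sum_insert ha]
    exact (h a (by simp)).add (ih fun i hi => h i (by simp [hi]))

theorem MatRep.pow {v : ℂ} {D : ℕ} {H : ℝ} (h : MatRep θ e v D H) (hH : 0 ≤ H) (k : ℕ) :
    MatRep θ e (v ^ k) (k * D) (H ^ k) := by
  induction k with
  | zero => simpa using MatRep.one
  | succ k ih =>
    rw [pow_succ, pow_succ, Nat.succ_mul]
    exact ih.mul h (pow_nonneg hH _)

theorem natDegree_det_le_of_forall {n : ℕ} (A : Matrix (Fin n) (Fin n) ℤ[X]) {D : ℕ}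
    (h : ∀ i j, (A i j).natDegree ≤ D) : A.det.natDegree ≤ n * D := by
  rw [Matrix.det_apply]
  refine natDegree_sum_le_of_forall_le _ _ fun σ _ => ?_
  refine (natDegree_smul_le _ _).trans ((natDegree_prod_le _ _).trans ?_)
  refine (Finset.sum_le_sum fun i _ => h _ _).trans ?_
  simp

theorem plen_det_le {n : ℕ} (A : Matrix (Fin n) (Fin n) ℤ[X]) {H : ℝ}
    (h : ∀ i j, plen (A i j) ≤ H) : plen A.det ≤ n.factorial * H ^ n := by
  rw [Matrix.det_apply]
  refine (plen_sum_le _ _).trans ?_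
  calc _ ≤ ∑ _σ : Equiv.Perm (Fin n), H ^ n := by
        refine Finset.sum_le_sum fun σ _ => ?_
        have h1 : plen (Equiv.Perm.sign σ • ∏ i, A (σ i) i) = plen (∏ i, A (σ i) i) := by
          rcases Int.units_eq_one_or (Equiv.Perm.sign σ) with hs | hs <;> rw [hs]
          · rw [one_smul]
          · rw [Units.neg_smul, one_smul, plen_neg]
        rw [h1]
        refine (plen_prod_le _ _).trans ?_
        refine (Finset.prod_le_prod (fun i _ => plen_nonneg _) fun i _ => h _ _).trans ?_
        simp
    _ = _ := by simp [Fintype.card_perm]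

theorem exists_norm_poly (he : PolyIndep θ e) (hn : 0 < n) :
    ∃ K : ℝ, 0 < K ∧ ∀ (v : ℂ) (D : ℕ) (H : ℝ), v ≠ 0 → 1 ≤ H → MatRep θ e v D H →
      ∃ R : ℤ[X], R ≠ 0 ∧ R.natDegree ≤ n * D ∧ plen R ≤ n.factorial * H ^ n ∧
        ‖aeval θ R‖ ≤ K * (H * max 1 ‖θ‖ ^ D) ^ n * ‖v‖ := by
  set i₀ : Fin n := ⟨0, hn⟩
  have he0 := he.ne_zero i₀
  set E : ℝ := ∑ i, ‖e i‖
  have hE : 0 < E := lt_of_lt_of_le (norm_pos_iff.2 he0)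
    (Finset.single_le_sum (f := fun i => ‖e i‖) (fun _ _ => norm_nonneg _) (Finset.mem_univ i₀))
  refine ⟨n * n.factorial * E / ‖e i₀‖, by positivity, ?_⟩
  rintro v D H hv hH ⟨A, h1, h2, h3⟩
  have hent : ∀ i j, plen (A i j) ≤ H := fun i j =>
    (Finset.single_le_sum (f := fun j => plen (A i j)) (fun _ _ => plen_nonneg _)
      (Finset.mem_univ j)).trans (h2 i)
  refine ⟨A.det, ?_, natDegree_det_le_of_forall A h1, plen_det_le A hent, ?_⟩
  · intro hdet
    obtain ⟨c, hc0, hc⟩ := Matrix.exists_vecMul_eq_zero_iff.2 hdet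
    apply hc0
    apply he
    have : v * ∑ i, aeval θ (c i) * e i = 0 := by
      calc v * ∑ i, aeval θ (c i) * e i = ∑ i, aeval θ (c i) * (v * e i) := by
            rw [Finset.mul_sum]; exact Finset.sum_congr rfl fun i _ => by ring
        _ = ∑ j, aeval θ (Matrix.vecMul c A j) * e j := by
            simp_rw [h3, Matrix.vecMul, dotProduct, map_sum, map_mul, Finset.mul_sum,
              Finset.sum_mul]
            rw [Finset.sum_comm]
            exact Finset.sum_congr rfl fun i _ => Finset.sum_congr rfl fun j _ => by ring
        _ = 0 := by rw [hc]; simp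
    exact (mul_eq_zero.1 this).resolve_left hv
  · have hΘ : 1 ≤ max 1 ‖θ‖ ^ D := one_le_pow₀ (le_max_left _ _)
    have key := norm_det_mul_norm_le (A.map (aeval θ)) e (fun i => v * e i)
      (by ext i; rw [h3]; rfl) (H := H * max 1 ‖θ‖ ^ D) (ε := E * ‖v‖)
      (one_le_mul_of_one_le_of_one_le hH hΘ) (fun i j => by
        refine (norm_aeval_le_plen _ (h1 i j) θ).trans ?_
        gcongr
        exact hent i j) (fun i => by
        rw [norm_mul, mul_comm]
        gcongr
        exact Finset.single_le_sum (f := fun i => ‖e i‖) (fun _ _ => norm_nonneg _)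
          (Finset.mem_univ i)) i₀
    rw [Fintype.card_fin] at key
    have hd : (A.map (aeval θ)).det = aeval θ A.det := by
      exact ((aeval θ : ℤ[X] →ₐ[ℤ] ℂ).toRingHom.map_det A).symm
    rw [hd] at key
    have : ‖aeval θ A.det‖ ≤ (n * n.factorial * (H * max 1 ‖θ‖ ^ D) ^ n * (E * ‖v‖)) / ‖e i₀‖ := by
      rwa [le_div_iff₀ (norm_pos_iff.2 he0)]
    refine this.trans (le_of_eq ?_)
    ring

end Representation

section Siegel

open Polynomial

variable {θ : ℂ} {n : ℕ} {e : Fin n → ℂ}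


open Int.Matrix in
theorem exists_siegel_solution (he : PolyIndep θ e) (hn : 0 < n) {α β : Type*} [Fintype α] [Fintype β]
    (v : α → β → ℂ) {D : ℕ} {H : ℝ} (hH : 1 ≤ H) (hα : 0 < Fintype.card α)
    (hcard : 4 * n * Fintype.card α ≤ Fintype.card β) (hv : ∀ a b, MatRep θ e (v a b) D H) :
    ∃ c : β → ℤ[X], c ≠ 0 ∧ (∀ b, (c b).natDegree ≤ D) ∧
      (∀ b, plen (c b) ≤ (D + 1) * (Fintype.card β * (D + 1) * H)) ∧
      ∀ a, ∑ b, aeval θ (c b) * v a b = 0 := by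
  classical
  choose A hA1 hA2 hA3 using hv
  set i₀ : Fin n := ⟨0, hn⟩
  let M : Matrix (α × Fin n × Fin (2 * D + 1)) (β × Fin (D + 1)) ℤ := fun x y =>
    if (y.2 : ℕ) ≤ x.2.2 then (A x.1 y.1 i₀ x.2.1).coeff (x.2.2 - y.2) else 0
  have hcα : Fintype.card (α × Fin n × Fin (2 * D + 1)) = Fintype.card α * (n * (2 * D + 1)) := by
    simp
  have hcβ : Fintype.card (β × Fin (D + 1)) = Fintype.card β * (D + 1) := by simp
  have hnα : 0 < Fintype.card α * (n * (2 * D + 1)) := by positivity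
  have h2 : 2 * (Fintype.card α * (n * (2 * D + 1))) ≤ Fintype.card β * (D + 1) := by
    calc 2 * (Fintype.card α * (n * (2 * D + 1))) ≤ 4 * n * Fintype.card α * (D + 1) := by
          nlinarith [Nat.zero_le (n * Fintype.card α)]
      _ ≤ _ := Nat.mul_le_mul_right _ hcard
  let _ : SeminormedAddCommGroup (Matrix (α × Fin n × Fin (2 * D + 1)) (β × Fin (D + 1)) ℤ) :=
    Matrix.seminormedAddCommGroup
  obtain ⟨t, ht0, htM, htn⟩ := Int.Matrix.exists_ne_zero_int_vec_norm_le M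
    (by rw [hcα, hcβ]; omega) (by rw [hcα]; exact hnα)
  rw [hcα, hcβ] at htn
  have hMn : ‖M‖ ≤ H := by
    rw [Matrix.norm_le_iff (by linarith)]
    intro x y
    simp only [M]
    split_ifs
    · rw [Int.norm_eq_abs]
      exact (abs_coeff_le_plen _ _).trans ((Finset.single_le_sum
        (f := fun j => plen (A x.1 y.1 i₀ j)) (fun _ _ => plen_nonneg _)
        (Finset.mem_univ x.2.1)).trans (hA2 _ _ i₀))
    · simp; linarith
  have hβ1 : (1 : ℝ) ≤ Fintype.card β * (D + 1) := by
    have : 1 ≤ Fintype.card β * (D + 1) := by omega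
    exact_mod_cast this
  have htb : ‖t‖ ≤ Fintype.card β * (D + 1) * H := by
    refine htn.trans ?_
    have hbase : 1 ≤ ((Fintype.card β * (D + 1) : ℕ) : ℝ) * max 1 ‖M‖ := by
      push_cast
      exact one_le_mul_of_one_le_of_one_le hβ1 (le_max_left _ _)
    calc _ ≤ (((Fintype.card β * (D + 1) : ℕ) : ℝ) * max 1 ‖M‖) ^ (1 : ℝ) := by
          refine Real.rpow_le_rpow_of_exponent_le hbase ?_
          have h2' : 2 * ((Fintype.card α * (n * (2 * D + 1)) : ℕ) : ℝ) ≤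
              ((Fintype.card β * (D + 1) : ℕ) : ℝ) := by exact_mod_cast h2
          have h3 : (0 : ℝ) < ((Fintype.card α * (n * (2 * D + 1)) : ℕ) : ℝ) := by
            exact_mod_cast hnα
          rw [div_le_one (by linarith)]
          linarith
      _ ≤ _ := by
          rw [Real.rpow_one]
          push_cast
          gcongr
          exact max_le hH hMn
  have htb' : ∀ y, |(t y : ℝ)| ≤ Fintype.card β * (D + 1) * H := fun y => by
    rw [← Int.norm_eq_abs]
    exact (norm_le_pi_norm t y).trans htb
  let c : β → ℤ[X] := fun b => ∑ k : Fin (D + 1), monomial (k : ℕ) (t (b, k))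
  have hcoeff : ∀ b (k : Fin (D + 1)), (c b).coeff k = t (b, k) := by
    intro b k
    simp only [c, finsetSum_coeff, coeff_monomial]
    rw [Finset.sum_eq_single k]
    · simp
    · intro k' _ hk'
      rw [if_neg (fun h => hk' (Fin.ext h))]
    · simp
  refine ⟨c, ?_, ?_, ?_, ?_⟩
  · intro h0
    apply ht0
    ext ⟨b, k⟩
    rw [← hcoeff, h0]; simp
  · intro b
    refine natDegree_sum_le_of_forall_le _ _ fun k _ => ?_
    exact (natDegree_monomial_le _).trans (by omega)
  · intro b
    refine (plen_sum_le _ _).trans ?_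
    simp only [plen_monomial]
    refine (Finset.sum_le_sum fun k _ => htb' (b, k)).trans ?_
    simp
  · intro a
    have hpoly : ∀ j, ∑ b, c b * A a b i₀ j = 0 := by
      intro j
      ext l
      rw [coeff_zero, finsetSum_coeff]
      by_cases hl : l < 2 * D + 1
      · have h3 := congrFun htM (a, j, ⟨l, hl⟩)
        rw [Matrix.mulVec, dotProduct, Fintype.sum_prod_type] at h3
        rw [← Pi.zero_apply (M := fun _ => ℤ) (a, j, (⟨l, hl⟩ : Fin (2 * D + 1))), ← h3]
        refine Finset.sum_congr rfl fun b _ => ?_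
        simp only [c, M, Finset.sum_mul, finsetSum_coeff]
        refine Finset.sum_congr rfl fun k _ => ?_
        rw [← C_mul_X_pow_eq_monomial, mul_assoc, coeff_C_mul, X_pow_mul, coeff_mul_X_pow']
        split_ifs <;> ring
      · refine Finset.sum_eq_zero fun b _ => ?_
        apply coeff_eq_zero_of_natDegree_lt
        refine natDegree_mul_le.trans_lt ?_
        have h4 := hA1 a b i₀ j
        have h5 : (c b).natDegree ≤ D := by
          refine natDegree_sum_le_of_forall_le _ _ fun k _ => ?_
          exact (natDegree_monomial_le _).trans (by omega)
        omega
    have h6 : (∑ b, aeval θ (c b) * v a b) * e i₀ = 0 := by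
      calc (∑ b, aeval θ (c b) * v a b) * e i₀
          = ∑ j, aeval θ (∑ b, c b * A a b i₀ j) * e j := by
            simp_rw [map_sum, map_mul, Finset.sum_mul, mul_assoc, hA3, Finset.mul_sum]
            rw [Finset.sum_comm]
        _ = 0 := by simp [hpoly]
    exact (mul_eq_zero.1 h6).resolve_right (he.ne_zero i₀)

end Siegel

section MonomialCount

open MvPolynomial

variable {σ : Type*}

/-- `MonoBound k a Q`: the polynomial `Q` is a signed sum of at most `a` monomials of degree at
most `k`. -/
inductive MonoBound (k : ℕ) : ℕ → MvPolynomial σ ℤ → Prop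
  | zero : MonoBound k 0 0
  | succ {a : ℕ} {Q : MvPolynomial σ ℤ} : MonoBound k a Q → MonoBound k (a + 1) Q
  | add_mono {a : ℕ} {Q : MvPolynomial σ ℤ} (s : List σ) (hs : s.length ≤ k) :
      MonoBound k a Q → MonoBound k (a + 1) (Q + (s.map X).prod)
  | sub_mono {a : ℕ} {Q : MvPolynomial σ ℤ} (s : List σ) (hs : s.length ≤ k) :
      MonoBound k a Q → MonoBound k (a + 1) (Q - (s.map X).prod)

namespace MonoBound

theorem mono_deg {k l a : ℕ} {Q : MvPolynomial σ ℤ} (h : MonoBound k a Q) (hkl : k ≤ l) :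
    MonoBound l a Q := by
  induction h with
  | zero => exact zero
  | succ _ ih => exact succ ih
  | add_mono s hs _ ih => exact add_mono s (hs.trans hkl) ih
  | sub_mono s hs _ ih => exact sub_mono s (hs.trans hkl) ih

theorem mono_count {k a b : ℕ} {Q : MvPolynomial σ ℤ} (h : MonoBound k a Q) (hab : a ≤ b) :
    MonoBound k b Q := by
  induction b, hab using Nat.le_induction with
  | base => exact h
  | succ _ _ ih => exact succ ih

theorem of_list (s : List σ) : MonoBound s.length 1 (s.map X : List (MvPolynomial σ ℤ)).prod := by
  have := add_mono s le_rfl (zero (k := s.length))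
  simpa using this

theorem of_X (i : σ) : MonoBound 1 1 (X i : MvPolynomial σ ℤ) := by
  simpa using of_list [i]

theorem one : MonoBound 0 1 (1 : MvPolynomial σ ℤ) := by
  simpa using of_list ([] : List σ)

theorem add {k a b : ℕ} {P Q : MvPolynomial σ ℤ} (hP : MonoBound k a P) (hQ : MonoBound k b Q) :
    MonoBound k (a + b) (P + Q) := by
  induction hQ with
  | zero => simpa using hP
  | succ _ ih => exact succ ih
  | add_mono s hs _ ih => rw [← add_assoc P]; exact add_mono s hs ih
  | sub_mono s hs _ ih => rw [← add_sub_assoc]; exact sub_mono s hs ih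

theorem neg {k a : ℕ} {Q : MvPolynomial σ ℤ} (hQ : MonoBound k a Q) : MonoBound k a (-Q) := by
  induction hQ with
  | zero => simpa using zero
  | succ _ ih => exact succ ih
  | add_mono s hs _ ih => rw [neg_add, ← sub_eq_add_neg]; exact sub_mono s hs ih
  | sub_mono s hs _ ih => rw [neg_sub', sub_neg_eq_add]; exact add_mono s hs ih

theorem sub {k a b : ℕ} {P Q : MvPolynomial σ ℤ} (hP : MonoBound k a P) (hQ : MonoBound k b Q) :
    MonoBound k (a + b) (P - Q) := by
  rw [sub_eq_add_neg]; exact hP.add hQ.neg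

theorem mul_list {k a : ℕ} {Q : MvPolynomial σ ℤ} (hQ : MonoBound k a Q) (s : List σ) :
    MonoBound (k + s.length) a (Q * (s.map X).prod) := by
  induction hQ with
  | zero => simpa using zero
  | succ _ ih => exact succ ih
  | add_mono t ht _ ih =>
    rw [add_mul, ← List.prod_append, ← List.map_append]
    exact add_mono _ (by rw [List.length_append]; omega) ih
  | sub_mono t ht _ ih =>
    rw [sub_mul, ← List.prod_append, ← List.map_append]
    exact sub_mono _ (by rw [List.length_append]; omega) ih

theorem mul {k l a b : ℕ} {P Q : MvPolynomial σ ℤ} (hP : MonoBound k a P) (hQ : MonoBound l b Q) :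
    MonoBound (k + l) (a * b) (P * Q) := by
  induction hQ with
  | zero => simpa using zero
  | succ _ ih => exact ih.mono_count (by rw [mul_add]; omega)
  | add_mono s hs _ ih =>
    rw [mul_add, mul_add, mul_one]
    exact ih.add ((hP.mul_list s).mono_deg (by omega))
  | sub_mono s hs _ ih =>
    rw [mul_sub, mul_add, mul_one]
    exact ih.sub ((hP.mul_list s).mono_deg (by omega))

theorem pow {k a : ℕ} {Q : MvPolynomial σ ℤ} (hQ : MonoBound k a Q) (m : ℕ) :
    MonoBound (m * k) (a ^ m) (Q ^ m) := by
  induction m with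
  | zero => simpa using one
  | succ m ih =>
    rw [pow_succ, pow_succ, Nat.succ_mul]
    exact ih.mul hQ

theorem natMul {k a : ℕ} {Q : MvPolynomial σ ℤ} (hQ : MonoBound k a Q) (m : ℕ) :
    MonoBound k (m * a) ((m : MvPolynomial σ ℤ) * Q) := by
  induction m with
  | zero => simpa using zero
  | succ m ih =>
    have h := ih.add hQ
    rwa [← Nat.succ_mul, ← add_one_mul, ← Nat.cast_succ] at h

variable {f : σ → MvPolynomial σ ℤ} {h B : ℕ}

theorem derivation_list (hf : ∀ i, MonoBound (h + 1) B (f i)) (s : List σ) :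
    MonoBound (s.length + h) (s.length * B)
      (mkDerivation ℤ f (s.map X : List (MvPolynomial σ ℤ)).prod) := by
  induction s with
  | nil => simpa using zero
  | cons i s ih =>
    rw [List.map_cons, List.prod_cons, Derivation.leibniz, mkDerivation_X, smul_eq_mul,
      smul_eq_mul, List.length_cons, Nat.succ_mul]
    have h1 := ((of_X i).mul ih).mono_deg (l := s.length + 1 + h) (by omega)
    have h2 := ((of_list s).mul (hf i)).mono_deg (l := s.length + 1 + h) (by omega)
    rw [one_mul] at h1 h2
    exact h1.add h2

theorem derivation {k a : ℕ} {Q : MvPolynomial σ ℤ} (hf : ∀ i, MonoBound (h + 1) B (f i))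
    (hQ : MonoBound k a Q) : MonoBound (k + h) (a * (k * B)) (mkDerivation ℤ f Q) := by
  have key : ∀ s : List σ, s.length ≤ k → MonoBound (k + h) (k * B)
      (mkDerivation ℤ f (s.map X : List (MvPolynomial σ ℤ)).prod) := fun s hs =>
    ((derivation_list hf s).mono_deg (by omega)).mono_count (Nat.mul_le_mul_right _ hs)
  induction hQ with
  | zero => simpa using zero
  | succ _ ih => exact ih.mono_count (Nat.mul_le_mul_right _ (Nat.le_succ _))
  | add_mono s hs _ ih => rw [map_add, Nat.succ_mul]; exact ih.add (key s hs)
  | sub_mono s hs _ ih => rw [map_sub, Nat.succ_mul]; exact ih.sub (key s hs)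

theorem iterate_derivation {k a : ℕ} {Q : MvPolynomial σ ℤ} (hf : ∀ i, MonoBound (h + 1) B (f i))
    (hQ : MonoBound k a Q) (t : ℕ) :
    MonoBound (k + t * h) (a * ((k + t * h) * B) ^ t) ((mkDerivation ℤ f)^[t] Q) := by
  have main : ∀ t m, t ≤ m → MonoBound (k + t * h) (a * ((k + m * h) * B) ^ t)
      ((mkDerivation ℤ f)^[t] Q) := by
    intro t m htm
    induction t with
    | zero => simpa using hQ
    | succ t ih =>
      rw [Function.iterate_succ_apply', Nat.succ_mul, ← add_assoc, pow_succ, ← mul_assoc]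
      refine ((ih (by omega)).derivation hf).mono_count ?_
      have : t * h ≤ m * h := Nat.mul_le_mul_right _ (by omega)
      gcongr
  exact main t t le_rfl

open Polynomial in
theorem matRep {θ : ℂ} {n : ℕ} {e : Fin n → ℂ} {γ : σ → ℂ} {d : ℂ} {δ : ℕ} {H : ℝ} (hH : 1 ≤ H)
    (hd : MatRep θ e d δ H) (hγ : ∀ i, MatRep θ e (d * γ i) δ H) {k a : ℕ}
    {Q : MvPolynomial σ ℤ} (hQ : MonoBound k a Q) :
    MatRep θ e (d ^ k * MvPolynomial.aeval γ Q) (k * δ) (a * H ^ k) := by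
  have hH0 : 0 ≤ H := zero_le_one.trans hH
  have hlist : ∀ s : List σ, MatRep θ e
      (d ^ s.length * MvPolynomial.aeval γ (s.map MvPolynomial.X : List (MvPolynomial σ ℤ)).prod)
      (s.length * δ) (H ^ s.length) := by
    intro s
    induction s with
    | nil => simpa using MatRep.one
    | cons i s ih =>
      rw [List.map_cons, List.prod_cons, map_mul, MvPolynomial.aeval_X, List.length_cons, pow_succ',
        pow_succ', Nat.succ_mul, add_comm (_ * _)]
      have := (hγ i).mul ih hH0
      rwa [mul_mul_mul_comm] at this
  have key : ∀ s : List σ, s.length ≤ k → MatRep θ e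
      (d ^ k * MvPolynomial.aeval γ (s.map MvPolynomial.X : List (MvPolynomial σ ℤ)).prod)
      (k * δ) (H ^ k) := by
    intro s hs
    obtain ⟨r, rfl⟩ := Nat.exists_eq_add_of_le hs
    have := (hd.pow hH0 r).mul (hlist s) (by positivity)
    rw [← mul_assoc, ← pow_add, ← add_mul, ← pow_add, add_comm r] at this
    exact this
  induction hQ with
  | zero => simpa using MatRep.zero.mono (Nat.zero_le _) le_rfl
  | succ _ ih =>
    refine ih.mono le_rfl ?_
    push_cast
    gcongr
    linarith
  | add_mono s hs _ ih =>
    rw [map_add, mul_add]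
    push_cast
    rw [add_mul, one_mul]
    exact ih.add (key s hs)
  | sub_mono s hs _ ih =>
    rw [map_sub, mul_sub, sub_eq_add_neg]
    push_cast
    rw [add_mul, one_mul]
    exact ih.add (key s hs).neg

end MonoBound

theorem hasDerivAt_aeval_mkDerivation {φ : σ → ℂ → ℂ} {f : σ → MvPolynomial σ ℤ} {z : ℂ}
    (hφ : ∀ i, HasDerivAt (φ i) (aeval (fun j => φ j z) (f i)) z) (Q : MvPolynomial σ ℤ) :
    HasDerivAt (fun w => aeval (fun j => φ j w) Q)
      (aeval (fun j => φ j z) (mkDerivation ℤ f Q)) z := by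
  induction Q using MvPolynomial.induction_on with
  | C a =>
    have h : mkDerivation ℤ f (C a) = 0 := Derivation.map_algebraMap _ a
    rw [h, map_zero]
    simp only [algHom_C]
    exact hasDerivAt_const z _
  | add P Q hP hQ =>
    simp only [map_add]
    exact hP.add hQ
  | mul_X P i hP =>
    simp only [map_mul, Derivation.leibniz, mkDerivation_X, smul_eq_mul, map_add, aeval_X]
    exact (hP.mul (hφ i)).congr_deriv (by ring)

theorem iteratedDeriv_aeval {φ : σ → ℂ → ℂ} {f : σ → MvPolynomial σ ℤ} {U : Set ℂ}
    (hU : IsOpen U) (hφ : ∀ z ∈ U, ∀ i, HasDerivAt (φ i) (aeval (fun j => φ j z) (f i)) z)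
    (t : ℕ) : ∀ (Q : MvPolynomial σ ℤ), ∀ z ∈ U, iteratedDeriv t (fun w => aeval (fun j => φ j w) Q) z =
      aeval (fun j => φ j z) ((mkDerivation ℤ f)^[t] Q) := by
  induction t with
  | zero => intro Q z _; simp
  | succ t ih =>
    intro Q z hz
    rw [iteratedDeriv_succ', Function.iterate_succ_apply, ← ih _ z hz]
    apply Filter.EventuallyEq.iteratedDeriv_eq
    filter_upwards [hU.mem_nhds hz] with w hw
    exact (hasDerivAt_aeval_mkDerivation (hφ w hw) Q).deriv

end MonomialCount

section RepresentationExistence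

open Polynomial IntermediateField

theorem exists_common_denominator {θ : ℂ} (P : Subring ℤ[X]) {ι : Type*} [Finite ι] (x : ι → ℂ)
    (hx : ∀ i, ∃ p ∈ P, ∃ q ∈ P, aeval θ q ≠ 0 ∧ aeval θ q * x i = aeval θ p) :
    ∃ q ∈ P, aeval θ q ≠ 0 ∧ ∀ i, ∃ p ∈ P, aeval θ q * x i = aeval θ p := by
  classical
  cases nonempty_fintype ι
  choose p hp q hq h0 h using hx
  refine ⟨∏ i, q i, P.prod_mem fun i _ => hq i, ?_, fun i => ?_⟩
  · rw [map_prod]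
    exact Finset.prod_ne_zero_iff.2 fun i _ => h0 i
  · refine ⟨p i * ∏ j ∈ Finset.univ.erase i, q j,
      P.mul_mem (hp i) (P.prod_mem fun i _ => hq i), ?_⟩
    rw [← Finset.mul_prod_erase _ _ (Finset.mem_univ i), map_mul, map_mul, ← h]
    ring

theorem exists_matrix_of_isAlgebraic {θ : ℂ} (P : Subring ℤ[X]) (K : IntermediateField ℚ ℂ)
    (hK : ∀ x ∈ K, ∃ p ∈ P, ∃ q ∈ P, aeval θ q ≠ 0 ∧ aeval θ q * x = aeval θ p)
    {σ : Type*} [Finite σ] (γ : σ → ℂ) (hγ : ∀ i, IsAlgebraic K (γ i)) :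
    ∃ n : ℕ, 0 < n ∧ ∃ e : Fin n → ℂ, LinearIndependent K e ∧ (∀ j, IsAlgebraic K (e j)) ∧
      ∃ q ∈ P, aeval θ q ≠ 0 ∧ ∃ A : σ → Matrix (Fin n) (Fin n) ℤ[X], (∀ i k j, A i k j ∈ P) ∧
        ∀ i k, aeval θ q * γ i * e k = ∑ j, aeval θ (A i k j) * e j := by
  have hfin : FiniteDimensional K (adjoin K (Set.range γ)) := by
    apply finiteDimensional_adjoin
    rintro _ ⟨i, rfl⟩
    exact (hγ i).isIntegral
  let E := adjoin K (Set.range γ)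
  let b := Module.finBasis K E
  have hg : ∀ i, γ i ∈ E := fun i => subset_adjoin _ _ ⟨i, rfl⟩
  let g : σ → E := fun i => ⟨γ i, hg i⟩
  obtain ⟨q, hq, hq0, h⟩ := exists_common_denominator (θ := θ) P
    (fun s : σ × Fin (Module.finrank K E) × Fin (Module.finrank K E) =>
      ((b.repr (g s.1 * b s.2.1) s.2.2 : K) : ℂ)) (fun s => hK _ (SetLike.coe_mem _))
  choose p hp hpe using h
  refine ⟨Module.finrank K E, Module.finrank_pos, fun j => (b j : ℂ), ?_, fun j => ?_, q, hq, hq0,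
    fun i k j => p (i, k, j), fun i k j => hp _, fun i k => ?_⟩
  · exact b.linearIndependent.map' E.val.toLinearMap
      (LinearMap.ker_eq_bot.2 E.val.injective)
  · exact (Algebra.IsAlgebraic.isAlgebraic (R := K) (b j)).algebraMap
  · have := congrArg (fun x : E => (x : ℂ)) (b.sum_repr (g i * b k))
    simp only [AddSubmonoidClass.coe_finsetSum, MulMemClass.coe_mul, IntermediateField.coe_smul]
      at this
    rw [mul_assoc, show γ i = g i from rfl, ← this, Finset.mul_sum]
    refine Finset.sum_congr rfl fun j _ => ?_
    rw [← hpe, mul_assoc]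
    rfl

theorem exists_matRep_of_matrix {θ : ℂ} {n : ℕ} {e : Fin n → ℂ} {σ : Type*} [Finite σ]
    {γ : σ → ℂ} {q : ℤ[X]} {δ : ℕ} (hq : q.natDegree ≤ δ) {A : σ → Matrix (Fin n) (Fin n) ℤ[X]}
    (hA : ∀ i k j, (A i k j).natDegree ≤ δ)
    (h : ∀ i k, aeval θ q * γ i * e k = ∑ j, aeval θ (A i k j) * e j) :
    ∃ H : ℝ, 1 ≤ H ∧ MatRep θ e (aeval θ q) δ H ∧ ∀ i, MatRep θ e (aeval θ q * γ i) δ H := by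
  cases nonempty_fintype σ
  have hnn : ∀ i k, 0 ≤ ∑ j, plen (A i k j) :=
    fun i k => Finset.sum_nonneg fun j _ => plen_nonneg _
  refine ⟨1 + plen q + ∑ i, ∑ k, ∑ j, plen (A i k j), ?_, ?_, fun i => ?_⟩
  · have : 0 ≤ ∑ i, ∑ k, ∑ j, plen (A i k j) :=
      Finset.sum_nonneg fun i _ => Finset.sum_nonneg fun k _ => hnn i k
    linarith [plen_nonneg q]
  · refine (MatRep.poly q).mono hq ?_
    have : 0 ≤ ∑ i, ∑ k, ∑ j, plen (A i k j) :=
      Finset.sum_nonneg fun i _ => Finset.sum_nonneg fun k _ => hnn i k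
    linarith
  · refine ⟨A i, hA i, fun k => ?_, h i⟩
    have h1 : ∑ j, plen (A i k j) ≤ ∑ k, ∑ j, plen (A i k j) :=
      Finset.single_le_sum (f := fun k => ∑ j, plen (A i k j)) (fun k _ => hnn i k)
        (Finset.mem_univ k)
    have h2 : ∑ k, ∑ j, plen (A i k j) ≤ ∑ i, ∑ k, ∑ j, plen (A i k j) :=
      Finset.single_le_sum (f := fun i => ∑ k, ∑ j, plen (A i k j))
        (fun i _ => Finset.sum_nonneg fun k _ => hnn i k) (Finset.mem_univ i)
    linarith [plen_nonneg q]

theorem exists_int_fraction_of_mem_adjoin {θ x : ℂ} (hx : x ∈ ℚ⟮θ⟯) :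
    ∃ p q : ℤ[X], aeval θ q ≠ 0 ∧ aeval θ q * x = aeval θ p := by
  obtain ⟨r, s, rfl⟩ := (mem_adjoin_simple_iff ℚ x).1 hx
  have key : ∀ r : ℚ[X], ∃ b : ℤ, b ≠ 0 ∧ ∃ p : ℤ[X], (b : ℂ) * aeval θ r = aeval θ p := by
    intro r
    obtain ⟨b, hb, hr⟩ := IsLocalization.integerNormalization_spec (nonZeroDivisors ℤ) r
    refine ⟨b, nonZeroDivisors.ne_zero hb, IsLocalization.integerNormalization (nonZeroDivisors ℤ) r, ?_⟩
    have := congrArg (aeval θ) hr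
    rw [aeval_map_algebraMap] at this
    rw [this]
    simp
  obtain ⟨b, hb, p, hp⟩ := key r
  obtain ⟨c, hc, q, hq⟩ := key s
  by_cases hs : aeval θ s = 0
  · exact ⟨0, 1, by simp, by simp [hs]⟩
  · refine ⟨C c * p, C b * q, ?_, ?_⟩
    · rw [map_mul, ← hq]
      simp [hb, hc, hs]
    · rw [map_mul, ← hq, map_mul, ← hp]
      rw [aeval_C, aeval_C, algebraMap_int_eq, eq_intCast, eq_intCast]
      field_simp

/-- Simultaneous matrix representation, over `ℤ[θ]`, of finitely many numbers algebraic over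
`ℚ(θ)`. -/
theorem exists_matRep_of_isAlgebraic_adjoin {θ : ℂ} (hθ : Transcendental ℤ θ) {σ : Type*} [Finite σ]
    (γ : σ → ℂ) (hγ : ∀ i, IsAlgebraic ℚ⟮θ⟯ (γ i)) :
    ∃ n : ℕ, 0 < n ∧ ∃ e : Fin n → ℂ, PolyIndep θ e ∧ ∃ d : ℂ, d ≠ 0 ∧ ∃ δ : ℕ, ∃ H : ℝ, 1 ≤ H ∧
      MatRep θ e d δ H ∧ ∀ i, MatRep θ e (d * γ i) δ H := by
  cases nonempty_fintype σ
  obtain ⟨n, hn, e, hli, -, q, -, hq0, A, -, hA⟩ := exists_matrix_of_isAlgebraic (θ := θ) ⊤ ℚ⟮θ⟯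
    (fun x hx => by
      obtain ⟨p, q, h1, h2⟩ := exists_int_fraction_of_mem_adjoin hx
      exact ⟨p, trivial, q, trivial, h1, h2⟩) γ hγ
  refine ⟨n, hn, e, fun c hc => ?_, aeval θ q, hq0, ?_⟩
  · have hmem : ∀ j, aeval θ (c j) ∈ ℚ⟮θ⟯ := by
      intro j
      have h1 := algebra_adjoin_le_adjoin ℚ {θ} 
        (Polynomial.aeval_mem_adjoin_singleton ℚ θ (p := (c j).map (algebraMap ℤ ℚ)))
      rwa [aeval_map_algebraMap] at h1
    have := Fintype.linearIndependent_iff.1 hli (fun j => ⟨_, hmem j⟩) hc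
    ext1 j
    by_contra hj
    exact hθ ⟨c j, hj, congrArg Subtype.val (this j)⟩
  · refine ⟨q.natDegree + ∑ i, ∑ k, ∑ j, (A i k j).natDegree, ?_⟩
    refine exists_matRep_of_matrix (Nat.le_add_right _ _) (fun i k j => ?_) hA
    have h0 : (A i k j).natDegree ≤ ∑ j, (A i k j).natDegree :=
      Finset.single_le_sum (f := fun j => (A i k j).natDegree) (fun _ _ => Nat.zero_le _)
        (Finset.mem_univ j)
    have h1 : ∑ j, (A i k j).natDegree ≤ ∑ k, ∑ j, (A i k j).natDegree :=
      Finset.single_le_sum (f := fun k => ∑ j, (A i k j).natDegree) (fun _ _ => Nat.zero_le _)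
        (Finset.mem_univ k)
    have h2 : ∑ k, ∑ j, (A i k j).natDegree ≤ ∑ i, ∑ k, ∑ j, (A i k j).natDegree :=
      Finset.single_le_sum (f := fun i => ∑ k, ∑ j, (A i k j).natDegree) (fun _ _ => Nat.zero_le _)
        (Finset.mem_univ i)
    omega

/-- Rational linear independence of algebraic numbers persists over `ℤ[θ]` for `θ` transcendental. -/
theorem polyIndep_of_isAlgebraic {θ : ℂ} (hθ : Transcendental ℤ θ) {n : ℕ} {e : Fin n → ℂ}
    (hli : LinearIndependent ℚ e) (halg : ∀ j, IsAlgebraic ℚ (e j)) : PolyIndep θ e := by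
  intro c hc
  let F := algebraicClosure ℚ ℂ
  have hθF : Transcendental F θ := by
    intro h
    have : Algebra.IsAlgebraic ℚ F := algebraicClosure.isAlgebraic ℚ ℂ
    have := h.restrictScalars ℚ
    exact hθ ((IsFractionRing.isAlgebraic_iff ℤ ℚ ℂ).2 this)
  have heF : ∀ j, e j ∈ F := fun j => mem_algebraicClosure_iff.2 (halg j)
  let G : F[X] := ∑ j, C (⟨e j, heF j⟩ : F) * (c j).map (algebraMap ℤ F)
  have hG : G = 0 := by
    by_contra h
    refine hθF ⟨G, h, ?_⟩
    rw [← hc]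
    simp only [G, map_sum, map_mul, aeval_C, aeval_map_algebraMap]
    exact Finset.sum_congr rfl fun j _ => mul_comm _ _
  ext1 j
  ext1 k
  have h1 := congrArg (fun g : F[X] => (g.coeff k : ℂ)) hG
  simp only [G, finsetSum_coeff, coeff_C_mul, coeff_map, coeff_zero,
    AddSubmonoidClass.coe_finsetSum, MulMemClass.coe_mul] at h1
  have h2 := Fintype.linearIndependent_iff.1 hli (fun j => ((c j).coeff k : ℚ)) (by
    rw [← ZeroMemClass.coe_zero F, ← h1]
    refine Finset.sum_congr rfl fun j _ => ?_
    rw [Algebra.smul_def, mul_comm]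
    simp) j
  exact_mod_cast h2

/-- Simultaneous matrix representation, over `ℤ`, of finitely many algebraic numbers. -/
theorem exists_matRep_of_isAlgebraic {θ : ℂ} (hθ : Transcendental ℤ θ) {σ : Type*} [Finite σ]
    (γ : σ → ℂ) (hγ : ∀ i, IsAlgebraic ℚ (γ i)) :
    ∃ n : ℕ, 0 < n ∧ ∃ e : Fin n → ℂ, PolyIndep θ e ∧ ∃ d : ℂ, d ≠ 0 ∧ ∃ H : ℝ, 1 ≤ H ∧
      MatRep θ e d 0 H ∧ ∀ i, MatRep θ e (d * γ i) 0 H := by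
  obtain ⟨n, hn, e, hli, halg, q, hq, hq0, A, hAP, hA⟩ := exists_matrix_of_isAlgebraic (θ := θ)
    (C : ℤ →+* ℤ[X]).range ⊥
    (fun x hx => by
      obtain ⟨r, rfl⟩ := IntermediateField.mem_bot.1 hx
      refine ⟨C r.num, ⟨_, rfl⟩, C r.den, ⟨_, rfl⟩, by simp, ?_⟩
      rw [aeval_C, aeval_C, algebraMap_int_eq, eq_intCast, eq_intCast, eq_ratCast]
      exact_mod_cast Rat.den_mul_eq_num r) γ
    (fun i => (hγ i).tower_top _)
  have hdeg : ∀ p ∈ (C : ℤ →+* ℤ[X]).range, p.natDegree ≤ 0 := by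
    rintro _ ⟨a, rfl⟩
    simp
  refine ⟨n, hn, e, polyIndep_of_isAlgebraic hθ ?_ fun j => ?_, aeval θ q, hq0, ?_⟩
  · exact hli.restrict_scalars' ℚ
  · exact (halg j).restrictScalars ℚ
  · exact exists_matRep_of_matrix (hdeg q hq) (fun i k j => hdeg _ (hAP i k j)) hA

end RepresentationExistence

section RemovableSingularities

open Filter Topology Metric

/-- `f` is meromorphic at `z` without a pole there. -/
def RegularAt (f : ℂ → ℂ) (z : ℂ) : Prop := MeromorphicAt f z ∧ 0 ≤ meromorphicOrderAt f z

theorem AnalyticAt.regularAt {f : ℂ → ℂ} {z : ℂ} (h : AnalyticAt ℂ f z) : RegularAt f z :=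
  ⟨h.meromorphicAt, h.meromorphicOrderAt_nonneg⟩

namespace RegularAt

variable {f g : ℂ → ℂ} {z : ℂ}

theorem congr (h : RegularAt f z) (hfg : f =ᶠ[𝓝[≠] z] g) : RegularAt g z :=
  ⟨h.1.congr hfg, (meromorphicOrderAt_congr hfg) ▸ h.2⟩

theorem add (hf : RegularAt f z) (hg : RegularAt g z) : RegularAt (fun w => f w + g w) z :=
  ⟨hf.1.add hg.1, (le_min hf.2 hg.2).trans (meromorphicOrderAt_add hf.1 hg.1)⟩

theorem mul (hf : RegularAt f z) (hg : RegularAt g z) : RegularAt (fun w => f w * g w) z := by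
  refine ⟨hf.1.mul hg.1, ?_⟩
  have := meromorphicOrderAt_mul hf.1 hg.1
  exact this.symm ▸ add_nonneg hf.2 hg.2

theorem const (c : ℂ) : RegularAt (fun _ => c) z := analyticAt_const.regularAt

theorem pow (hf : RegularAt f z) (n : ℕ) : RegularAt (fun w => f w ^ n) z := by
  induction n with
  | zero => simpa using const 1
  | succ n ih => simpa only [pow_succ] using ih.mul hf

theorem sum {ι : Type*} (s : Finset ι) {f : ι → ℂ → ℂ} (hf : ∀ i ∈ s, RegularAt (f i) z) :
    RegularAt (fun w => ∑ i ∈ s, f i w) z := by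
  classical
  induction s using Finset.induction_on with
  | empty => simpa using const 0
  | insert i s hi ih =>
    simp only [Finset.sum_insert hi]
    exact (hf i (Finset.mem_insert_self _ _)).add
      (ih fun j hj => hf j (Finset.mem_insert_of_mem hj))

end RegularAt

theorem exists_analyticOnNhd_of_regularAt {f : ℂ → ℂ} {U : Set ℂ}
    (hf : ∀ z ∈ U, RegularAt f z) :
    ∃ F : ℂ → ℂ, AnalyticOnNhd ℂ F U ∧ ∀ z ∈ U, AnalyticAt ℂ f z → F z = f z := by
  have hm : MeromorphicOn f U := fun z hz => (hf z hz).1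
  refine ⟨toMeromorphicNFOn f U, fun z hz => ?_, fun z hz ha => ?_⟩
  · rw [← (meromorphicNFOn_toMeromorphicNFOn f U hz).meromorphicOrderAt_nonneg_iff_analyticAt,
      meromorphicOrderAt_toMeromorphicNFOn hm hz]
    exact (hf z hz).2
  · rw [toMeromorphicNFOn_eq_toMeromorphicNFAt hm hz,
      toMeromorphicNFAt_eq_self.2 ha.meromorphicNFAt]

theorem regularAt_mul_inv_pow {f : ℂ → ℂ} {w : ℂ} {T : ℕ} (hf : AnalyticAt ℂ f w)
    (h : ∀ t < T, iteratedDeriv t f w = 0) : RegularAt (fun z => f z * ((z - w) ^ T)⁻¹) w := by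
  obtain ⟨g, hg, hfg⟩ := (natCast_le_analyticOrderAt hf).1
    ((natCast_le_analyticOrderAt_iff_iteratedDeriv_eq_zero hf).2 h)
  refine hg.regularAt.congr ?_
  filter_upwards [hfg.filter_mono nhdsWithin_le_nhds, self_mem_nhdsWithin] with z hz hzw
  have : (z - w) ^ T ≠ 0 := pow_ne_zero _ (sub_ne_zero.2 hzw)
  rw [hz, smul_eq_mul]
  field_simp

end RemovableSingularities

section Extrapolation

open Filter Topology Metric

/-- Two functions meromorphic in the plane, with at most double poles located in a set `Λ` with
quadratic counting function, and with linear growth away from the poles. -/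
structure DoublePoleGrowth (f₁ f₂ : ℂ → ℂ) (Λ : Set ℂ) (C : ℕ) : Prop where
  pos : 1 ≤ C
  analytic₁ : ∀ z ∉ Λ, AnalyticAt ℂ f₁ z
  analytic₂ : ∀ z ∉ Λ, AnalyticAt ℂ f₂ z
  regular₁ : ∀ z, RegularAt (fun w => (w - z) ^ 2 * f₁ w) z
  regular₂ : ∀ z, RegularAt (fun w => (w - z) ^ 2 * f₂ w) z
  count : ∀ R : ℝ, 1 ≤ R → ∃ S : Finset ℂ, (S : Set ℂ) = Λ ∩ closedBall 0 R ∧ (S.card : ℝ) ≤ C * R ^ 2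
  growth : ∀ z ∉ Λ, ∃ l ∈ Λ, ‖z - l‖ ≤ C ∧ ‖f₁ z‖ * ‖z - l‖ ^ 2 ≤ C * (1 + ‖z‖) ∧
    ‖f₂ z‖ * ‖z - l‖ ^ 2 ≤ C * (1 + ‖z‖)

/-- The polynomial combination of two functions with coefficients `c`, of degree less than `L` in
each of them. -/
def polyComb (f₁ f₂ : ℂ → ℂ) {L : ℕ} (c : Fin L × Fin L → ℂ) (z : ℂ) : ℂ :=
  ∑ b, c b * (f₁ z ^ (b.1 : ℕ) * f₂ z ^ (b.2 : ℕ))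

variable {f₁ f₂ : ℂ → ℂ} {Λ : Set ℂ} {C : ℕ}

theorem DoublePoleGrowth.analyticAt_polyComb (h : DoublePoleGrowth f₁ f₂ Λ C) {L : ℕ}
    (c : Fin L × Fin L → ℂ) {z : ℂ} (hz : z ∉ Λ) : AnalyticAt ℂ (polyComb f₁ f₂ c) z := by
  unfold polyComb
  have h1 := h.analytic₁ z hz
  have h2 := h.analytic₂ z hz
  fun_prop

theorem DoublePoleGrowth.regularAt_polyComb (h : DoublePoleGrowth f₁ f₂ Λ C) {L : ℕ}
    (c : Fin L × Fin L → ℂ) (z : ℂ) :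
    RegularAt (fun w => polyComb f₁ f₂ c w * (w - z) ^ (4 * L)) z := by
  have : (fun w => polyComb f₁ f₂ c w * (w - z) ^ (4 * L)) = fun w => ∑ b,
      c b * ((((w - z) ^ 2 * f₁ w) ^ (b.1 : ℕ) * ((w - z) ^ 2 * f₂ w) ^ (b.2 : ℕ)) *
        (w - z) ^ (4 * L - (2 * (b.1 : ℕ) + 2 * (b.2 : ℕ)))) := by
    funext w
    rw [polyComb, Finset.sum_mul]
    refine Finset.sum_congr rfl fun b _ => ?_
    have hb : 4 * L = (2 * (b.1 : ℕ) + 2 * (b.2 : ℕ)) +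
        (4 * L - (2 * (b.1 : ℕ) + 2 * (b.2 : ℕ))) := by
      have := b.1.2; have := b.2.2
      omega
    conv_lhs => rw [hb]
    rw [mul_pow, mul_pow, pow_add, pow_add, pow_mul, pow_mul]
    ring
  rw [this]
  refine RegularAt.sum _ fun b _ => (RegularAt.const _).mul
    ((((h.regular₁ z).pow _).mul ((h.regular₂ z).pow _)).mul ?_)
  exact AnalyticAt.regularAt (by fun_prop)

/-- Pointwise bound for a polynomial combination near a pole. -/
theorem norm_polyComb_mul_le {L : ℕ} {c : Fin L × Fin L → ℂ} {H B D : ℝ} {z l : ℂ}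
    (hc : ∀ b, ‖c b‖ ≤ H) (hB : 1 ≤ B) (hD : 1 ≤ D) (hzl : ‖z - l‖ ≤ D)
    (h₁ : ‖f₁ z‖ * ‖z - l‖ ^ 2 ≤ B) (h₂ : ‖f₂ z‖ * ‖z - l‖ ^ 2 ≤ B) :
    ‖polyComb f₁ f₂ c z‖ * ‖z - l‖ ^ (4 * L) ≤ L ^ 2 * (H * (B ^ (2 * L) * D ^ (4 * L))) := by
  have hterm : ∀ b : Fin L × Fin L, ‖c b * (f₁ z ^ (b.1 : ℕ) * f₂ z ^ (b.2 : ℕ))‖ *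
      ‖z - l‖ ^ (4 * L) ≤ H * (B ^ (2 * L) * D ^ (4 * L)) := by
    intro b
    have hb : 4 * L = (2 * (b.1 : ℕ) + 2 * (b.2 : ℕ)) +
        (4 * L - (2 * (b.1 : ℕ) + 2 * (b.2 : ℕ))) := by
      have := b.1.2; have := b.2.2
      omega
    have hH : 0 ≤ H := (norm_nonneg _).trans (hc b)
    calc ‖c b * (f₁ z ^ (b.1 : ℕ) * f₂ z ^ (b.2 : ℕ))‖ * ‖z - l‖ ^ (4 * L)
        = ‖c b‖ * (((‖f₁ z‖ * ‖z - l‖ ^ 2) ^ (b.1 : ℕ) * (‖f₂ z‖ * ‖z - l‖ ^ 2) ^ (b.2 : ℕ)) *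
          ‖z - l‖ ^ (4 * L - (2 * (b.1 : ℕ) + 2 * (b.2 : ℕ)))) := by
          conv_lhs => rw [hb]
          rw [norm_mul, norm_mul, norm_pow, norm_pow]
          ring
      _ ≤ H * ((B ^ (b.1 : ℕ) * B ^ (b.2 : ℕ)) *
          D ^ (4 * L - (2 * (b.1 : ℕ) + 2 * (b.2 : ℕ)))) := by
          gcongr
          exact hc b
      _ ≤ H * (B ^ (2 * L) * D ^ (4 * L)) := by
          rw [← pow_add]
          have h3 : (b.1 : ℕ) + (b.2 : ℕ) ≤ 2 * L := by
            have := b.1.2; have := b.2.2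
            omega
          gcongr
          exact Nat.sub_le _ _
  calc ‖polyComb f₁ f₂ c z‖ * ‖z - l‖ ^ (4 * L)
      ≤ (∑ b : Fin L × Fin L, ‖c b * (f₁ z ^ (b.1 : ℕ) * f₂ z ^ (b.2 : ℕ))‖) *
        ‖z - l‖ ^ (4 * L) := by
        gcongr
        exact norm_sum_le _ _
    _ ≤ ∑ _b : Fin L × Fin L, H * (B ^ (2 * L) * D ^ (4 * L)) := by
        rw [Finset.sum_mul]
        exact Finset.sum_le_sum fun b _ => hterm b
    _ = L ^ 2 * (H * (B ^ (2 * L) * D ^ (4 * L))) := by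
        simp only [Finset.sum_const, Finset.card_univ, Fintype.card_prod, Fintype.card_fin,
          nsmul_eq_mul]
        push_cast
        ring

end Extrapolation

section Extrapolation

open Filter Topology Metric

variable {f₁ f₂ : ℂ → ℂ} {Λ : Set ℂ} {C : ℕ}

theorem DoublePoleGrowth.norm_mul_prod_le (h : DoublePoleGrowth f₁ f₂ Λ C) {L : ℕ}
    {c : Fin L × Fin L → ℂ} {H r : ℝ} (hc : ∀ b, ‖c b‖ ≤ H) (hH : 0 ≤ H) (hr : 1 ≤ r) {S : Finset ℂ}
    (hS : (S : Set ℂ) = Λ ∩ closedBall 0 ((10 + C) * r)) {z : ℂ} (hz : z ∉ Λ) (hzr : ‖z‖ ≤ 10 * r) :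
    ‖polyComb f₁ f₂ c z‖ * ∏ l ∈ S, ‖z - l‖ ^ (4 * L) ≤
      L ^ 2 * (H * ((11 * C * r) ^ (2 * L) * (C : ℝ) ^ (4 * L))) *
        ((20 + C) * r) ^ (4 * L * S.card) := by
  obtain ⟨l, hl, hlz, h1, h2⟩ := h.growth z hz
  have hC : (1 : ℝ) ≤ C := by exact_mod_cast h.pos
  have hlS : l ∈ S := by
    rw [← Finset.mem_coe, hS]
    refine ⟨hl, ?_⟩
    rw [mem_closedBall_zero_iff]
    have : ‖l‖ ≤ ‖z‖ + ‖z - l‖ := by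
      calc ‖l‖ = ‖z - (z - l)‖ := by congr 1; ring
        _ ≤ _ := norm_sub_le _ _
    nlinarith
  have hB : (C : ℝ) * (1 + ‖z‖) ≤ 11 * C * r := by nlinarith
  have hB1 : 1 ≤ 11 * C * r := by nlinarith
  have hA : 1 ≤ (20 + C) * r := by nlinarith
  rw [← Finset.mul_prod_erase _ _ hlS, ← mul_assoc]
  refine mul_le_mul (norm_polyComb_mul_le hc hB1 hC hlz (h1.trans hB) (h2.trans hB)) ?_
    (Finset.prod_nonneg fun _ _ => by positivity) (by positivity)
  calc ∏ l ∈ S.erase l, ‖z - l‖ ^ (4 * L) ≤ ∏ l ∈ S.erase l, ((20 + C) * r) ^ (4 * L) := by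
        refine Finset.prod_le_prod (fun _ _ => by positivity) fun m hm => ?_
        have hm' : m ∈ (S : Set ℂ) := Finset.mem_of_mem_erase hm
        rw [hS] at hm'
        have := mem_closedBall_zero_iff.1 hm'.2
        gcongr
        refine (norm_sub_le _ _).trans ?_
        linarith
    _ = ((20 + C) * r) ^ (4 * L * (S.erase l).card) := by
        rw [Finset.prod_const, ← pow_mul]
    _ ≤ _ := by
        gcongr
        exact Finset.erase_subset _ _

theorem DoublePoleGrowth.norm_iteratedDeriv_le_aux (h : DoublePoleGrowth f₁ f₂ Λ C) {L T : ℕ}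
    {c : Fin L × Fin L → ℂ} {H r ρ : ℝ} (hc : ∀ b, ‖c b‖ ≤ H) (hH : 0 ≤ H) (hr : 1 ≤ r) {S : Finset ℂ}
    (hS : (S : Set ℂ) = Λ ∩ closedBall 0 ((10 + C) * r)) {W : Finset ℂ} (hT : 0 < T)
    (hWr : ∀ w ∈ W, ‖w‖ ≤ r) (hWΛ : ∀ w ∈ W, w ∉ Λ)
    (hW : ∀ w ∈ W, ∀ t < T, iteratedDeriv t (polyComb f₁ f₂ c) w = 0)
    (hρ : 0 < ρ) (hρ1 : ρ ≤ 1) {w₀ : ℂ} (hw₀ : ‖w₀‖ ≤ r) (hw₀Λ : ∀ l ∈ Λ, 2 * ρ ≤ ‖w₀ - l‖) (t : ℕ) :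
    ‖iteratedDeriv t (polyComb f₁ f₂ c) w₀‖ ≤ t.factorial *
      (L ^ 2 * (H * ((11 * C * r) ^ (2 * L) * (C : ℝ) ^ (4 * L))) *
        ((20 + C) * r) ^ (4 * L * S.card) * (ρ⁻¹) ^ (4 * L * S.card) * (2⁻¹) ^ (T * W.card)) /
        ρ ^ t := by
  classical
  set f := polyComb f₁ f₂ c with hf
  set M : ℝ := L ^ 2 * (H * ((11 * C * r) ^ (2 * L) * (C : ℝ) ^ (4 * L))) *
        ((20 + C) * r) ^ (4 * L * S.card) with hM
  have hM0 : 0 ≤ M := by positivity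
  have hC : (1 : ℝ) ≤ C := by exact_mod_cast h.pos
  let A : ℂ → ℂ := fun z => ∏ l ∈ S, (z - l) ^ (4 * L)
  let B : ℂ → ℂ := fun z => ∏ w ∈ W, (z - w) ^ T
  have hAan : ∀ z, AnalyticAt ℂ A z := fun z => by
    refine Finset.analyticAt_fun_prod _ fun l _ => ?_
    fun_prop
  have hBan : ∀ z, AnalyticAt ℂ B z := fun z => by
    refine Finset.analyticAt_fun_prod _ fun l _ => ?_
    fun_prop
  have hB0 : ∀ z ∉ W, B z ≠ 0 := fun z hz => Finset.prod_ne_zero_iff.2 fun w hw =>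
    pow_ne_zero _ (sub_ne_zero.2 (by rintro rfl; exact hz hw))
  let g : ℂ → ℂ := fun z => f z * A z * (B z)⁻¹
  have hgan : ∀ z, z ∉ Λ → z ∉ W → AnalyticAt ℂ g z := fun z hz hzW =>
    ((h.analyticAt_polyComb c hz).mul (hAan z)).mul ((hBan z).inv (hB0 z hzW))
  have hreg : ∀ z ∈ ball (0 : ℂ) (10 * r), RegularAt g z := by
    intro z hz
    have hz' := mem_ball_zero_iff.1 hz
    by_cases hzΛ : z ∈ Λ
    · have hzS : z ∈ S := by
        rw [← Finset.mem_coe, hS]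
        refine ⟨hzΛ, mem_closedBall_zero_iff.2 ?_⟩
        nlinarith
      have hzW : z ∉ W := fun hw => hWΛ z hw hzΛ
      have : g = fun w => (f w * (w - z) ^ (4 * L)) * ((∏ l ∈ S.erase z, (w - l) ^ (4 * L)) *
          (B w)⁻¹) := by
        funext w
        simp only [g, A]
        rw [← Finset.mul_prod_erase _ _ hzS]
        ring
      rw [this]
      refine (h.regularAt_polyComb c z).mul (AnalyticAt.regularAt ?_)
      refine AnalyticAt.mul (Finset.analyticAt_fun_prod _ fun l _ => ?_)
        ((hBan z).inv (hB0 z hzW))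
      fun_prop
    · by_cases hzW : z ∈ W
      · have : g = fun w => (f w * ((w - z) ^ T)⁻¹) * (A w *
            (∏ v ∈ W.erase z, (w - v) ^ T)⁻¹) := by
          funext w
          simp only [g, B]
          rw [← Finset.mul_prod_erase _ _ hzW, mul_inv]
          ring
        rw [this]
        refine (regularAt_mul_inv_pow (h.analyticAt_polyComb c hzΛ) (hW z hzW)).mul
          (AnalyticAt.regularAt ?_)
        refine (hAan z).mul (AnalyticAt.inv (Finset.analyticAt_fun_prod _ fun l _ => ?_) ?_)
        · fun_prop
        · refine Finset.prod_ne_zero_iff.2 fun w hw => pow_ne_zero _ (sub_ne_zero.2 ?_)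
          exact (Finset.ne_of_mem_erase hw).symm
      · exact (hgan z hzΛ hzW).regularAt
  obtain ⟨G, hGan, hGg⟩ := exists_analyticOnNhd_of_regularAt hreg
  -- bound on the large sphere
  have hbound : ∀ z ∈ sphere (0 : ℂ) (9 * r), ‖G z‖ ≤ M / (7 * r) ^ (T * W.card) := by
    intro z hz
    have hz' := mem_sphere_zero_iff_norm.1 hz
    have hzball : z ∈ ball (0 : ℂ) (10 * r) := mem_ball_zero_iff.2 (by linarith)
    have hcont : Tendsto (fun w => ‖G w‖) (𝓝[≠] z) (𝓝 ‖G z‖) :=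
      ((hGan z hzball).continuousAt.norm.tendsto).mono_left nhdsWithin_le_nhds
    refine le_of_tendsto hcont ?_
    have e1 : ∀ᶠ w in 𝓝[≠] z, w ∈ ball (0 : ℂ) (10 * r) :=
      nhdsWithin_le_nhds (isOpen_ball.mem_nhds hzball)
    have e2 : ∀ᶠ w in 𝓝[≠] z, 8 * r < ‖w‖ :=
      (continuous_norm.continuousAt.eventually (lt_mem_nhds (by
        show 8 * r < ‖z‖
        rw [hz']; linarith))).filter_mono
        nhdsWithin_le_nhds
    have e3 : ∀ᶠ w in 𝓝[≠] z, w ∉ S := by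
      have : ∀ᶠ w in 𝓝 z, w ∉ S.erase z :=
        (Finset.finite_toSet (S.erase z)).isClosed.isOpen_compl.mem_nhds (by simp)
      filter_upwards [this.filter_mono nhdsWithin_le_nhds, self_mem_nhdsWithin] with w h1 h2 h3
      exact h1 (Finset.mem_erase.2 ⟨h2, h3⟩)
    filter_upwards [e1, e2, e3] with w hw1 hw2 hw3
    have hw1' := mem_ball_zero_iff.1 hw1
    have hwΛ : w ∉ Λ := fun hl => hw3 (by
      rw [← Finset.mem_coe, hS]
      refine ⟨hl, mem_closedBall_zero_iff.2 ?_⟩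
      nlinarith)
    have hwW : w ∉ W := fun hl => by linarith [hWr w hl]
    rw [hGg w hw1 (hgan w hwΛ hwW)]
    simp only [g, A, B, norm_mul, norm_inv, norm_prod, norm_pow]
    rw [← div_eq_mul_inv]
    refine div_le_div₀ hM0 (h.norm_mul_prod_le hc hH hr hS hwΛ hw1'.le) (by positivity) ?_
    rw [pow_mul, ← Finset.prod_const]
    refine Finset.prod_le_prod (fun _ _ => by positivity) fun v hv => ?_
    gcongr
    have := norm_sub_norm_le w v
    linarith [hWr v hv]
  have hmax : ∀ z ∈ closedBall (0 : ℂ) (9 * r), ‖G z‖ ≤ M / (7 * r) ^ (T * W.card) := by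
    intro z hz
    have hr9 : 9 * r ≠ 0 := by positivity
    refine Complex.norm_le_of_forall_mem_frontier_norm_le (U := ball 0 (9 * r)) isBounded_ball ?_ ?_ ?_
    · refine DifferentiableOn.diffContOnCl fun w hw => ?_
      rw [closure_ball _ hr9] at hw
      exact (hGan w (closedBall_subset_ball (by linarith) hw)).differentiableAt.differentiableWithinAt
    · rw [frontier_ball _ hr9]
      exact hbound
    · rwa [closure_ball _ hr9]
  -- bound on the small circle
  have hnear : ∀ z ∈ closedBall w₀ ρ, z ∉ Λ := by
    intro z hz hl
    have h1 := hw₀Λ z hl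
    have h2 := mem_closedBall'.1 hz
    rw [dist_eq_norm] at h2
    linarith
  have hsmall : ∀ z ∈ sphere w₀ ρ, ‖f z‖ ≤
      M * (ρ⁻¹) ^ (4 * L * S.card) * (2⁻¹) ^ (T * W.card) := by
    intro z hz
    have hzc : z ∈ closedBall w₀ ρ := sphere_subset_closedBall hz
    have hzΛ := hnear z hzc
    by_cases hzW : z ∈ W
    · have := hW z hzW 0 hT
      rw [iteratedDeriv_zero] at this
      rw [this, norm_zero]
      positivity
    have hzn : ‖z‖ ≤ 2 * r := by
      have h2 := mem_sphere_iff_norm.1 hz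
      have h3 : ‖z‖ ≤ ‖w₀‖ + ‖z - w₀‖ := by
        calc ‖z‖ = ‖w₀ + (z - w₀)‖ := by congr 1; ring
          _ ≤ _ := norm_add_le _ _
      linarith
    have hA : ρ ^ (4 * L * S.card) ≤ ‖A z‖ := by
      simp only [A, norm_prod, norm_pow]
      rw [pow_mul, ← Finset.prod_const]
      refine Finset.prod_le_prod (fun _ _ => by positivity) fun l hl => ?_
      gcongr
      have hl' : l ∈ (S : Set ℂ) := hl
      rw [hS] at hl'
      have h1 := hw₀Λ l hl'.1
      have h2 := mem_sphere_iff_norm.1 hz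
      have h3 : ‖w₀ - l‖ ≤ ‖z - l‖ + ‖z - w₀‖ := by
        calc ‖w₀ - l‖ = ‖(z - l) - (z - w₀)‖ := by congr 1; ring
          _ ≤ _ := norm_sub_le _ _
      linarith
    have hA0 : 0 < ‖A z‖ := lt_of_lt_of_le (by positivity) hA
    have hB : ‖B z‖ ≤ (3 * r) ^ (T * W.card) := by
      simp only [B, norm_prod, norm_pow]
      rw [pow_mul, ← Finset.prod_const]
      refine Finset.prod_le_prod (fun _ _ => by positivity) fun w hw => ?_
      gcongr
      refine (norm_sub_le _ _).trans ?_
      linarith [hWr w hw]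
    have hG := hmax z (mem_closedBall_zero_iff.2 (by linarith))
    rw [hGg z (mem_ball_zero_iff.2 (by linarith)) (hgan z hzΛ hzW)] at hG
    have hfz : ‖f z‖ = ‖g z‖ * ‖B z‖ / ‖A z‖ := by
      simp only [g, norm_mul, norm_inv]
      have := norm_pos_iff.2 (hB0 z hzW)
      field_simp
    rw [hfz]
    calc ‖g z‖ * ‖B z‖ / ‖A z‖
        ≤ M / (7 * r) ^ (T * W.card) * (3 * r) ^ (T * W.card) / ρ ^ (4 * L * S.card) := by
          gcongr
      _ = M * (ρ⁻¹) ^ (4 * L * S.card) * ((3 * r) ^ (T * W.card) / (7 * r) ^ (T * W.card)) := by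
          rw [inv_pow]; field_simp
      _ ≤ M * (ρ⁻¹) ^ (4 * L * S.card) * (2⁻¹) ^ (T * W.card) := by
          rw [← div_pow]
          gcongr
          rw [div_le_iff₀ (by positivity)]
          linarith
  refine Complex.norm_iteratedDeriv_le_of_forall_mem_sphere_norm_le t hρ ?_ hsmall
  refine DifferentiableOn.diffContOnCl fun w hw => ?_
  rw [closure_ball _ hρ.ne'] at hw
  exact (h.analyticAt_polyComb c (hnear w hw)).differentiableAt.differentiableWithinAt

theorem DoublePoleGrowth.exists_norm_iteratedDeriv_le (h : DoublePoleGrowth f₁ f₂ Λ C) {ρ : ℝ}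
    (hρ : 0 < ρ) (hρ1 : ρ ≤ 1) : ∃ C' : ℕ, ∀ (L T r : ℕ) (c : Fin L × Fin L → ℂ) (H : ℝ)
      (W : Finset ℂ) (w₀ : ℂ) (t : ℕ), 0 < T → 2 ≤ r → 0 ≤ H → (∀ b, ‖c b‖ ≤ H) →
      (∀ w ∈ W, ‖w‖ ≤ r ∧ w ∉ Λ ∧ ∀ t < T, iteratedDeriv t (polyComb f₁ f₂ c) w = 0) →
      ‖w₀‖ ≤ r → (∀ l ∈ Λ, 2 * ρ ≤ ‖w₀ - l‖) →
      ‖iteratedDeriv t (polyComb f₁ f₂ c) w₀‖ ≤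
        t.factorial * (H * (r : ℝ) ^ (C' * L * r ^ 2) * (2⁻¹) ^ (T * W.card)) / ρ ^ t := by
  obtain ⟨k, hk⟩ := exists_nat_ge ρ⁻¹
  set K : ℕ := 20 + 11 * C + k with hK
  refine ⟨(K + 1) * (8 + 8 * (C * (10 + C) ^ 2)), ?_⟩
  intro L T r c H W w₀ t hT hr hH hc hW hw₀ hw₀Λ
  have hr1 : (1 : ℝ) ≤ r := by exact_mod_cast (by omega : 1 ≤ r)
  have hC : (1 : ℝ) ≤ C := by exact_mod_cast h.pos
  obtain ⟨S, hS, hScard⟩ := h.count ((10 + C) * r) (by nlinarith)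
  refine (h.norm_iteratedDeriv_le_aux hc hH hr1 hS hT (fun w hw => (hW w hw).1)
    (fun w hw => (hW w hw).2.1) (fun w hw => (hW w hw).2.2) hρ hρ1 hw₀ hw₀Λ t).trans ?_
  have hSm : S.card ≤ C * (10 + C) ^ 2 * r ^ 2 := by
    have : (S.card : ℝ) ≤ ((C * (10 + C) ^ 2 * r ^ 2 : ℕ) : ℝ) := by
      push_cast
      linarith
    exact_mod_cast this
  set m := C * (10 + C) ^ 2 * r ^ 2
  have hKC : (K : ℝ) = 20 + 11 * C + k := by rw [hK]; push_cast; ring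
  have hk0 : (0 : ℝ) ≤ k := Nat.cast_nonneg k
  set b : ℝ := K * r with hb
  have hb2 : (2 : ℝ) ≤ b := by nlinarith
  have hb1 : (1 : ℝ) ≤ b := by linarith
  have hLb : (L : ℝ) ≤ b ^ L := by
    calc (L : ℝ) ≤ 2 ^ L := by exact_mod_cast Nat.lt_two_pow_self.le
      _ ≤ b ^ L := by gcongr
  have h1 : 11 * (C : ℝ) * r ≤ b := by rw [hb, hKC]; nlinarith
  have h2 : (C : ℝ) ≤ b := by rw [hb, hKC]; nlinarith
  have h3 : (20 + C) * (r : ℝ) ≤ b := by rw [hb, hKC]; nlinarith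
  have h4 : ρ⁻¹ ≤ b := by rw [hb, hKC]; nlinarith
  have hbr : b ≤ (r : ℝ) ^ (K + 1) := by
    rw [hb, pow_succ]
    gcongr
    calc (K : ℝ) ≤ 2 ^ K := by exact_mod_cast Nat.lt_two_pow_self.le
      _ ≤ (r : ℝ) ^ K := by gcongr; exact_mod_cast hr
  have hmul : ∀ n, n ≤ 4 * L * m → ∀ x : ℝ, 0 ≤ x → x ≤ b → x ^ n ≤ b ^ (4 * L * m) := by
    intro n hn x hx hxb
    calc x ^ n ≤ b ^ n := by gcongr
      _ ≤ _ := by gcongr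
  have hSn : 4 * L * S.card ≤ 4 * L * m := by gcongr
  have key : (L : ℝ) ^ 2 * (H * ((11 * C * r) ^ (2 * L) * (C : ℝ) ^ (4 * L))) *
        ((20 + C) * r) ^ (4 * L * S.card) * (ρ⁻¹) ^ (4 * L * S.card) ≤
      H * (r : ℝ) ^ ((K + 1) * (8 + 8 * (C * (10 + C) ^ 2)) * L * r ^ 2) := by
    calc (L : ℝ) ^ 2 * (H * ((11 * C * r) ^ (2 * L) * (C : ℝ) ^ (4 * L))) *
        ((20 + C) * r) ^ (4 * L * S.card) * (ρ⁻¹) ^ (4 * L * S.card)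
        ≤ (b ^ L) ^ 2 * (H * (b ^ (2 * L) * b ^ (4 * L))) * b ^ (4 * L * m) * b ^ (4 * L * m) := by
          gcongr ?_ * (_ * (?_ * ?_)) * ?_ * ?_
          · gcongr
          · gcongr
          · gcongr
          · exact hmul _ hSn _ (by positivity) h3
          · exact hmul _ hSn _ (by positivity) h4
      _ = H * b ^ (8 * L + 8 * L * m) := by ring
      _ ≤ H * ((r : ℝ) ^ (K + 1)) ^ ((8 + 8 * (C * (10 + C) ^ 2)) * L * r ^ 2) := by
          gcongr H * ?_
          calc b ^ (8 * L + 8 * L * m) ≤ b ^ ((8 + 8 * (C * (10 + C) ^ 2)) * L * r ^ 2) := by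
                gcongr
                have : 1 ≤ r ^ 2 := Nat.one_le_pow _ _ (by omega)
                have h8 : 8 * L ≤ 8 * L * r ^ 2 := Nat.le_mul_of_pos_right _ this
                calc 8 * L + 8 * L * m ≤ 8 * L * r ^ 2 + 8 * L * m := by gcongr
                  _ = _ := by ring
            _ ≤ _ := by gcongr
      _ = _ := by rw [← pow_mul]; congr 2; ring
  gcongr ?_ * (?_ * ?_) / ?_

end Extrapolation

section LatticeCoordinates

open Filter Topology Metric

namespace PeriodPair

variable (L : PeriodPair)

theorem exists_coords (z : ℂ) : ∃ a b : ℝ, z = a * L.ω₁ + b * L.ω₂ := by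
  refine ⟨L.basis.equivFun z 0, L.basis.equivFun z 1, ?_⟩
  conv_lhs => rw [← L.basis.sum_equivFun z]
  simp [Fin.sum_univ_two]

theorem exists_coords_bound : ∃ κ : ℝ, 1 ≤ κ ∧ ∀ a b : ℝ,
    |a| ≤ κ * ‖a * L.ω₁ + b * L.ω₂‖ ∧ |b| ≤ κ * ‖a * L.ω₁ + b * L.ω₂‖ := by
  have key : ∀ (a b : ℝ), L.basis.equivFun (a * L.ω₁ + b * L.ω₂) = ![a, b] := by
    intro a b
    have h1 : (a * L.ω₁ + b * L.ω₂ : ℂ) = ∑ i, (![a, b] i) • L.basis i := by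
      simp [Fin.sum_univ_two]
    rw [h1]
    exact L.basis.equivFun_symm_apply ![a, b] ▸ L.basis.equivFun.apply_symm_apply _
  set M := L.basis.equivFunL.toContinuousLinearMap with hM
  refine ⟨max 1 ‖M‖, le_max_left _ _, fun a b => ?_⟩
  have h2 : M (a * L.ω₁ + b * L.ω₂) = ![a, b] := key a b
  have h3 := M.le_opNorm (a * L.ω₁ + b * L.ω₂)
  rw [h2] at h3
  have h4 : ‖M‖ * ‖(a * L.ω₁ + b * L.ω₂ : ℂ)‖ ≤ max 1 ‖M‖ * ‖(a * L.ω₁ + b * L.ω₂ : ℂ)‖ := by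
    gcongr
    exact le_max_right _ _
  exact ⟨(norm_le_pi_norm ![a, b] 0).trans (h3.trans h4),
    (norm_le_pi_norm ![a, b] 1).trans (h3.trans h4)⟩

theorem int_coords_injective {m n m' n' : ℤ}
    (h : (m : ℂ) * L.ω₁ + n * L.ω₂ = m' * L.ω₁ + n' * L.ω₂) : m = m' ∧ n = n' := by
  obtain ⟨κ, -, hκ⟩ := L.exists_coords_bound
  have h0 : (((m - m' : ℤ) : ℝ) : ℂ) * L.ω₁ + ((n - n' : ℤ) : ℝ) * L.ω₂ = 0 := by
    push_cast
    linear_combination h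
  have := hκ ((m - m' : ℤ) : ℝ) ((n - n' : ℤ) : ℝ)
  rw [h0, norm_zero, mul_zero] at this
  have h1 := abs_nonpos_iff.1 this.1
  have h2 := abs_nonpos_iff.1 this.2
  norm_cast at h1 h2
  omega

theorem real_coords_mem_lattice {a b : ℝ} (h : (a * L.ω₁ + b * L.ω₂ : ℂ) ∈ L.lattice) :
    ∃ m n : ℤ, a = m ∧ b = n := by
  obtain ⟨m, n, hmn⟩ := mem_lattice.1 h
  obtain ⟨κ, -, hκ⟩ := L.exists_coords_bound
  have h0 : ((a - m : ℝ) : ℂ) * L.ω₁ + (b - n : ℝ) * L.ω₂ = 0 := by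
    push_cast
    linear_combination -hmn
  have := hκ (a - m) (b - n)
  rw [h0, norm_zero, mul_zero] at this
  exact ⟨m, n, sub_eq_zero.1 (abs_nonpos_iff.1 this.1), sub_eq_zero.1 (abs_nonpos_iff.1 this.2)⟩

theorem exists_card_lattice_inter_closedBall_le : ∃ C : ℕ, 1 ≤ C ∧ ∀ R : ℝ, 1 ≤ R →
    ∃ S : Finset ℂ, (S : Set ℂ) = (L.lattice : Set ℂ) ∩ closedBall 0 R ∧
      (S.card : ℝ) ≤ C * R ^ 2 := by
  classical
  obtain ⟨κ, hκ1, hκ⟩ := L.exists_coords_bound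
  refine ⟨⌈(3 * κ) ^ 2⌉₊ + 1, by omega, fun R hR => ?_⟩
  set k : ℤ := ⌊κ * R⌋ with hk
  have hk0 : 0 ≤ k := Int.floor_nonneg.2 (by positivity)
  let S₀ : Finset ℂ := (Finset.Icc (-k) k ×ˢ Finset.Icc (-k) k).image
    fun p => (p.1 : ℂ) * L.ω₁ + p.2 * L.ω₂
  refine ⟨S₀.filter fun z => ‖z‖ ≤ R, ?_, ?_⟩
  · ext z
    simp only [Finset.coe_filter, Set.mem_ofPred_eq, Set.mem_inter_iff, mem_closedBall_zero_iff,
      SetLike.mem_coe, S₀, Finset.mem_image, Finset.mem_product, Finset.mem_Icc, Prod.exists]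
    refine and_congr_left fun hz => ⟨?_, ?_⟩
    · rintro ⟨m, n, -, rfl⟩
      exact mem_lattice.2 ⟨m, n, rfl⟩
    · intro h
      obtain ⟨m, n, rfl⟩ := mem_lattice.1 h
      have := hκ m n
      push_cast at this
      have h1 : ∀ j : ℤ, |(j : ℝ)| ≤ κ * ‖(m : ℂ) * L.ω₁ + n * L.ω₂‖ → -k ≤ j ∧ j ≤ k := by
        intro j hj
        rw [← abs_le, hk, Int.le_floor]
        push_cast
        exact hj.trans (by gcongr)
      exact ⟨m, n, ⟨h1 m this.1, h1 n this.2⟩, rfl⟩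
  · have h1 : (S₀.filter fun z => ‖z‖ ≤ R).card ≤ (2 * k + 1).toNat * (2 * k + 1).toNat := by
      refine (Finset.card_filter_le _ _).trans (Finset.card_image_le.trans ?_)
      rw [Finset.card_product, Int.card_Icc]
      have : k + 1 - -k = 2 * k + 1 := by ring
      rw [this]
    have h2 : (((2 * k + 1).toNat : ℕ) : ℝ) ≤ 3 * κ * R := by
      have h3 : (((2 * k + 1).toNat : ℤ) : ℝ) = 2 * k + 1 := by
        rw [Int.toNat_of_nonneg (by omega)]
        push_cast
        ring
      have h4 : (((2 * k + 1).toNat : ℕ) : ℝ) = 2 * k + 1 := by exact_mod_cast h3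
      rw [h4]
      have h5 : (k : ℝ) ≤ κ * R := Int.floor_le _
      have h6 : 1 ≤ κ * R := one_le_mul_of_one_le_of_one_le hκ1 hR
      linarith
    calc ((S₀.filter fun z => ‖z‖ ≤ R).card : ℝ)
        ≤ ((2 * k + 1).toNat : ℕ) * ((2 * k + 1).toNat : ℕ) := by exact_mod_cast h1
      _ ≤ (3 * κ * R) * (3 * κ * R) := by gcongr
      _ = (3 * κ) ^ 2 * R ^ 2 := by ring
      _ ≤ (⌈(3 * κ) ^ 2⌉₊ + 1 : ℕ) * R ^ 2 := by
        gcongr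
        push_cast
        exact (Nat.le_ceil _).trans (by linarith)

/-- The centred fundamental parallelogram. -/
def cell : Set ℂ :=
  (fun p : ℝ × ℝ => (p.1 * L.ω₁ + p.2 * L.ω₂ : ℂ)) '' (Set.Icc (-(1 / 2)) (1 / 2) ×ˢ Set.Icc (-(1 / 2)) (1 / 2))

theorem isCompact_cell : IsCompact L.cell :=
  (isCompact_Icc.prod isCompact_Icc).image (by fun_prop)

theorem zero_mem_cell : (0 : ℂ) ∈ L.cell :=
  ⟨(0, 0), by norm_num, by simp⟩

theorem eq_zero_of_mem_cell_of_mem_lattice {z : ℂ} (hz : z ∈ L.cell) (h : z ∈ L.lattice) :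
    z = 0 := by
  obtain ⟨⟨a, b⟩, ⟨ha, hb⟩, rfl⟩ := hz
  obtain ⟨m, n, hm, hn⟩ := L.real_coords_mem_lattice h
  have key : ∀ j : ℤ, (j : ℝ) ∈ Set.Icc (-(1 / 2) : ℝ) (1 / 2) → j = 0 := by
    rintro j ⟨h1, h2⟩
    have h3 : (-1 : ℝ) < j := by linarith
    have h4 : (j : ℝ) < 1 := by linarith
    norm_cast at h3 h4
    omega
  have hm0 := key m (hm ▸ ha)
  have hn0 := key n (hn ▸ hb)
  subst hm hn hm0 hn0
  simp

theorem exists_cell_add (z : ℂ) : ∃ z₀ ∈ L.cell, ∃ m n : ℤ, z = z₀ + (m * L.ω₁ + n * L.ω₂) := by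
  obtain ⟨a, b, hab⟩ := L.exists_coords z
  have key : ∀ x : ℝ, x - round x ∈ Set.Icc (-(1 / 2) : ℝ) (1 / 2) := fun x =>
    abs_le.1 (abs_sub_round x)
  refine ⟨(a - round a : ℝ) * L.ω₁ + (b - round b : ℝ) * L.ω₂,
    ⟨(a - round a, b - round b), ⟨key a, key b⟩, rfl⟩, round a, round b, ?_⟩
  rw [hab]
  push_cast
  ring

theorem exists_norm_cell_add_bound : ∃ κ : ℝ, 1 ≤ κ ∧ ∀ z₀ ∈ L.cell, ‖z₀‖ ≤ κ ∧ ∀ m n : ℤ,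
    |(m : ℝ)| ≤ κ * (1 + ‖z₀ + (m * L.ω₁ + n * L.ω₂)‖) ∧
    |(n : ℝ)| ≤ κ * (1 + ‖z₀ + (m * L.ω₁ + n * L.ω₂)‖) := by
  obtain ⟨κ, hκ1, hκ⟩ := L.exists_coords_bound
  obtain ⟨M, hM⟩ := L.isCompact_cell.isBounded.exists_norm_le
  have hM0 : 0 ≤ M := by simpa using hM 0 L.zero_mem_cell
  refine ⟨max M (κ * (1 + M)), le_max_of_le_right (by nlinarith), fun z₀ hz₀ =>
    ⟨(hM z₀ hz₀).trans (le_max_left _ _), fun m n => ?_⟩⟩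
  have h1 := hκ m n
  push_cast at h1
  set w : ℂ := m * L.ω₁ + n * L.ω₂
  have h2 : ‖w‖ ≤ ‖z₀ + w‖ + M := by
    have := norm_sub_le (z₀ + w) z₀
    rw [add_sub_cancel_left] at this
    linarith [hM z₀ hz₀]
  have h3 : κ * ‖w‖ ≤ max M (κ * (1 + M)) * (1 + ‖z₀ + w‖) := by
    calc κ * ‖w‖ ≤ κ * (1 + M) * (1 + ‖z₀ + w‖) := by
          rw [mul_assoc]
          gcongr
          nlinarith [norm_nonneg (z₀ + w)]
      _ ≤ _ := by
          gcongr
          exact le_max_right _ _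
  exact ⟨h1.1.trans h3, h1.2.trans h3⟩

theorem ω₁_ne_zero : L.ω₁ ≠ 0 := by
  intro h
  have := L.int_coords_injective (m := 1) (n := 0) (m' := 0) (n' := 0) (by simp [h])
  omega

theorem ω₂_ne_zero : L.ω₂ ≠ 0 := by
  intro h
  have := L.int_coords_injective (m := 0) (n := 1) (m' := 0) (n' := 0) (by simp [h])
  omega

end PeriodPair

end LatticeCoordinates

section QuasiPeriodicFunctions

open Filter Topology Metric

theorem RegularAt.comp_sub_const {g : ℂ → ℂ} (hg : RegularAt g 0) (l : ℂ) :
    RegularAt (fun w => g (w - l)) l := by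
  have h0 : meromorphicOrderAt (fun w => g (w - l)) l = meromorphicOrderAt g 0 := by
    have := meromorphicOrderAt_comp_of_deriv_ne_zero (f := g) (g := fun w => w - l) (x := l)
      (by fun_prop) (by simp)
    simpa [Function.comp_def] using this
  have hm : MeromorphicAt (fun w => g (w - l)) l := by
    have hg' : MeromorphicAt g ((fun w => w - l) l) := by simpa using hg.1
    exact hg'.comp_analyticAt (g := fun w => w - l) (by fun_prop)
  exact ⟨hm, h0 ▸ hg.2⟩

/-- A function, meromorphic in the plane with at most double poles located in `Λ`, a set with
quadratic counting function, with linear growth away from the poles. -/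
structure PoleGrowth (f : ℂ → ℂ) (Λ : Set ℂ) (C : ℕ) : Prop where
  pos : 1 ≤ C
  analytic : ∀ z ∉ Λ, AnalyticAt ℂ f z
  regular : ∀ z, RegularAt (fun w => (w - z) ^ 2 * f w) z
  count : ∀ R : ℝ, 1 ≤ R → ∃ S : Finset ℂ, (S : Set ℂ) = Λ ∩ closedBall 0 R ∧ (S.card : ℝ) ≤ C * R ^ 2
  growth : ∀ z ∉ Λ, ∃ l ∈ Λ, ‖z - l‖ ≤ C ∧ ‖f z‖ * ‖z - l‖ ^ 2 ≤ C * (1 + ‖z‖)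

theorem PoleGrowth.doublePoleGrowth {f₁ f₂ : ℂ → ℂ} {Λ₁ Λ₂ : Set ℂ} {C₁ C₂ : ℕ}
    (h₁ : PoleGrowth f₁ Λ₁ C₁) (h₂ : PoleGrowth f₂ Λ₂ C₂) :
    DoublePoleGrowth f₁ f₂ (Λ₁ ∪ Λ₂) (C₁ + C₂) where
  pos := h₁.pos.trans (Nat.le_add_right _ _)
  analytic₁ z hz := h₁.analytic z fun h => hz (Or.inl h)
  analytic₂ z hz := h₂.analytic z fun h => hz (Or.inr h)
  regular₁ := h₁.regular
  regular₂ := h₂.regular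
  count R hR := by
    classical
    obtain ⟨S₁, hS₁, hc₁⟩ := h₁.count R hR
    obtain ⟨S₂, hS₂, hc₂⟩ := h₂.count R hR
    refine ⟨S₁ ∪ S₂, by rw [Finset.coe_union, hS₁, hS₂, Set.union_inter_distrib_right], ?_⟩
    have : ((S₁ ∪ S₂).card : ℝ) ≤ S₁.card + S₂.card := by
      exact_mod_cast Finset.card_union_le S₁ S₂
    push_cast
    linarith
  growth z hz := by
    obtain ⟨l₁, hl₁, hd₁, hg₁⟩ := h₁.growth z fun h => hz (Or.inl h)
    obtain ⟨l₂, hl₂, hd₂, hg₂⟩ := h₂.growth z fun h => hz (Or.inr h)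
    have hC₁ : (0 : ℝ) ≤ C₁ := Nat.cast_nonneg _
    have hC₂ : (0 : ℝ) ≤ C₂ := Nat.cast_nonneg _
    have hz0 := norm_nonneg z
    have key : ∀ l ∈ Λ₁ ∪ Λ₂, ‖z - l‖ ≤ ‖z - l₁‖ → ‖z - l‖ ≤ ‖z - l₂‖ → ∃ l ∈ Λ₁ ∪ Λ₂,
        ‖z - l‖ ≤ (C₁ + C₂ : ℕ) ∧ ‖f₁ z‖ * ‖z - l‖ ^ 2 ≤ (C₁ + C₂ : ℕ) * (1 + ‖z‖) ∧
        ‖f₂ z‖ * ‖z - l‖ ^ 2 ≤ (C₁ + C₂ : ℕ) * (1 + ‖z‖) := by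
      intro l hl h1 h2
      refine ⟨l, hl, ?_, ?_, ?_⟩
      · push_cast
        linarith
      · have : ‖f₁ z‖ * ‖z - l‖ ^ 2 ≤ ‖f₁ z‖ * ‖z - l₁‖ ^ 2 := by gcongr
        push_cast
        nlinarith
      · have : ‖f₂ z‖ * ‖z - l‖ ^ 2 ≤ ‖f₂ z‖ * ‖z - l₂‖ ^ 2 := by gcongr
        push_cast
        nlinarith
    rcases le_total ‖z - l₁‖ ‖z - l₂‖ with h | h
    · exact key l₁ (Or.inl hl₁) le_rfl h
    · exact key l₂ (Or.inr hl₂) h le_rfl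

namespace PeriodPair

variable (L : PeriodPair)

theorem eventually_notMem_lattice (z : ℂ) : ∀ᶠ w in 𝓝[≠] z, w ∉ L.lattice := by
  have := L.compl_lattice_sdiff_singleton_mem_nhds z
  filter_upwards [nhdsWithin_le_nhds this, self_mem_nhdsWithin] with w hw hwz hwl
  exact hw ⟨hwl, hwz⟩

theorem int_coords_mem_lattice (m n : ℤ) : (m * L.ω₁ + n * L.ω₂ : ℂ) ∈ L.lattice :=
  mem_lattice.2 ⟨m, n, rfl⟩

theorem add_mem_lattice_iff {z l : ℂ} (hl : l ∈ L.lattice) : z + l ∈ L.lattice ↔ z ∈ L.lattice :=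
  L.lattice.add_mem_iff_left hl

/-- `f` is additively quasi-periodic off the lattice, with quasi-periods `x₁` and `x₂`. -/
def QuasiPeriodic (f : ℂ → ℂ) (x₁ x₂ : ℂ) : Prop :=
  ∀ z ∉ L.lattice, f (z + L.ω₁) = f z + x₁ ∧ f (z + L.ω₂) = f z + x₂

variable {L} {f : ℂ → ℂ} {x₁ x₂ : ℂ}

theorem add_int_mul_of_add {ω x : ℂ} (hω : ω ∈ L.lattice)
    (h : ∀ z ∉ L.lattice, f (z + ω) = f z + x) (n : ℤ) :
    ∀ z ∉ L.lattice, f (z + n * ω) = f z + n * x := by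
  have hn : ∀ n : ℤ, (n * ω : ℂ) ∈ L.lattice := fun n => by
    simpa using L.lattice.smul_mem n hω
  induction n using Int.induction_on with
  | zero => simp
  | succ k ih =>
    intro z hz
    have h1 := h (z + (k : ℤ) * ω) (by rwa [L.add_mem_lattice_iff (hn _)])
    rw [ih z hz] at h1
    push_cast at h1 ⊢
    rw [show z + (k + 1) * ω = z + k * ω + ω by ring, h1]
    ring
  | pred k ih =>
    intro z hz
    have h1 := h (z + (-(k : ℤ) - 1 : ℤ) * ω) (by rwa [L.add_mem_lattice_iff (hn _)])
    rw [show z + ((-(k : ℤ) - 1 : ℤ) : ℂ) * ω + ω = z + ((-(k : ℤ) : ℤ) : ℂ) * ω by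
      push_cast; ring, ih z hz] at h1
    push_cast at h1 ⊢
    linear_combination -h1

theorem QuasiPeriodic.add_int (h : L.QuasiPeriodic f x₁ x₂) {z : ℂ} (hz : z ∉ L.lattice)
    (m n : ℤ) : f (z + (m * L.ω₁ + n * L.ω₂)) = f z + (m * x₁ + n * x₂) := by
  have h1 : (m * L.ω₁ : ℂ) ∈ L.lattice := by simpa using L.int_coords_mem_lattice m 0
  rw [← add_assoc, add_int_mul_of_add L.ω₂_mem_lattice (fun z hz => (h z hz).2) n _
    (by rwa [L.add_mem_lattice_iff h1]),
    add_int_mul_of_add L.ω₁_mem_lattice (fun z hz => (h z hz).1) m _ hz]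
  ring

theorem QuasiPeriodic.regularAt_of_mem (h : L.QuasiPeriodic f x₁ x₂) {p : ℕ}
    (h0 : RegularAt (fun w => w ^ p * f w) 0) {l : ℂ} (hl : l ∈ L.lattice) :
    RegularAt (fun w => (w - l) ^ p * f w) l := by
  obtain ⟨m, n, rfl⟩ := mem_lattice.1 hl
  set l : ℂ := m * L.ω₁ + n * L.ω₂
  have h1 : AnalyticAt ℂ (fun w => (w - l) ^ p * (m * x₁ + n * x₂)) l := by fun_prop
  refine ((h0.comp_sub_const l).add h1.regularAt).congr ?_
  filter_upwards [L.eventually_notMem_lattice l] with w hw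
  have h2 : w - l ∉ L.lattice := by
    rwa [← L.add_mem_lattice_iff hl, sub_add_cancel]
  have h3 := h.add_int h2 m n
  rw [sub_add_cancel] at h3
  rw [h3]
  ring

theorem QuasiPeriodic.exists_poleGrowth (h : L.QuasiPeriodic f x₁ x₂)
    (ha : ∀ z ∉ L.lattice, AnalyticAt ℂ f z) (h0 : RegularAt (fun w => w ^ 2 * f w) 0) :
    ∃ C : ℕ, PoleGrowth f L.lattice C := by
  obtain ⟨C₁, hC₁, hcount⟩ := L.exists_card_lattice_inter_closedBall_le
  obtain ⟨κ, hκ1, hκ⟩ := L.exists_norm_cell_add_bound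
  have ha2 : ∀ z ∉ L.lattice, AnalyticAt ℂ (fun w => w ^ 2 * f w) z := fun z hz => by
    have := ha z hz
    fun_prop
  obtain ⟨F, hF, hFf⟩ := exists_analyticOnNhd_of_regularAt (f := fun w => w ^ 2 * f w)
    (U := L.cell) fun z hz => by
      by_cases hzl : z ∈ L.lattice
      · rwa [L.eq_zero_of_mem_cell_of_mem_lattice hz hzl]
      · exact (ha2 z hzl).regularAt
  obtain ⟨M, hM⟩ := L.isCompact_cell.exists_bound_of_continuousOn hF.continuousOn
  have hM0 : 0 ≤ M := (norm_nonneg _).trans (hM 0 L.zero_mem_cell)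
  set B : ℝ := M + κ ^ 2 * (κ * (‖x₁‖ + ‖x₂‖)) with hB
  obtain ⟨C, hC⟩ := exists_nat_ge (κ + B + C₁)
  have hB0 : 0 ≤ B := by positivity
  have hC₁' : (0 : ℝ) ≤ C₁ := Nat.cast_nonneg _
  refine ⟨C, ⟨?_, ha, fun z => ?_, fun R hR => ?_, fun z hz => ?_⟩⟩
  · have : (1 : ℝ) ≤ C := by linarith
    exact_mod_cast this
  · by_cases hz : z ∈ L.lattice
    · exact h.regularAt_of_mem h0 hz
    · have := ha z hz
      exact AnalyticAt.regularAt (by fun_prop)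
  · obtain ⟨S, hS, hS'⟩ := hcount R hR
    refine ⟨S, hS, hS'.trans ?_⟩
    have : (C₁ : ℝ) ≤ C := by linarith
    gcongr
  · obtain ⟨z₀, hz₀, m, n, rfl⟩ := L.exists_cell_add z
    rw [SetLike.mem_coe] at hz
    have hz₀l : z₀ ∉ L.lattice := by
      rwa [L.add_mem_lattice_iff (L.int_coords_mem_lattice m n)] at hz
    obtain ⟨hb, hmn⟩ := hκ z₀ hz₀
    refine ⟨m * L.ω₁ + n * L.ω₂, L.int_coords_mem_lattice m n, ?_, ?_⟩
    · rw [add_sub_cancel_right]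
      linarith
    · obtain ⟨h1, h2⟩ := hmn m n
      rw [h.add_int hz₀l, add_sub_cancel_right]
      set N := ‖z₀ + (m * L.ω₁ + n * L.ω₂)‖
      have hN : 0 ≤ N := norm_nonneg _
      have h3 : ‖f z₀‖ * ‖z₀‖ ^ 2 ≤ M := by
        have := hM z₀ hz₀
        rw [hFf z₀ hz₀ (ha2 z₀ hz₀l), norm_mul, norm_pow] at this
        linarith
      have h4 : ‖(m * x₁ + n * x₂ : ℂ)‖ ≤ κ * (1 + N) * (‖x₁‖ + ‖x₂‖) := by
        refine (norm_add_le _ _).trans ?_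
        rw [norm_mul, norm_mul, Complex.norm_intCast, Complex.norm_intCast, mul_add]
        gcongr
      calc ‖f z₀ + (m * x₁ + n * x₂)‖ * ‖z₀‖ ^ 2
          ≤ (‖f z₀‖ + ‖(m * x₁ + n * x₂ : ℂ)‖) * ‖z₀‖ ^ 2 := by
            gcongr
            exact norm_add_le _ _
        _ = ‖f z₀‖ * ‖z₀‖ ^ 2 + ‖(m * x₁ + n * x₂ : ℂ)‖ * ‖z₀‖ ^ 2 := by ring
        _ ≤ M + κ * (1 + N) * (‖x₁‖ + ‖x₂‖) * κ ^ 2 := by gcongr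
        _ ≤ B * (1 + N) := by
            rw [hB]
            nlinarith [mul_nonneg hM0 hN]
        _ ≤ C * (1 + N) := by
            gcongr
            linarith

/-- Liouville's theorem for functions without poles, periodic with respect to a lattice. -/
theorem QuasiPeriodic.exists_eq_const (h : L.QuasiPeriodic f 0 0)
    (ha : ∀ z ∉ L.lattice, AnalyticAt ℂ f z) (h0 : RegularAt f 0) :
    ∃ c, ∀ z ∉ L.lattice, f z = c := by
  obtain ⟨F, hF, hFf⟩ := exists_analyticOnNhd_of_regularAt (f := f) (U := Set.univ)
    fun z _ => by
      by_cases hzl : z ∈ L.lattice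
      · have := h.regularAt_of_mem (p := 0) (by simpa using h0) hzl
        simpa using this
      · exact (ha z hzl).regularAt
  obtain ⟨M, hM⟩ := L.isCompact_cell.exists_bound_of_continuousOn
    (hF.continuousOn.mono (Set.subset_univ L.cell))
  have hbound : ∀ z ∉ L.lattice, ‖F z‖ ≤ M := by
    intro z hz
    obtain ⟨z₀, hz₀, m, n, rfl⟩ := L.exists_cell_add z
    have hz₀l : z₀ ∉ L.lattice := by
      rwa [L.add_mem_lattice_iff (L.int_coords_mem_lattice m n)] at hz
    rw [hFf _ trivial (ha _ hz), h.add_int hz₀l]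
    have := hM z₀ hz₀
    rw [hFf _ trivial (ha _ hz₀l)] at this
    simpa using this
  have hbound' : ∀ z, ‖F z‖ ≤ M := by
    intro z
    have h1 : Tendsto (fun w => ‖F w‖) (𝓝[≠] z) (𝓝 ‖F z‖) :=
      ((hF z trivial).continuousAt.norm).tendsto.mono_left nhdsWithin_le_nhds
    refine le_of_tendsto h1 ?_
    filter_upwards [L.eventually_notMem_lattice z] with w hw using hbound w hw
  have hd : Differentiable ℂ F := fun z => (hF z trivial).differentiableAt
  refine ⟨F 0, fun z hz => ?_⟩
  rw [← hFf z trivial (ha z hz)]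
  refine hd.apply_eq_apply_of_bounded ?_ z 0
  rw [isBounded_iff_forall_norm_le]
  exact ⟨M, by rintro _ ⟨w, rfl⟩; exact hbound' w⟩

end PeriodPair

end QuasiPeriodicFunctions

section ZetaLike

open Filter Topology Metric Complex

/-- The function `e^{2πiz} / (1 - e^{2πiz})`. -/
noncomputable def expQuot (z : ℂ) : ℂ :=
  exp (2 * Real.pi * I * z) / (1 - exp (2 * Real.pi * I * z))

theorem exp_two_pi_I_mul_eq_one_iff {z : ℂ} :
    exp (2 * Real.pi * I * z) = 1 ↔ ∃ n : ℤ, z = n := by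
  rw [exp_eq_one_iff]
  refine exists_congr fun n => ⟨fun h => ?_, fun h => by rw [h]; ring⟩
  exact mul_left_cancel₀ two_pi_I_ne_zero (by rw [h]; ring)

theorem expQuot_add_one (z : ℂ) : expQuot (z + 1) = expQuot z := by
  simp [expQuot, mul_add, exp_add, exp_two_pi_mul_I]

theorem expQuot_add_expQuot_neg {z : ℂ} (hz : ∀ n : ℤ, z ≠ n) :
    expQuot z + expQuot (-z) = -1 := by
  have h1 : exp (2 * Real.pi * I * z) ≠ 1 := fun h => by
    obtain ⟨n, hn⟩ := exp_two_pi_I_mul_eq_one_iff.1 h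
    exact hz n hn
  have h0 := exp_ne_zero (2 * Real.pi * I * z)
  rw [expQuot, expQuot, mul_neg, exp_neg]
  set E := exp (2 * Real.pi * I * z)
  have h2 : 1 - E ≠ 0 := sub_ne_zero.2 h1.symm
  have h3 : 1 - E⁻¹ ≠ 0 := by
    rw [sub_ne_zero]
    exact fun h => h1 (inv_eq_one.1 h.symm)
  have h4 : E - 1 ≠ 0 := sub_ne_zero.2 h1
  have h5 : E⁻¹ / (1 - E⁻¹) = 1 / (E - 1) := by
    rw [div_eq_div_iff h3 h4]
    field_simp
  rw [h5]
  field_simp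
  ring

theorem analyticAt_expQuot {z : ℂ} (hz : ∀ n : ℤ, z ≠ n) : AnalyticAt ℂ expQuot z := by
  have h1 : 1 - exp (2 * Real.pi * I * z) ≠ 0 := sub_ne_zero.2 fun h => by
    obtain ⟨n, hn⟩ := exp_two_pi_I_mul_eq_one_iff.1 h.symm
    exact hz n hn
  unfold expQuot
  exact AnalyticAt.div (by fun_prop) (by fun_prop) h1

theorem norm_expQuot_le {z : ℂ} (hz : ‖exp (2 * Real.pi * I * z)‖ ≤ 1 / 2) :
    ‖expQuot z‖ ≤ 2 * ‖exp (2 * Real.pi * I * z)‖ := by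
  rw [expQuot, norm_div]
  set E := exp (2 * Real.pi * I * z)
  have h1 : 1 / 2 ≤ ‖1 - E‖ := by
    have := norm_sub_norm_le (1 : ℂ) E
    rw [norm_one] at this
    linarith
  rw [div_le_iff₀ (by linarith)]
  nlinarith [norm_nonneg E]

theorem exists_analyticAt_expQuot_zero : ∃ F : ℂ → ℂ, AnalyticAt ℂ F 0 ∧
    ∀ᶠ z in 𝓝[≠] 0, -(2 * Real.pi * I) * expQuot z = F z + 1 / z := by
  have key : ∀ f : ℂ → ℂ, AnalyticAt ℂ f 0 → f 0 = 0 → ∃ u : ℂ → ℂ, AnalyticAt ℂ u 0 ∧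
      u 0 = deriv f 0 ∧ ∀ z, f z = z * u z := by
    intro f hf h0
    obtain ⟨p, hp⟩ := hf
    refine ⟨dslope f 0, ⟨_, hp.has_fpower_series_dslope_fslope⟩, dslope_same f 0, fun z => ?_⟩
    have := sub_smul_dslope f 0 z
    simp [h0] at this
    exact this.symm
  have hd : HasDerivAt (fun z : ℂ => 1 - exp (2 * Real.pi * I * z)) (-(2 * Real.pi * I)) 0 := by
    have h1 : HasDerivAt (fun z : ℂ => 2 * Real.pi * I * z) (2 * Real.pi * I) 0 := by
      simpa using (hasDerivAt_id (0 : ℂ)).const_mul (2 * Real.pi * I)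
    simpa using h1.cexp.const_sub 1
  obtain ⟨u, hu, hu0, hfu⟩ := key (fun z => 1 - exp (2 * Real.pi * I * z)) (by fun_prop) (by simp)
  rw [hd.deriv] at hu0
  obtain ⟨χ, hχ, -, hfχ⟩ := key (fun z => -(2 * Real.pi * I) * exp (2 * Real.pi * I * z) - u z)
    (by fun_prop) (by simp [hu0])
  have hu0' : u 0 ≠ 0 := by
    rw [hu0]
    exact neg_ne_zero.2 two_pi_I_ne_zero
  refine ⟨fun z => χ z / u z, hχ.div hu hu0', ?_⟩
  filter_upwards [(hu.continuousAt.eventually_ne hu0').filter_mono nhdsWithin_le_nhds,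
    self_mem_nhdsWithin] with z hz hz0
  have hz0' : z ≠ 0 := hz0
  have h1 := hfu z
  have h2 := hfχ z
  rw [expQuot, h1]
  field_simp
  linear_combination h2

variable {τ : ℂ}

theorem exists_bound_expQuot (hτ : 0 < τ.im) (R : ℝ) : ∃ n₀ : ℕ, ∃ u : ℕ → ℝ, Summable u ∧
    ∀ n : ℕ, ∀ z : ℂ, |z.im| < R → (∀ k : ℤ, z + ((n + n₀ : ℕ) + 1) * τ ≠ k) ∧
      ‖expQuot (z + ((n + n₀ : ℕ) + 1) * τ)‖ ≤ u n := by
  set ρ : ℝ := Real.exp (-(2 * Real.pi * τ.im)) with hρ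
  have hρ0 : 0 < ρ := Real.exp_pos _
  have hρ1 : ρ < 1 := by
    rw [hρ, Real.exp_lt_one_iff]
    have := mul_pos Real.two_pi_pos hτ
    linarith
  set B : ℝ := Real.exp (2 * Real.pi * R)
  have hB : 0 < B := Real.exp_pos _
  obtain ⟨n₀, hn₀⟩ := exists_pow_lt_of_lt_one (show (0 : ℝ) < 1 / (2 * B) by positivity) hρ1
  have hn₀' : B * ρ ^ n₀ ≤ 1 / 2 := by
    rw [lt_div_iff₀ (by positivity)] at hn₀
    linarith
  have hE : ∀ n : ℕ, ∀ z : ℂ, |z.im| < R →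
      ‖exp (2 * Real.pi * I * (z + ((n + n₀ : ℕ) + 1) * τ))‖ ≤ ρ ^ n * (1 / 2) := by
    intro n z hz
    rw [norm_exp]
    have h1 : (2 * Real.pi * I * (z + ((n + n₀ : ℕ) + 1) * τ)).re =
        2 * Real.pi * (-z.im) + ((n + n₀ + 1 : ℕ) : ℝ) * (-(2 * Real.pi * τ.im)) := by
      have h2 : z + ((n + n₀ : ℕ) + 1) * τ = z + ((n + n₀ + 1 : ℕ) : ℝ) * τ := by
        push_cast
        ring
      rw [h2]
      simp [-Nat.cast_add]
      ring
    rw [h1, Real.exp_add, Real.exp_nat_mul, ← hρ]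
    calc Real.exp (2 * Real.pi * (-z.im)) * ρ ^ (n + n₀ + 1)
        ≤ B * ρ ^ (n + n₀) := by
          refine mul_le_mul (Real.exp_le_exp.2 ?_) (pow_le_pow_of_le_one hρ0.le hρ1.le (by omega))
            (by positivity) hB.le
          have := (abs_lt.1 hz).1
          gcongr
          linarith
      _ = ρ ^ n * (B * ρ ^ n₀) := by ring
      _ ≤ ρ ^ n * (1 / 2) := by gcongr
  have hpow : ∀ n : ℕ, ρ ^ n ≤ 1 := fun n => pow_le_one₀ hρ0.le hρ1.le
  refine ⟨n₀, fun n => 2 * (ρ ^ n * (1 / 2)),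
    ((summable_geometric_of_lt_one hρ0.le hρ1).mul_right _).mul_left _, fun n z hz => ⟨?_, ?_⟩⟩
  · intro k hk
    have h1 := hE n z hz
    rw [exp_two_pi_I_mul_eq_one_iff.2 ⟨k, hk⟩, norm_one] at h1
    linarith [hpow n]
  · refine (norm_expQuot_le ((hE n z hz).trans ?_)).trans ?_
    · linarith [hpow n]
    · linarith [hE n z hz]

/-- The sum of `expQuot` over the positive multiples of `τ`. -/
noncomputable def expQuotSum (τ z : ℂ) : ℂ := ∑' n : ℕ, expQuot (z + (n + 1) * τ)

theorem summable_expQuot (hτ : 0 < τ.im) (z : ℂ) :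
    Summable fun n : ℕ => expQuot (z + (n + 1) * τ) := by
  obtain ⟨n₀, u, hu, h⟩ := exists_bound_expQuot hτ (|z.im| + 1)
  rw [← summable_nat_add_iff n₀]
  exact Summable.of_norm_bounded hu fun n => (h n z (by linarith)).2

theorem analyticAt_expQuotSum (hτ : 0 < τ.im) {z : ℂ}
    (hz : ∀ n : ℕ, ∀ k : ℤ, z + (n + 1) * τ ≠ k) : AnalyticAt ℂ (expQuotSum τ) z := by
  obtain ⟨n₀, u, hu, h⟩ := exists_bound_expQuot hτ (|z.im| + 1)
  set U : Set ℂ := {w | |w.im| < |z.im| + 1} with hU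
  have hUo : IsOpen U := isOpen_lt (by fun_prop) (by fun_prop)
  have hzU : z ∈ U := by simp [hU]
  have h1 : DifferentiableOn ℂ (fun w => ∑' n : ℕ, expQuot (w + ((n + n₀ : ℕ) + 1) * τ)) U := by
    refine differentiableOn_tsum_of_summable_norm hu (fun n w hw => ?_) hUo fun n w hw =>
      (h n w hw).2
    exact (AnalyticAt.fun_comp (f := fun w : ℂ => w + ((n + n₀ : ℕ) + 1) * τ)
      (analyticAt_expQuot (h n w hw).1) (by fun_prop)).differentiableAt.differentiableWithinAt
  have h2 : AnalyticAt ℂ (fun w => ∑' n : ℕ, expQuot (w + ((n + n₀ : ℕ) + 1) * τ)) z :=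
    h1.analyticAt (hUo.mem_nhds hzU)
  have h3 : AnalyticAt ℂ (fun w => ∑ n ∈ Finset.range n₀, expQuot (w + (n + 1) * τ)) z := by
    refine Finset.analyticAt_fun_sum _ fun n _ => ?_
    exact AnalyticAt.fun_comp (f := fun w : ℂ => w + (n + 1) * τ)
      (analyticAt_expQuot (hz n)) (by fun_prop)
  have h4 : expQuotSum τ = fun w => (∑ n ∈ Finset.range n₀, expQuot (w + (n + 1) * τ)) +
      ∑' n : ℕ, expQuot (w + ((n + n₀ : ℕ) + 1) * τ) := by
    funext w
    exact ((summable_expQuot hτ w).sum_add_tsum_nat_add n₀).symm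
  rw [h4]
  exact h3.add h2

theorem expQuotSum_add_one (z : ℂ) : expQuotSum τ (z + 1) = expQuotSum τ z := by
  unfold expQuotSum
  congr 1
  funext n
  rw [show z + 1 + (n + 1) * τ = z + (n + 1) * τ + 1 by ring, expQuot_add_one]

theorem expQuotSum_eq (hτ : 0 < τ.im) (z : ℂ) :
    expQuotSum τ z = expQuot (z + τ) + expQuotSum τ (z + τ) := by
  unfold expQuotSum
  rw [(summable_expQuot hτ z).tsum_eq_zero_add]
  simp only [Nat.cast_zero, zero_add, one_mul, Nat.cast_add, Nat.cast_one]
  congr 2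
  funext n
  congr 1
  ring

/-- An odd function with simple poles at `ℤ + ℤτ`, periodic with respect to `1` and quasi-periodic
with respect to `τ`. -/
noncomputable def zetaAux (τ z : ℂ) : ℂ :=
  -(Real.pi * I) * (1 + 2 * expQuot z) -
    2 * Real.pi * I * (expQuotSum τ z - expQuotSum τ (-z))

theorem zetaAux_neg {z : ℂ} (hz : ∀ n : ℤ, z ≠ n) : zetaAux τ (-z) = -zetaAux τ z := by
  unfold zetaAux
  rw [neg_neg]
  linear_combination -(2 * Real.pi * I) * expQuot_add_expQuot_neg hz

theorem zetaAux_add_one (z : ℂ) : zetaAux τ (z + 1) = zetaAux τ z := by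
  unfold zetaAux
  have h := expQuotSum_add_one (τ := τ) (-(z + 1))
  rw [show -(z + 1) + 1 = -z by ring] at h
  rw [expQuot_add_one, expQuotSum_add_one, ← h]

theorem zetaAux_add (hτ : 0 < τ.im) {z : ℂ} (hz : ∀ n : ℤ, z ≠ n) :
    zetaAux τ (z + τ) = zetaAux τ z - 2 * Real.pi * I := by
  unfold zetaAux
  have h1 := expQuotSum_eq hτ z
  have h2 := expQuotSum_eq hτ (-(z + τ))
  rw [show -(z + τ) + τ = -z by ring] at h2
  rw [h2]
  linear_combination (2 * Real.pi * I) * h1 + (2 * Real.pi * I) * expQuot_add_expQuot_neg hz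

theorem analyticAt_zetaAux (hτ : 0 < τ.im) {z : ℂ} (hz : ∀ n k : ℤ, z + n * τ ≠ k) :
    AnalyticAt ℂ (zetaAux τ) z := by
  have h0 : ∀ n : ℤ, z ≠ n := fun n => by simpa using hz 0 n
  have h1 := analyticAt_expQuot h0
  have h2 : AnalyticAt ℂ (expQuotSum τ) z := analyticAt_expQuotSum hτ fun n k => by
    simpa using hz (n + 1) k
  have h3 : AnalyticAt ℂ (fun w => expQuotSum τ (-w)) z := by
    refine AnalyticAt.fun_comp (g := expQuotSum τ) (analyticAt_expQuotSum hτ fun n k h => ?_)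
      (by fun_prop)
    refine hz (-(n + 1)) (-k) ?_
    push_cast
    linear_combination -h
  unfold zetaAux
  fun_prop

theorem exists_analyticAt_zetaAux_zero (hτ : 0 < τ.im) : ∃ F : ℂ → ℂ, AnalyticAt ℂ F 0 ∧
    ∀ᶠ z in 𝓝[≠] 0, zetaAux τ z = F z + 1 / z := by
  obtain ⟨F, hF, hF'⟩ := exists_analyticAt_expQuot_zero
  have h0 : AnalyticAt ℂ (expQuotSum τ) 0 := analyticAt_expQuotSum hτ fun n k h => by
    have h1 := congrArg im h
    have h2 : (0 + ((n : ℂ) + 1) * τ).im = ((n : ℝ) + 1) * τ.im := by simp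
    rw [h2, intCast_im] at h1
    have : 0 < ((n : ℝ) + 1) * τ.im := by positivity
    linarith
  have h0' : AnalyticAt ℂ (fun w => expQuotSum τ (-w)) 0 :=
    AnalyticAt.fun_comp (g := expQuotSum τ) (by simpa using h0) (by fun_prop)
  refine ⟨fun z => -(Real.pi * I) + F z - 2 * Real.pi * I * (expQuotSum τ z - expQuotSum τ (-z)),
    by fun_prop, ?_⟩
  filter_upwards [hF'] with z hz
  unfold zetaAux
  linear_combination hz

end ZetaLike

section WeierstrassFacts

theorem isAlgebraic_of_cubic {K E : Type*} [Field K] [Field E] [CharZero E] [Algebra K E]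
    {a b x : E} (ha : IsAlgebraic K a) (hb : IsAlgebraic K b) (h : 4 * x ^ 3 - a * x - b = 0) :
    IsAlgebraic K x := by
  have ht : IsAlgebraic (algebraicClosure K E) x := by
    let a' : algebraicClosure K E := ⟨a, mem_algebraicClosure_iff.2 ha⟩
    let b' : algebraicClosure K E := ⟨b, mem_algebraicClosure_iff.2 hb⟩
    have : CharZero (algebraicClosure K E) :=
      ⟨fun m n h => Nat.cast_injective (R := E) (by
        simpa using congrArg (algebraMap (algebraicClosure K E) E) h)⟩
    refine ⟨4 * Polynomial.X ^ 3 - Polynomial.C a' * Polynomial.X - Polynomial.C b', ?_, ?_⟩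
    · intro h0
      have := congrArg (fun p => Polynomial.coeff p 3) h0
      simp [Polynomial.coeff_ofNat_mul] at this
    · have e₂ : algebraMap (algebraicClosure K E) E a' = a := rfl
      have e₃ : algebraMap (algebraicClosure K E) E b' = b := rfl
      simp only [map_sub, map_mul, map_pow, Polynomial.aeval_X, Polynomial.aeval_C, e₂, e₃,
        map_ofNat]
      exact h
  exact ht.restrictScalars K

open Filter Topology Metric

namespace PeriodPair

variable (L : PeriodPair)

theorem isPreconnected_compl_lattice : IsPreconnected (L.lattice : Set ℂ)ᶜ := by
  refine (Set.Countable.isConnected_compl_of_one_lt_rank (by simp) ?_).2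
  have : (L.lattice : Set ℂ) = Set.range fun p : ℤ × ℤ => (p.1 * L.ω₁ + p.2 * L.ω₂ : ℂ) := by
    ext z
    rw [SetLike.mem_coe, mem_lattice]
    simp
  rw [this]
  exact Set.countable_range _

theorem isOpen_compl_lattice : IsOpen (L.lattice : Set ℂ)ᶜ := L.isClosed_lattice.isOpen_compl

theorem eq_zero_of_eventually_eq_zero {f : ℂ → ℂ} (hf : ∀ z ∉ L.lattice, AnalyticAt ℂ f z)
    {z₀ : ℂ} (hz₀ : z₀ ∉ L.lattice) (h : ∀ᶠ z in 𝓝 z₀, f z = 0) : ∀ z ∉ L.lattice, f z = 0 := by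
  have hf' : AnalyticOnNhd ℂ f (L.lattice : Set ℂ)ᶜ := fun z hz => hf z hz
  exact hf'.eqOn_zero_of_preconnected_of_eventuallyEq_zero L.isPreconnected_compl_lattice hz₀ h

variable {L}

theorem analyticAt_weierstrassP {z : ℂ} (hz : z ∉ L.lattice) : AnalyticAt ℂ L.weierstrassP z :=
  L.analyticOnNhd_weierstrassP z hz

theorem analyticAt_derivWeierstrassP {z : ℂ} (hz : z ∉ L.lattice) :
    AnalyticAt ℂ L.derivWeierstrassP z :=
  L.analyticOnNhd_derivWeierstrassP z hz

theorem hasDerivAt_weierstrassP {z : ℂ} (hz : z ∉ L.lattice) :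
    HasDerivAt L.weierstrassP (L.derivWeierstrassP z) z := by
  rw [← L.deriv_weierstrassP]
  exact (analyticAt_weierstrassP hz).differentiableAt.hasDerivAt

theorem not_eventually_weierstrassP_eq {z : ℂ} (hz : z ∉ L.lattice) (c : ℂ) :
    ¬ ∀ᶠ w in 𝓝 z, L.weierstrassP w = c := by
  intro h
  have h1 := L.eq_zero_of_eventually_eq_zero (f := fun w => L.weierstrassP w - c)
    (fun z hz => (analyticAt_weierstrassP hz).sub analyticAt_const) hz
    (h.mono fun w hw => sub_eq_zero.2 hw)
  have h2 := L.order_weierstrassP 0 L.lattice.zero_mem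
  have h3 : L.weierstrassP =ᶠ[𝓝[≠] 0] fun _ => c := by
    filter_upwards [L.eventually_notMem_lattice 0] with w hw
    exact sub_eq_zero.1 (h1 w hw)
  rw [meromorphicOrderAt_congr h3] at h2
  have h4 := (analyticAt_const (𝕜 := ℂ) (v := c) (x := (0 : ℂ))).meromorphicOrderAt_nonneg
  rw [h2] at h4
  exact absurd h4 (by decide)

theorem not_eventually_derivWeierstrassP_eq_zero {z : ℂ} (hz : z ∉ L.lattice) :
    ¬ ∀ᶠ w in 𝓝 z, L.derivWeierstrassP w = 0 := by
  intro h
  have h1 := L.eq_zero_of_eventually_eq_zero (f := L.derivWeierstrassP)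
    (fun z hz => analyticAt_derivWeierstrassP hz) hz h
  obtain ⟨c, hc⟩ := L.isOpen_compl_lattice.exists_is_const_of_deriv_eq_zero (𝕜 := ℂ) (f := L.weierstrassP)
    L.isPreconnected_compl_lattice
    (fun z hz => (analyticAt_weierstrassP hz).differentiableAt.differentiableWithinAt)
    fun z hz => by
      rw [L.deriv_weierstrassP]
      exact h1 z hz
  refine not_eventually_weierstrassP_eq hz c ?_
  filter_upwards [L.isOpen_compl_lattice.mem_nhds hz] with w hw using hc w hw

theorem hasDerivAt_derivWeierstrassP {z : ℂ} (hz : z ∉ L.lattice) :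
    HasDerivAt L.derivWeierstrassP (6 * L.weierstrassP z ^ 2 - L.g₂ / 2) z := by
  have ha := analyticAt_derivWeierstrassP hz
  suffices h : deriv L.derivWeierstrassP z - (6 * L.weierstrassP z ^ 2 - L.g₂ / 2) = 0 by
    rw [← sub_eq_zero.1 h]
    exact ha.differentiableAt.hasDerivAt
  have key : ∀ w ∉ L.lattice, L.derivWeierstrassP w *
      (deriv L.derivWeierstrassP w - (6 * L.weierstrassP w ^ 2 - L.g₂ / 2)) = 0 := by
    intro w hw
    have h1 := (analyticAt_derivWeierstrassP hw).differentiableAt.hasDerivAt.pow 2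
    have hP := hasDerivAt_weierstrassP hw
    have h2 := (((hP.pow 3).const_mul 4).sub (hP.const_mul L.g₂)).sub_const L.g₃
    have h3 : (L.derivWeierstrassP ^ 2 : ℂ → ℂ) =ᶠ[𝓝 w]
        fun x => ((fun y => 4 * (L.weierstrassP ^ 3) y) - fun y => L.g₂ * L.weierstrassP y) x - L.g₃ := by
      filter_upwards [L.isOpen_compl_lattice.mem_nhds hw] with x hx
      simpa using L.derivWeierstrassP_sq x hx
    have h4 := h1.unique (h2.congr_of_eventuallyEq h3)
    norm_num at h4
    linear_combination h4 / 2
  have hc : ContinuousAt (fun w => deriv L.derivWeierstrassP w -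
      (6 * L.weierstrassP w ^ 2 - L.g₂ / 2)) z := by
    have h1 := ha.deriv.continuousAt
    have h2 := (analyticAt_weierstrassP hz).continuousAt
    fun_prop
  rcases ha.eventually_eq_zero_or_eventually_ne_zero with h | h
  · exact absurd h (not_eventually_derivWeierstrassP_eq_zero hz)
  · refine tendsto_nhds_unique (hc.tendsto.mono_left (nhdsWithin_le_nhds (s := {z}ᶜ)))
      (tendsto_const_nhds.congr' ?_)
    filter_upwards [h, L.eventually_notMem_lattice z] with w hw hwl
    exact ((mul_eq_zero.1 (key w hwl)).resolve_left hw).symm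

theorem quasiPeriodic_weierstrassP : L.QuasiPeriodic L.weierstrassP 0 0 := fun z _ => by
  rw [add_zero]
  exact ⟨L.weierstrassP_add_coe z ⟨_, L.ω₁_mem_lattice⟩,
    L.weierstrassP_add_coe z ⟨_, L.ω₂_mem_lattice⟩⟩

theorem weierstrassP_add_of_mem (z : ℂ) {l : ℂ} (hl : l ∈ L.lattice) :
    L.weierstrassP (z + l) = L.weierstrassP z :=
  L.weierstrassP_add_coe z ⟨l, hl⟩

theorem derivWeierstrassP_add_of_mem (z : ℂ) {l : ℂ} (hl : l ∈ L.lattice) :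
    L.derivWeierstrassP (z + l) = L.derivWeierstrassP z :=
  L.derivWeierstrassP_add_coe z ⟨l, hl⟩

theorem exists_analyticAt_weierstrassP_zero : ∃ F : ℂ → ℂ, AnalyticAt ℂ F 0 ∧
    ∀ z, L.weierstrassP z = F z + 1 / z ^ 2 := by
  refine ⟨L.weierstrassPExcept 0, L.analyticAt_weierstrassPExcept 0, fun z => ?_⟩
  rw [← L.weierstrassPExcept_add 0 z]
  simp

theorem regularAt_sq_mul_weierstrassP : RegularAt (fun w => w ^ 2 * L.weierstrassP w) 0 := by
  obtain ⟨F, hF, h⟩ := exists_analyticAt_weierstrassP_zero (L := L)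
  have h1 : AnalyticAt ℂ (fun w => w ^ 2 * F w + 1) 0 := by fun_prop
  refine h1.regularAt.congr ?_
  filter_upwards [self_mem_nhdsWithin] with w hw
  have hw0 : w ≠ 0 := hw
  rw [h]
  field_simp

theorem derivWeierstrassP_eq_zero_of_two_mul_mem {z : ℂ} (hz : 2 * z ∈ L.lattice) :
    L.derivWeierstrassP z = 0 := by
  have h1 := derivWeierstrassP_add_of_mem (-z) hz
  rw [show -z + 2 * z = z by ring, L.derivWeierstrassP_neg] at h1
  linear_combination h1 / 2

theorem isAlgebraic_weierstrassP_of_two_mul_mem (h₂ : IsAlgebraic ℚ L.g₂)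
    (h₃ : IsAlgebraic ℚ L.g₃) {z : ℂ} (hz : z ∉ L.lattice) (h : 2 * z ∈ L.lattice) :
    IsAlgebraic ℚ (L.weierstrassP z) := by
  have h1 := L.derivWeierstrassP_sq z hz
  rw [derivWeierstrassP_eq_zero_of_two_mul_mem h] at h1
  exact isAlgebraic_of_cubic h₂ h₃ (by linear_combination -h1)

end PeriodPair

/-- `Z` is, up to a linear term, the Weierstrass zeta function of the lattice `L`, normalised to be
periodic with respect to the first period. -/
structure ZetaLike (L : PeriodPair) (Z : ℂ → ℂ) (y : ℂ) : Prop where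
  analytic : ∀ z ∉ L.lattice, AnalyticAt ℂ Z z
  odd : ∀ z ∉ L.lattice, Z (-z) = -Z z
  quasi : L.QuasiPeriodic Z 0 (-(2 * Real.pi * Complex.I / L.ω₁))
  pole : ∃ F : ℂ → ℂ, AnalyticAt ℂ F 0 ∧ ∀ᶠ z in 𝓝[≠] 0, Z z = F z + 1 / z
  hasDeriv : ∀ z ∉ L.lattice, HasDerivAt Z (-L.weierstrassP z - y) z

theorem ZetaLike.half {L : PeriodPair} {Z : ℂ → ℂ} {y : ℂ} (h : ZetaLike L Z y) :
    Z (L.ω₁ / 2) = 0 := by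
  have h1 := h.odd _ L.ω₁_div_two_notMem_lattice
  have h2 : -(L.ω₁ / 2) ∉ L.lattice := fun h => L.ω₁_div_two_notMem_lattice (by simpa using h)
  have h3 := (h.quasi _ h2).1
  rw [show -(L.ω₁ / 2) + L.ω₁ = L.ω₁ / 2 by ring, h1] at h3
  linear_combination h3 / 2

theorem ZetaLike.regularAt {L : PeriodPair} {Z : ℂ → ℂ} {y : ℂ} (h : ZetaLike L Z y) :
    RegularAt (fun w => w ^ 2 * Z w) 0 := by
  obtain ⟨F, hF, h⟩ := h.pole
  have h1 : AnalyticAt ℂ (fun w => w ^ 2 * F w + w) 0 := by fun_prop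
  refine h1.regularAt.congr ?_
  filter_upwards [self_mem_nhdsWithin, h] with w hw hZ
  have hw0 : w ≠ 0 := hw
  rw [hZ]
  field_simp

theorem exists_zetaLike (L : PeriodPair) (hτ : 0 < (L.ω₂ / L.ω₁).im) :
    ∃ Z y, ZetaLike L Z y := by
  set τ := L.ω₂ / L.ω₁ with hτdef
  have hω := L.ω₁_ne_zero
  have hτω : τ * L.ω₁ = L.ω₂ := div_mul_cancel₀ _ hω
  have hmem : ∀ z ∉ L.lattice, ∀ n k : ℤ, z / L.ω₁ + n * τ ≠ k := by
    intro z hz n k h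
    apply hz
    rw [PeriodPair.mem_lattice]
    refine ⟨k, -n, ?_⟩
    have h1 : z = z / L.ω₁ * L.ω₁ := (div_mul_cancel₀ _ hω).symm
    rw [h1, ← hτω]
    push_cast
    linear_combination -L.ω₁ * h
  have hmem' : ∀ z ∉ L.lattice, ∀ k : ℤ, z / L.ω₁ ≠ k := fun z hz k => by
    simpa using hmem z hz 0 k
  set Z : ℂ → ℂ := fun z => L.ω₁⁻¹ * zetaAux τ (z / L.ω₁) with hZ
  have hZa : ∀ z ∉ L.lattice, AnalyticAt ℂ Z z := fun z hz => by
    refine analyticAt_const.mul ?_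
    exact AnalyticAt.fun_comp (f := fun w => w / L.ω₁) (analyticAt_zetaAux hτ (hmem z hz))
      (by fun_prop)
  have hquasi : L.QuasiPeriodic Z 0 (-(2 * Real.pi * Complex.I / L.ω₁)) := by
    intro z hz
    constructor
    · simp only [hZ]
      rw [add_div, div_self hω, zetaAux_add_one, add_zero]
    · simp only [hZ]
      rw [add_div, ← hτdef, zetaAux_add hτ (hmem' z hz)]
      field_simp
      ring
  have hpole : ∃ F : ℂ → ℂ, AnalyticAt ℂ F 0 ∧ ∀ᶠ z in 𝓝[≠] 0, Z z = F z + 1 / z := by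
    obtain ⟨F, hF, hF'⟩ := exists_analyticAt_zetaAux_zero hτ
    refine ⟨fun z => L.ω₁⁻¹ * F (z / L.ω₁), ?_, ?_⟩
    · refine analyticAt_const.mul ?_
      exact AnalyticAt.fun_comp (f := fun w => w / L.ω₁) (by simpa using hF) (by fun_prop)
    · have ht : Tendsto (fun z : ℂ => z / L.ω₁) (𝓝[≠] 0) (𝓝[≠] 0) := by
        refine tendsto_nhdsWithin_iff.2 ⟨?_, ?_⟩
        · have : ContinuousAt (fun z : ℂ => z / L.ω₁) 0 := by fun_prop
          have h2 := this.tendsto.mono_left (nhdsWithin_le_nhds (s := {0}ᶜ))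
          simpa using h2
        · filter_upwards [self_mem_nhdsWithin] with z hz
          exact div_ne_zero hz hω
      filter_upwards [ht.eventually hF', self_mem_nhdsWithin] with z hz hz0
      have hz0' : z ≠ 0 := hz0
      simp only [hZ]
      rw [hz]
      field_simp
  have hq' : L.QuasiPeriodic (fun z => deriv Z z + L.weierstrassP z) 0 0 := by
    have key : ∀ ω ∈ L.lattice, ∀ x, (∀ z ∉ L.lattice, Z (z + ω) = Z z + x) → ∀ z ∉ L.lattice,
        deriv Z (z + ω) = deriv Z z := by
      intro ω hω x hx z hz
      rw [← deriv_comp_add_const, ← deriv_add_const (f := Z) x]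
      refine Filter.EventuallyEq.deriv_eq ?_
      filter_upwards [L.isOpen_compl_lattice.mem_nhds hz] with w hw using hx w hw
    intro z hz
    have hP := PeriodPair.quasiPeriodic_weierstrassP z hz
    simp only [add_zero] at hP ⊢
    rw [key _ L.ω₁_mem_lattice _ (fun z hz => (hquasi z hz).1) z hz,
      key _ L.ω₂_mem_lattice _ (fun z hz => (hquasi z hz).2) z hz, hP.1, hP.2]
    exact ⟨rfl, rfl⟩
  have ha' : ∀ z ∉ L.lattice, AnalyticAt ℂ (fun z => deriv Z z + L.weierstrassP z) z :=
    fun z hz => (hZa z hz).deriv.add (PeriodPair.analyticAt_weierstrassP hz)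
  have hr' : RegularAt (fun z => deriv Z z + L.weierstrassP z) 0 := by
    obtain ⟨F, hF, hF'⟩ := hpole
    obtain ⟨G, hG, hG'⟩ := PeriodPair.exists_analyticAt_weierstrassP_zero (L := L)
    have h1 : AnalyticAt ℂ (fun z => deriv F z + G z) 0 := hF.deriv.add hG
    refine h1.regularAt.congr ?_
    have h2 : ∀ᶠ z in 𝓝[≠] (0 : ℂ), ∀ᶠ w in 𝓝 z, Z w = F w + 1 / w := by
      rw [eventually_nhdsWithin_iff] at hF'
      rw [eventually_nhdsWithin_iff]
      filter_upwards [hF'.eventually_nhds] with z hz hz0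
      filter_upwards [hz, isOpen_compl_singleton.mem_nhds hz0] with w hw hw0 using hw hw0
    filter_upwards [h2, self_mem_nhdsWithin,
      hF.eventually_analyticAt.filter_mono nhdsWithin_le_nhds] with z hz hz0 hFz
    have hz0' : z ≠ 0 := hz0
    have h3 : HasDerivAt (fun w => F w + 1 / w) (deriv F z + -(1 / z ^ 2)) z := by
      have := (hasDerivAt_inv hz0')
      simp only [one_div]
      exact hFz.differentiableAt.hasDerivAt.add this
    rw [Filter.EventuallyEq.deriv_eq hz, h3.deriv, hG']
    ring
  obtain ⟨c, hc⟩ := hq'.exists_eq_const ha' hr'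
  refine ⟨Z, -c, hZa, fun z hz => ?_, hquasi, hpole, fun z hz => ?_⟩
  · simp only [hZ]
    rw [neg_div, zetaAux_neg (hmem' z hz), mul_neg]
  · rw [← hc z hz]
    rw [show -L.weierstrassP z - -(deriv Z z + L.weierstrassP z) = deriv Z z by ring]
    exact (hZa z hz).differentiableAt.hasDerivAt

end WeierstrassFacts

section DerivativeValues

open MvPolynomial

variable {σ : Type*} {φ : σ → ℂ → ℂ} {f : σ → MvPolynomial σ ℤ} {U : Set ℂ} {B : ℕ}
  {θ : ℂ} {n : ℕ} {e : Fin n → ℂ} {d : ℂ} {δ : ℕ} {H : ℝ}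

theorem iteratedDeriv_polyComb {f₁ f₂ : ℂ → ℂ} {z : ℂ} (h₁ : AnalyticAt ℂ f₁ z)
    (h₂ : AnalyticAt ℂ f₂ z) {N : ℕ} (c : Fin N × Fin N → ℂ) (t : ℕ) :
    iteratedDeriv t (polyComb f₁ f₂ c) z =
      ∑ b, c b * iteratedDeriv t (fun w => f₁ w ^ (b.1 : ℕ) * f₂ w ^ (b.2 : ℕ)) z := by
  have hb : ∀ b : Fin N × Fin N,
      AnalyticAt ℂ (fun w => f₁ w ^ (b.1 : ℕ) * f₂ w ^ (b.2 : ℕ)) z := fun b => by fun_prop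
  unfold polyComb
  rw [iteratedDeriv_fun_sum (f := fun b w => c b * (f₁ w ^ (b.1 : ℕ) * f₂ w ^ (b.2 : ℕ)))
    fun b _ => (analyticAt_const.mul (hb b)).contDiffAt]
  exact Finset.sum_congr rfl fun b _ => iteratedDeriv_const_mul_field _ _

/-- The values of the derivatives of monomials in functions satisfying a quadratic differential
system. -/
theorem matRep_iteratedDeriv_monomial (hf : ∀ i, MonoBound 2 B (f i)) (hB : 1 ≤ B) (hU : IsOpen U)
    (hφ : ∀ z ∈ U, ∀ i, HasDerivAt (φ i) (aeval (fun j => φ j z) (f i)) z) (hH : 1 ≤ H)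
    (hd : MatRep θ e d δ H) {w : ℂ} (hw : w ∈ U) (hγ : ∀ i, MatRep θ e (d * φ i w) δ H)
    (i₁ i₂ : σ) {N T b₁ b₂ t : ℕ} (hb₁ : b₁ < N) (hb₂ : b₂ < N) (ht : t ≤ T) :
    MatRep θ e (d ^ (2 * N + T) * iteratedDeriv t (fun z => φ i₁ z ^ b₁ * φ i₂ z ^ b₂) w)
      ((2 * N + T) * δ) (((2 * N + T) * B : ℕ) ^ T * H ^ (2 * N + T)) := by
  have hQ : MonoBound (b₁ * 1 + b₂ * 1) (1 ^ b₁ * 1 ^ b₂)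
      (X i₁ ^ b₁ * X i₂ ^ b₂ : MvPolynomial σ ℤ) :=
    ((MonoBound.of_X i₁).pow b₁).mul ((MonoBound.of_X i₂).pow b₂)
  have h1 := (hQ.iterate_derivation hf t).mono_deg (l := 2 * N + T) (by omega)
  have h2 := h1.mono_count (b := ((2 * N + T) * B) ^ T) (by
    rw [one_pow, one_pow, one_mul, one_mul]
    calc ((b₁ * 1 + b₂ * 1 + t * 1) * B) ^ t ≤ ((2 * N + T) * B) ^ t := by
          gcongr <;> omega
      _ ≤ ((2 * N + T) * B) ^ T :=
          Nat.pow_le_pow_right (Nat.mul_pos (by omega) hB) ht)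
  have h3 := h2.matRep hH hd hγ
  rw [← iteratedDeriv_aeval hU hφ t _ w hw] at h3
  simp only [map_mul, map_pow, aeval_X] at h3
  exact_mod_cast h3

/-- The values of the derivatives of a polynomial combination with coefficients in `ℤ[θ]`. -/
theorem matRep_iteratedDeriv_polyComb (hf : ∀ i, MonoBound 2 B (f i)) (hB : 1 ≤ B) (hU : IsOpen U)
    (hφ : ∀ z ∈ U, ∀ i, HasDerivAt (φ i) (aeval (fun j => φ j z) (f i)) z) (hH : 1 ≤ H)
    (hd : MatRep θ e d δ H) {w : ℂ} (hw : w ∈ U) (hγ : ∀ i, MatRep θ e (d * φ i w) δ H)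
    (i₁ i₂ : σ) (h₁ : AnalyticAt ℂ (φ i₁) w) (h₂ : AnalyticAt ℂ (φ i₂) w) {N T t : ℕ}
    (ht : t ≤ T) {c : Fin N × Fin N → Polynomial ℤ} {D : ℕ} {P : ℝ} (hP : 0 ≤ P)
    (hcD : ∀ b, (c b).natDegree ≤ D) (hcP : ∀ b, plen (c b) ≤ P) :
    MatRep θ e (d ^ (2 * N + T) *
        iteratedDeriv t (polyComb (φ i₁) (φ i₂) fun b => Polynomial.aeval θ (c b)) w)
      (D + (2 * N + T) * δ) (N ^ 2 * (P * (((2 * N + T) * B : ℕ) ^ T * H ^ (2 * N + T)))) := by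
  rw [iteratedDeriv_polyComb h₁ h₂, Finset.mul_sum]
  have key : ∀ b ∈ (Finset.univ : Finset (Fin N × Fin N)), MatRep θ e (d ^ (2 * N + T) *
      (Polynomial.aeval θ (c b) *
        iteratedDeriv t (fun z => φ i₁ z ^ (b.1 : ℕ) * φ i₂ z ^ (b.2 : ℕ)) w))
      (D + (2 * N + T) * δ) (P * (((2 * N + T) * B : ℕ) ^ T * H ^ (2 * N + T))) := fun b _ => by
    have h := ((MatRep.poly (c b)).mono (hcD b) (hcP b)).mul
      (matRep_iteratedDeriv_monomial hf hB hU hφ hH hd hw hγ i₁ i₂ b.1.2 b.2.2 ht) hP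
    rwa [mul_left_comm] at h
  have h := MatRep.sum _ key
  rw [Finset.sum_const, Finset.card_univ, Fintype.card_prod, Fintype.card_fin, nsmul_eq_mul] at h
  exact_mod_cast h.mono le_rfl (le_of_eq (by push_cast; ring))

/-- Siegel's lemma for the auxiliary function. -/
theorem exists_polyComb_zeros (he : PolyIndep θ e) (hn : 0 < n) (hf : ∀ i, MonoBound 2 B (f i))
    (hB : 1 ≤ B) (hU : IsOpen U)
    (hφ : ∀ z ∈ U, ∀ i, HasDerivAt (φ i) (aeval (fun j => φ j z) (f i)) z) (hH : 1 ≤ H)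
    (hd0 : d ≠ 0) (hd : MatRep θ e d δ H) {M : ℕ} {w : Fin M → ℂ} (hw : ∀ m, w m ∈ U)
    (hγ : ∀ m i, MatRep θ e (d * φ i (w m)) δ H) (i₁ i₂ : σ)
    (h₁ : ∀ m, AnalyticAt ℂ (φ i₁) (w m)) (h₂ : ∀ m, AnalyticAt ℂ (φ i₂) (w m)) {N T : ℕ}
    (hN : 0 < N) (hT : 0 < T) (hM : 0 < M) (hcard : 4 * n * (T * M) ≤ N ^ 2) :
    ∃ c : Fin N × Fin N → Polynomial ℤ, c ≠ 0 ∧ (∀ b, (c b).natDegree ≤ (2 * N + T) * δ) ∧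
      (∀ b, plen (c b) ≤ (((2 * N + T) * δ : ℕ) + 1) * ((N ^ 2 : ℕ) * (((2 * N + T) * δ : ℕ) + 1) *
        (((2 * N + T) * B : ℕ) ^ T * H ^ (2 * N + T)))) ∧
      ∀ m, ∀ t < T, iteratedDeriv t
        (polyComb (φ i₁) (φ i₂) fun b => Polynomial.aeval θ (c b)) (w m) = 0 := by
  have hH' : (1 : ℝ) ≤ ((2 * N + T) * B : ℕ) ^ T * H ^ (2 * N + T) := by
    refine one_le_mul_of_one_le_of_one_le (one_le_pow₀ ?_) (one_le_pow₀ hH)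
    exact_mod_cast Nat.mul_pos (by omega) hB
  obtain ⟨c, hc0, hcD, hcP, hc⟩ := exists_siegel_solution (α := Fin T × Fin M)
    (β := Fin N × Fin N) he hn
    (fun a b => d ^ (2 * N + T) *
      iteratedDeriv (a.1 : ℕ) (fun z => φ i₁ z ^ (b.1 : ℕ) * φ i₂ z ^ (b.2 : ℕ)) (w a.2))
    hH' (by simpa using ⟨hT, hM⟩) (by simpa [sq] using hcard)
    (fun a b => matRep_iteratedDeriv_monomial hf hB hU hφ hH hd (hw _) (hγ _) i₁ i₂ b.1.2 b.2.2
      a.1.2.le)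
  refine ⟨c, hc0, hcD, fun b => (hcP b).trans (le_of_eq ?_), fun m t ht => ?_⟩
  · simp [sq]
  · have h := hc (⟨t, ht⟩, m)
    rw [iteratedDeriv_polyComb (h₁ m) (h₂ m)]
    refine (mul_eq_zero.1 ((Eq.trans ?_ h : d ^ (2 * N + T) * _ = 0))).resolve_left (pow_ne_zero _ hd0)
    rw [Finset.mul_sum]
    exact Finset.sum_congr rfl fun b _ => mul_left_comm _ _ _

end DerivativeValues

section ZeroEstimate

open Topology

/-- A nonzero polynomial in a nonconstant analytic function vanishes to bounded order. -/
theorem exists_analyticOrderAt_polynomial_eval_lt {g : ℂ → ℂ} {u : ℂ} (hg : AnalyticAt ℂ g u)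
    (hne : ¬ ∀ᶠ z in 𝓝 u, g z = g u) :
    ∃ k : ℕ, 1 ≤ k ∧ ∀ N : ℕ, ∀ p : Polynomial ℂ, p ≠ 0 → p.natDegree < N →
      analyticOrderAt (fun z => p.eval (g z)) u < (k * N : ℕ) := by
  have hg' : AnalyticAt ℂ (fun z => g z - g u) u := hg.sub analyticAt_const
  have htop : analyticOrderAt (fun z => g z - g u) u ≠ ⊤ := by
    rw [Ne, analyticOrderAt_eq_top]
    simpa only [sub_eq_zero] using hne
  obtain ⟨k, hk⟩ := ENat.ne_top_iff_exists.1 htop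
  refine ⟨k + 1, by omega, fun N p hp hpN => ?_⟩
  obtain ⟨q, hq, hdvd⟩ := p.exists_eq_pow_rootMultiplicity_mul_and_not_dvd hp (g u)
  set μ := p.rootMultiplicity (g u)
  have hq0 : q.eval (g u) ≠ 0 := fun h => hdvd (Polynomial.dvd_iff_isRoot.2 h)
  have hqan : AnalyticAt ℂ (fun z => q.eval (g z)) u := hg.aeval_polynomial q
  have hfun : (fun z => p.eval (g z)) = (fun z => g z - g u) ^ μ * fun z => q.eval (g z) := by
    funext z
    rw [hq]
    simp
  have hμ : μ ≤ p.natDegree := by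
    classical
    exact (Polynomial.count_roots (a := g u) p).symm.trans_le
      ((Multiset.count_le_card _ _).trans p.card_roots')
  rw [hfun, analyticOrderAt_mul (hg'.pow μ) hqan, analyticOrderAt_pow hg', ← hk,
    hqan.analyticOrderAt_eq_zero.2 hq0, add_zero, nsmul_eq_mul]
  norm_cast
  nlinarith

namespace PeriodPair

open Polynomial in
theorem _root_.ZetaLike.exists_iteratedDeriv_polyComb_ne_zero {L : PeriodPair} {Z : ℂ → ℂ} {y : ℂ}
    (h : ZetaLike L Z y) : ∃ k : ℕ, 1 ≤ k ∧ ∀ (N : ℕ) (c : Fin N × Fin N → ℂ), c ≠ 0 →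
      ∃ m < N, ∃ t < k * N,
        iteratedDeriv t (polyComb L.weierstrassP Z c) (L.ω₁ / 2 + m * L.ω₂) ≠ 0 := by
  have hu : L.ω₁ / 2 ∉ L.lattice := L.ω₁_div_two_notMem_lattice
  obtain ⟨k, hk1, hk⟩ := exists_analyticOrderAt_polynomial_eval_lt (analyticAt_weierstrassP hu)
    (not_eventually_weierstrassP_eq hu _)
  refine ⟨k, hk1, fun N c hc => ?_⟩
  by_contra! hzero
  set x : ℂ := 2 * Real.pi * Complex.I / L.ω₁ with hx
  have hx0 : x ≠ 0 := div_ne_zero (by simp [Real.pi_ne_zero]) L.ω₁_ne_zero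
  have hper : ∀ z ∉ L.lattice, ∀ m : ℕ, L.weierstrassP (z + m * L.ω₂) = L.weierstrassP z ∧
      Z (z + m * L.ω₂) = Z z - m * x := fun z hz m => by
    have h1 := quasiPeriodic_weierstrassP.add_int hz 0 m
    have h2 := h.quasi.add_int hz 0 m
    simp only [Int.cast_zero, zero_mul, zero_add, Int.cast_natCast, mul_zero, add_zero] at h1 h2
    exact ⟨h1, h2.trans (by rw [hx]; ring)⟩
  let p : Fin N → ℂ[X] := fun j => ∑ i : Fin N, C (c (i, j)) * X ^ (i : ℕ)
  have hpcoeff : ∀ i j, (p j).coeff (i : Fin N) = c (i, j) := fun i j => by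
    simp only [p, finsetSum_coeff, coeff_C_mul, coeff_X_pow]
    simp [Fin.val_inj]
  have hpdeg : ∀ j, (p j).natDegree < N := fun j => by
    have hN : 0 < N := Fin.pos j
    refine lt_of_le_of_lt (natDegree_sum_le_of_forall_le _ _ (n := N - 1) fun i _ => ?_)
      (Nat.sub_lt hN one_pos)
    exact (natDegree_C_mul_X_pow_le _ _).trans (by have := i.2; omega)
  obtain ⟨j₀, hj₀⟩ : ∃ j, p j ≠ 0 := by
    by_contra! hp
    exact hc (funext fun b => by rw [← hpcoeff b.1 b.2, hp]; simp)
  classical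
  obtain ⟨J, hJ, hJmax⟩ := (Finset.univ.filter fun j => p j ≠ 0).exists_max_image id
    ⟨j₀, by simpa using hj₀⟩
  simp only [Finset.mem_filter, Finset.mem_univ, true_and, id] at hJ hJmax
  have hcomb : ∀ z m, z ∉ L.lattice → polyComb L.weierstrassP Z c (z + (m : ℕ) * L.ω₂) =
      (∑ j : Fin N, C ((p j).eval (L.weierstrassP z)) * X ^ (j : ℕ)).eval (Z z - m * x) := by
    intro z m hz
    rw [polyComb, (hper z hz m).1, (hper z hz m).2, Fintype.sum_prod_type, Finset.sum_comm]
    simp only [p, eval_finsetSum, eval_mul, eval_C, eval_pow, eval_X, Finset.sum_mul, mul_assoc]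
  let s := Finset.range (J + 1)
  let κ : ℕ → ℂ := fun m => (∏ j ∈ s.erase m, (((j : ℂ) - m) * x))⁻¹
  have hpJ : ∀ z ∉ L.lattice, (p J).eval (L.weierstrassP z) =
      ∑ m ∈ s, κ m * polyComb L.weierstrassP Z c (z + (m : ℕ) * L.ω₂) := by
    intro z hz
    set P : ℂ[X] := ∑ j : Fin N, C ((p j).eval (L.weierstrassP z)) * X ^ (j : ℕ) with hP
    have hPdeg : P.degree < s.card := by
      rw [Finset.card_range]
      refine (degree_sum_le _ _).trans_lt ((Finset.sup_lt_iff (WithBot.bot_lt_coe _)).2 fun j _ => ?_)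
      by_cases hj : p j = 0
      · simp [hj]
      · refine (degree_C_mul_X_pow_le _ _).trans_lt ?_
        exact_mod_cast Nat.lt_succ_of_le (hJmax j hj)
    have hinj : Set.InjOn (fun m : ℕ => Z z - m * x) s := fun a _ b _ hab => by
      have : (a : ℂ) * x = b * x := by linear_combination -hab
      exact_mod_cast mul_right_cancel₀ hx0 this
    have h1 := Lagrange.coeff_eq_sum hinj hPdeg
    have h2 : P.coeff (s.card - 1) = (p J).eval (L.weierstrassP z) := by
      rw [Finset.card_range, Nat.add_sub_cancel, hP]
      simp only [finsetSum_coeff, coeff_C_mul, coeff_X_pow]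
      simp [Fin.val_inj]
    rw [← h2, h1]
    refine Finset.sum_congr rfl fun m _ => ?_
    rw [hcomb z m hz, div_eq_inv_mul]
    congr 2
    exact Finset.prod_congr rfl fun j _ => by ring
  have hmem : ∀ m : ℕ, L.ω₁ / 2 + m * L.ω₂ ∉ L.lattice := fun m hm => hu <| by
    refine (L.add_mem_lattice_iff (z := L.ω₁ / 2) (l := m * L.ω₂) ?_).1 hm
    simpa using L.int_coords_mem_lattice 0 m
  have han : ∀ m : ℕ, AnalyticAt ℂ (polyComb L.weierstrassP Z c) (L.ω₁ / 2 + m * L.ω₂) := by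
    intro m
    have h1 := analyticAt_weierstrassP (hmem m)
    have h2 := h.analytic _ (hmem m)
    unfold polyComb
    fun_prop
  have han' : ∀ m : ℕ, AnalyticAt ℂ
      (fun z => κ m * polyComb L.weierstrassP Z c (z + (m : ℕ) * L.ω₂)) (L.ω₁ / 2) := fun m =>
    analyticAt_const.mul (AnalyticAt.fun_comp (f := fun z => z + (m : ℕ) * L.ω₂) (han m)
      (by fun_prop))
  have hlt := hk N (p J) hJ (hpdeg J)
  refine absurd hlt (not_lt.2 ?_)
  have hev : (fun z => (p J).eval (L.weierstrassP z)) =ᶠ[𝓝 (L.ω₁ / 2)]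
      fun z => ∑ m ∈ s, κ m * polyComb L.weierstrassP Z c (z + (m : ℕ) * L.ω₂) := by
    filter_upwards [L.isOpen_compl_lattice.mem_nhds hu] with z hz
    exact hpJ z hz
  rw [analyticOrderAt_congr hev, natCast_le_analyticOrderAt_iff_iteratedDeriv_eq_zero
    (Finset.analyticAt_fun_sum _ fun m _ => han' m)]
  intro t ht
  rw [iteratedDeriv_fun_sum fun m _ => (han' m).contDiffAt]
  refine Finset.sum_eq_zero fun m hm => ?_
  rw [iteratedDeriv_const_mul_field, iteratedDeriv_comp_add_const]
  have hmN : m < N := by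
    have := J.2
    rw [Finset.mem_range] at hm
    omega
  simp only [hzero m hmN t ht, mul_zero]

end PeriodPair

end ZeroEstimate

section SmallValues

open Real in
theorem pow_le_exp_of_le {x s t : ℝ} (hx0 : 0 ≤ x) (hx : x ≤ exp s) (m : ℕ) (hm : m * s ≤ t) :
    x ^ m ≤ exp t :=
  calc x ^ m ≤ exp s ^ m := by gcongr
    _ = exp (m * s) := (exp_nat_mul _ _).symm
    _ ≤ exp t := exp_le_exp.2 hm

open Real in
theorem mul_le_exp_of_le {x y s t r : ℝ} (hy0 : 0 ≤ y) (hx : x ≤ exp s) (hy : y ≤ exp t)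
    (h : s + t ≤ r) : x * y ≤ exp r :=
  calc x * y ≤ exp s * exp t := by gcongr
    _ = exp (s + t) := (exp_add _ _).symm
    _ ≤ exp r := exp_le_exp.2 h

open Real in
theorem le_exp_self (x : ℝ) : x ≤ exp x := by linarith [add_one_le_exp x]

open Real in
theorem mul_pow_le_exp {κ : ℝ} (hκ : 0 ≤ κ) (a : ℕ) {n : ℕ} (hn : 1 ≤ n) :
    κ * (n : ℝ) ^ a ≤ exp ((κ + a) * n) := by
  have hn' : (1 : ℝ) ≤ n := by exact_mod_cast hn
  refine mul_le_exp_of_le (by positivity) (le_exp_self κ)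
    (pow_le_exp_of_le (by positivity) (le_exp_self (n : ℝ)) a le_rfl) ?_
  nlinarith

open Polynomial Real in
theorem false_of_small_values {θ : ℂ} (hθ : Transcendental ℤ θ) {q : ℕ} {e : Fin q → ℂ}
    (he : PolyIndep θ e) (hq : 0 < q) {C : ℝ} (hC : 1 ≤ C) (n₀ : ℕ)
    (h : ∀ n : ℕ, n₀ ≤ n → ∃ v : ℂ, v ≠ 0 ∧ ∃ D : ℕ, (D : ℝ) ≤ C * n ^ 10 ∧
      MatRep θ e v D (exp (C * n ^ 11)) ∧ ‖v‖ ≤ exp (C * n ^ 11 - n ^ 22 / C)) : False := by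
  obtain ⟨K, hK, hnorm⟩ := exists_norm_poly he hq
  set Θ : ℝ := max 1 ‖θ‖ with hΘ
  have hΘ1 : 1 ≤ Θ := le_max_left _ _
  have hq1 : (1 : ℝ) ≤ q := by exact_mod_cast hq
  have hf1 : (0 : ℝ) ≤ (q.factorial : ℝ) := by positivity
  set A : ℝ := K + q * (C + Θ * C) + C with hA
  have hA0 : 0 ≤ A := by positivity
  refine gelfond_criterion hθ (C := 2 * C + q.factorial + q * C) (by nlinarith)
    (max (max n₀ 1) ⌈2 * C * A⌉₊) fun n hn => ?_
  have hn0 : n₀ ≤ n := by omega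
  have hn1 : 1 ≤ n := by omega
  have hn1' : (1 : ℝ) ≤ n := by exact_mod_cast hn1
  have hnA : 2 * C * A ≤ n := (Nat.le_ceil _).trans (by exact_mod_cast (by omega))
  obtain ⟨v, hv0, D, hD, hv, hvn⟩ := h n hn0
  have h11 : (1 : ℝ) ≤ (n : ℝ) ^ 11 := one_le_pow₀ hn1'
  have h1011 : (n : ℝ) ^ 10 ≤ (n : ℝ) ^ 11 := pow_le_pow_right₀ hn1' (by norm_num)
  obtain ⟨R, hR0, hRd, hRl, hRn⟩ := hnorm v D _ hv0 (one_le_exp (by positivity)) hv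
  refine ⟨R, hR0, ?_, ?_, ?_⟩
  · calc (R.natDegree : ℝ) ≤ q * D := by exact_mod_cast hRd
      _ ≤ q * (C * n ^ 10) := by gcongr
      _ ≤ _ := by rw [← mul_assoc]; gcongr; linarith
  · refine hRl.trans (mul_le_exp_of_le (by positivity) (le_exp_self _)
      (pow_le_exp_of_le (by positivity) le_rfl q le_rfl) ?_)
    nlinarith [mul_nonneg hf1 (sub_nonneg.2 h11)]
  · have hΘD : Θ ^ D ≤ exp (Θ * (C * n ^ 11)) := by
      refine pow_le_exp_of_le (by positivity) (le_exp_self Θ) D ?_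
      rw [mul_comm]
      gcongr
      exact hD.trans (by gcongr)
    have h1 : exp (C * n ^ 11) * Θ ^ D ≤ exp ((C + Θ * C) * n ^ 11) :=
      mul_le_exp_of_le (by positivity) le_rfl hΘD (by linarith)
    have h2 : K * (exp (C * n ^ 11) * Θ ^ D) ^ q ≤ exp ((K + q * (C + Θ * C)) * n ^ 11) := by
      refine mul_le_exp_of_le (by positivity) (le_exp_self K)
        (pow_le_exp_of_le (by positivity) h1 q le_rfl) ?_
      nlinarith
    refine hRn.trans (mul_le_exp_of_le (norm_nonneg _) h2 hvn ?_)
    have h3 : 2 * C * (A * n ^ 11) ≤ (n : ℝ) ^ 22 := by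
      calc 2 * C * (A * (n : ℝ) ^ 11) = 2 * C * A * (n : ℝ) ^ 11 := by ring
        _ ≤ (n : ℝ) * (n : ℝ) ^ 11 := by gcongr
        _ = (n : ℝ) ^ 12 := by ring
        _ ≤ _ := pow_le_pow_right₀ hn1' (by norm_num)
    have h4 : A * n ^ 11 ≤ (n : ℝ) ^ 22 / (2 * C) := by
      rw [le_div_iff₀ (by positivity)]; linarith
    have h5 : (n : ℝ) ^ 22 / (2 * C + q.factorial + q * C) ≤ n ^ 22 / (2 * C) := by
      gcongr
      nlinarith
    have h6 : (n : ℝ) ^ 22 / C = n ^ 22 / (2 * C) + n ^ 22 / (2 * C) := by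
      field_simp; ring
    rw [hA] at h4
    linarith

end SmallValues

namespace PeriodPair

open Topology

variable {L : PeriodPair} {Z : ℂ → ℂ} {y : ℂ}

theorem half_add_notMem (L : PeriodPair) (m n : ℤ) :
    L.ω₁ / 2 + (m * L.ω₁ + n * L.ω₂) ∉ L.lattice := fun h =>
  L.ω₁_div_two_notMem_lattice ((L.add_mem_lattice_iff (L.int_coords_mem_lattice m n)).1 h)

/-- A point outside the lattice has positive distance to it. -/
theorem exists_le_norm_sub (L : PeriodPair) {u : ℂ} (hu : u ∉ L.lattice) :
    ∃ ρ : ℝ, 0 < ρ ∧ ρ ≤ 1 ∧ ∀ l ∈ L.lattice, 2 * ρ ≤ ‖u - l‖ := by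
  obtain ⟨ε, hε, hball⟩ := Metric.isOpen_iff.1 L.isOpen_compl_lattice u hu
  refine ⟨min 1 (ε / 2), lt_min one_pos (half_pos hε), min_le_left _ _, fun l hl => ?_⟩
  have h1 : ¬ ‖l - u‖ < ε := fun h => hball (by rwa [Metric.mem_ball, dist_eq_norm]) hl
  rw [norm_sub_rev]
  have := min_le_right 1 (ε / 2)
  linarith

/-- Extrapolation for polynomial combinations of `℘` and a zeta function. -/
theorem _root_.ZetaLike.exists_norm_iteratedDeriv_polyComb_le (h : ZetaLike L Z y) :
    ∃ ρ : ℝ, 0 < ρ ∧ ∃ C c₀ : ℕ, 2 ≤ c₀ ∧ ∀ (N T M : ℕ) (c : Fin N × Fin N → ℂ) (H : ℝ) (t : ℕ),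
      0 < T → 0 < M → 0 ≤ H → (∀ b, ‖c b‖ ≤ H) →
      (∀ m < M, ∀ t < T,
        iteratedDeriv t (polyComb L.weierstrassP Z c) (L.ω₁ / 2 + m * L.ω₂) = 0) →
      ‖iteratedDeriv t (polyComb L.weierstrassP Z c) (L.ω₁ / 2 + M * L.ω₂)‖ ≤
        t.factorial * (H * ((c₀ * M : ℕ) : ℝ) ^ (C * N * (c₀ * M) ^ 2) *
          2⁻¹ ^ (T * M ^ 2)) / ρ ^ t := by
  classical
  obtain ⟨C₁, h₁⟩ := quasiPeriodic_weierstrassP.exists_poleGrowth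
    (fun z hz => analyticAt_weierstrassP hz) L.regularAt_sq_mul_weierstrassP
  obtain ⟨C₂, h₂⟩ := h.quasi.exists_poleGrowth h.analytic h.regularAt
  have hg := h₁.doublePoleGrowth h₂
  rw [Set.union_self] at hg
  obtain ⟨ρ, hρ, hρ1, hρl⟩ := L.exists_le_norm_sub L.ω₁_div_two_notMem_lattice
  obtain ⟨C, hC⟩ := hg.exists_norm_iteratedDeriv_le hρ hρ1
  refine ⟨ρ, hρ, C, max 2 ⌈2 * ‖L.ω₁‖ + ‖L.ω₂‖⌉₊, le_max_left _ _,
    fun N T M c H t hT hM hH hc hzero => ?_⟩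
  set c₀ := max 2 ⌈2 * ‖L.ω₁‖ + ‖L.ω₂‖⌉₊
  have hc₀ : 2 * ‖L.ω₁‖ + ‖L.ω₂‖ ≤ c₀ := (Nat.le_ceil _).trans (by exact_mod_cast le_max_right _ _)
  have hM1 : (1 : ℝ) ≤ M := by exact_mod_cast hM
  have hbound : ∀ i m : ℕ, i ≤ M → m ≤ M →
      ‖L.ω₁ / 2 + (i * L.ω₁ + m * L.ω₂)‖ ≤ (c₀ * M : ℕ) := fun i m hi hm => by
    have hi' : (i : ℝ) ≤ M := by exact_mod_cast hi
    have hm' : (m : ℝ) ≤ M := by exact_mod_cast hm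
    calc ‖L.ω₁ / 2 + (i * L.ω₁ + m * L.ω₂)‖ ≤ ‖L.ω₁ / 2‖ + (‖i * L.ω₁‖ + ‖m * L.ω₂‖) :=
          (norm_add_le _ _).trans (by gcongr; exact norm_add_le _ _)
      _ = ‖L.ω₁‖ / 2 + (i * ‖L.ω₁‖ + m * ‖L.ω₂‖) := by simp
      _ ≤ M * ‖L.ω₁‖ + (M * ‖L.ω₁‖ + M * ‖L.ω₂‖) := by
          gcongr
          nlinarith [norm_nonneg L.ω₁]
      _ = M * (2 * ‖L.ω₁‖ + ‖L.ω₂‖) := by ring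
      _ ≤ M * c₀ := by gcongr
      _ = _ := by push_cast; ring
  let pt : ℕ × ℕ → ℂ := fun a => L.ω₁ / 2 + (a.1 * L.ω₁ + a.2 * L.ω₂)
  have hpt : Function.Injective pt := fun a b hab => by
    have h1 := L.int_coords_injective (m := a.1) (n := a.2) (m' := b.1) (n' := b.2)
      (by simpa using add_left_cancel hab)
    exact Prod.ext (by exact_mod_cast h1.1) (by exact_mod_cast h1.2)
  have hptmem : ∀ a, pt a ∉ (L.lattice : Set ℂ) := fun a => by
    have := L.half_add_notMem a.1 a.2
    simpa [pt] using this
  let W : Finset ℂ := (Finset.range M ×ˢ Finset.range M).image pt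
  have hW : W.card = M ^ 2 := by
    rw [Finset.card_image_of_injective _ hpt, Finset.card_product, Finset.card_range, sq]
  have hperiod : ∀ a : ℕ × ℕ, ∀ t, iteratedDeriv t (polyComb L.weierstrassP Z c) (pt a) =
      iteratedDeriv t (polyComb L.weierstrassP Z c) (L.ω₁ / 2 + a.2 * L.ω₂) := fun a t => by
    have hmem : L.ω₁ / 2 + a.2 * L.ω₂ ∉ L.lattice := by
      have := L.half_add_notMem 0 a.2
      simpa using this
    have h1 : (fun z => polyComb L.weierstrassP Z c (z + a.1 * L.ω₁)) =ᶠ[𝓝 (L.ω₁ / 2 + a.2 * L.ω₂)]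
        polyComb L.weierstrassP Z c := by
      filter_upwards [L.isOpen_compl_lattice.mem_nhds hmem] with z hz
      have h1 := quasiPeriodic_weierstrassP.add_int hz a.1 0
      have h2 := h.quasi.add_int hz a.1 0
      simp only [Int.cast_natCast, Int.cast_zero, zero_mul, mul_zero, add_zero] at h1 h2
      simp only [polyComb, h1, h2]
    rw [← h1.iteratedDeriv_eq t, iteratedDeriv_comp_add_const]
    congr 1
    simp only [pt]
    ring
  have key := hC N T (c₀ * M) c H W (L.ω₁ / 2 + M * L.ω₂) t hT
    ((le_max_left 2 _).trans (Nat.le_mul_of_pos_right _ hM)) hH hc ?_ ?_ ?_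
  · rwa [hW] at key
  · intro w hw
    obtain ⟨a, ha, rfl⟩ := Finset.mem_image.1 hw
    rw [Finset.mem_product, Finset.mem_range, Finset.mem_range] at ha
    refine ⟨hbound a.1 a.2 ha.1.le ha.2.le, hptmem a, fun t ht => ?_⟩
    rw [hperiod]
    exact hzero _ ha.2 t ht
  · have := hbound 0 M (Nat.zero_le _) le_rfl
    simpa using this
  · intro l hl
    have := hρl (l - M * L.ω₂) (sub_mem hl (by simpa using L.int_coords_mem_lattice 0 M))
    rwa [sub_sub_eq_add_sub, add_sub_right_comm, sub_add_eq_add_sub] at this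

/-- The functions `℘`, `℘'`, `Z` and the constants `g₂ / 2` and `y` satisfy an algebraic
differential system with integer coefficients. -/
noncomputable def zetaSystem (L : PeriodPair) (Z : ℂ → ℂ) (y : ℂ) : Fin 5 → ℂ → ℂ :=
  ![L.weierstrassP, L.derivWeierstrassP, Z, fun _ => L.g₂ / 2, fun _ => y]

open MvPolynomial in
/-- The right hand sides of the differential system of `zetaSystem`. -/
noncomputable def zetaField : Fin 5 → MvPolynomial (Fin 5) ℤ :=
  ![X 1, ((6 : ℕ) : MvPolynomial (Fin 5) ℤ) * X 0 ^ 2 - X 3, -X 0 - X 4, 0, 0]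

theorem monoBound_zetaField (i : Fin 5) : MonoBound 2 7 (zetaField i) := by
  have hX : ∀ i : Fin 5, MonoBound 2 1 (MvPolynomial.X i : MvPolynomial (Fin 5) ℤ) := fun i =>
    (MonoBound.of_X i).mono_deg (by norm_num)
  fin_cases i
  · exact (hX 1).mono_count (b := 7) (by norm_num)
  · exact (((MonoBound.of_X 0).pow 2).natMul 6).sub (hX 3)
  · exact ((hX 0).neg.sub (hX 4)).mono_count (b := 7) (by norm_num)
  · exact MonoBound.zero.mono_count (b := 7) (Nat.zero_le _)
  · exact MonoBound.zero.mono_count (b := 7) (Nat.zero_le _)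

theorem _root_.ZetaLike.hasDerivAt_zetaSystem (h : ZetaLike L Z y) {z : ℂ} (hz : z ∉ L.lattice)
    (i : Fin 5) : HasDerivAt (zetaSystem L Z y i)
      (MvPolynomial.aeval (fun j => zetaSystem L Z y j z) (zetaField i)) z := by
  fin_cases i
  · simpa [zetaSystem, zetaField] using hasDerivAt_weierstrassP hz
  · simpa [zetaSystem, zetaField] using hasDerivAt_derivWeierstrassP hz
  · simpa [zetaSystem, zetaField] using h.hasDeriv z hz
  · simpa [zetaSystem, zetaField] using hasDerivAt_const z (L.g₂ / 2)
  · simpa [zetaSystem, zetaField] using hasDerivAt_const z y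

open IntermediateField in
theorem _root_.ZetaLike.exists_matRep_zetaSystem (h : ZetaLike L Z y) {θ : ℂ} (hθ : Transcendental ℤ θ)
    (he : IsAlgebraic ℚ⟮θ⟯ (L.weierstrassP (L.ω₁ / 2)))
    (hx : IsAlgebraic ℚ⟮θ⟯ (2 * Real.pi * Complex.I / L.ω₁))
    (ha : IsAlgebraic ℚ⟮θ⟯ (L.g₂ / 2)) (hy : IsAlgebraic ℚ⟮θ⟯ y) :
    ∃ q, 0 < q ∧ ∃ e : Fin q → ℂ, PolyIndep θ e ∧ ∃ d, d ≠ 0 ∧ ∃ δ : ℕ, ∃ H : ℝ, 1 ≤ H ∧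
      MatRep θ e d δ H ∧ ∀ X m : ℕ, 1 ≤ X → m ≤ X → ∀ i,
        MatRep θ e (d * zetaSystem L Z y i (L.ω₁ / 2 + m * L.ω₂)) δ (X * H) := by
  set x : ℂ := 2 * Real.pi * Complex.I / L.ω₁ with hxdef
  obtain ⟨q, hq, e, hpe, d, hd0, δ, H, hH, hd, hγ⟩ := exists_matRep_of_isAlgebraic_adjoin hθ
    (![L.weierstrassP (L.ω₁ / 2), x, L.g₂ / 2, y] : Fin 4 → ℂ) (fun i => by
      fin_cases i <;> assumption)
  refine ⟨q, hq, e, hpe, d, hd0, δ, H, hH, hd, fun X m hX hmX => ?_⟩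
  have hX1 : (1 : ℝ) ≤ X := by exact_mod_cast hX
  have hHX : H ≤ X * H := by nlinarith
  have hu := L.ω₁_div_two_notMem_lattice
  have hml : m * L.ω₂ ∈ L.lattice := by simpa using L.int_coords_mem_lattice 0 m
  have hZ : Z (L.ω₁ / 2 + m * L.ω₂) = -(m * x) := by
    have h2 := h.quasi.add_int hu 0 m
    simp only [Int.cast_zero, zero_mul, zero_add, Int.cast_natCast, mul_zero] at h2
    rw [h2, h.half, hxdef]
    ring
  intro i
  fin_cases i
  · simpa [zetaSystem, weierstrassP_add_of_mem _ hml] using (hγ 0).mono le_rfl hHX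
  · have : L.derivWeierstrassP (L.ω₁ / 2) = 0 := derivWeierstrassP_eq_zero_of_two_mul_mem
      (by rw [mul_div_cancel₀ _ two_ne_zero]; exact L.ω₁_mem_lattice)
    simpa [zetaSystem, derivWeierstrassP_add_of_mem _ hml, this] using
      MatRep.zero.mono (Nat.zero_le δ) (show (0 : ℝ) ≤ X * H by positivity)
  · have h1 := ((MatRep.intCast (θ := θ) (e := e) (m : ℤ)).mul (hγ 1) (abs_nonneg _)).neg
    have h2 : MatRep θ e (d * -(m * x)) δ (X * H) := by
      refine (Eq.subst (motive := fun v => MatRep θ e v _ _) ?_ h1 : MatRep θ e (d * -(m * x)) _ _).mono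
        (by simp) ?_
      · simp; ring
      · simp only [Int.cast_natCast, Nat.abs_cast]
        gcongr
    simpa [zetaSystem, hZ] using h2
  · simpa [zetaSystem] using (hγ 2).mono le_rfl hHX
  · simpa [zetaSystem] using (hγ 3).mono le_rfl hHX

end PeriodPair

namespace PeriodPair

open Real

/-- The height of the values of the auxiliary function, as a power of the number of its derivatives. -/
theorem system_height_le {n S : ℕ} (hn : 1 ≤ n) (hS : S ≤ 3 * n ^ 10) {H : ℝ} (hH : 1 ≤ H) :
    (((S * 7 : ℕ) : ℝ) ^ (n ^ 10) * (((n ^ 8 : ℕ) : ℝ) * H) ^ S) ≤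
      exp ((31 + 3 * (H + 8)) * n ^ 11) := by
  have hn' : (1 : ℝ) ≤ n := by exact_mod_cast hn
  have hS' : (S : ℝ) ≤ 3 * n ^ 10 := by exact_mod_cast hS
  have h1 : ((S * 7 : ℕ) : ℝ) ≤ exp ((21 + (10 : ℕ)) * n) := by
    refine le_trans ?_ (mul_pow_le_exp (κ := 21) (by norm_num) 10 hn)
    push_cast
    linarith
  have h2 : ((n ^ 8 : ℕ) : ℝ) * H ≤ exp ((H + (8 : ℕ)) * n) := by
    have := mul_pow_le_exp (κ := H) (by linarith) 8 hn
    push_cast at this ⊢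
    linarith
  refine mul_le_exp_of_le (by positivity) (pow_le_exp_of_le (by positivity) h1 _ le_rfl)
    (pow_le_exp_of_le (t := 3 * (H + 8) * n ^ 11) (by positivity) h2 _ ?_) (le_of_eq ?_)
  · push_cast
    calc (S : ℝ) * ((H + 8) * n) ≤ 3 * n ^ 10 * ((H + 8) * n) := by gcongr
      _ = _ := by ring
  · push_cast
    ring

theorem extrapolation_bound_le {n M c₀ C t q : ℕ} {ρ H A : ℝ} (hn : 1 ≤ n) (hρ : 0 < ρ)
    (hH0 : 0 ≤ H) (hH : H ≤ exp (A * n ^ 11)) (hc₀ : 2 ≤ c₀) (hM0 : 0 < M) (hM : M ≤ n ^ 8)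
    (ht : t ≤ n ^ 10) (hnC : 4 * (C * c₀ ^ 2 * (c₀ + 8)) ≤ n) (hnM : n ^ 6 ≤ 8 * q * M) :
    t.factorial * (H * ((c₀ * M : ℕ) : ℝ) ^ (C * n ^ 8 * (c₀ * M) ^ 2) *
          2⁻¹ ^ (n ^ 10 * M ^ 2)) / ρ ^ t ≤
      exp ((10 + ρ⁻¹ + A) * n ^ 11 - n ^ 22 / (256 * q ^ 2)) := by
  have hn' : (1 : ℝ) ≤ n := by exact_mod_cast hn
  have h1011 : (n : ℝ) ^ 10 ≤ (n : ℝ) ^ 11 := pow_le_pow_right₀ hn' (by norm_num)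
  have ht' : (t : ℝ) ≤ n ^ 10 := by exact_mod_cast ht
  have hM' : (M : ℝ) ≤ n ^ 8 := by exact_mod_cast hM
  have hfac : (t.factorial : ℝ) ≤ exp (10 * n ^ 11) := by
    have h1 : (t.factorial : ℝ) ≤ ((n ^ 10 : ℕ) : ℝ) ^ (n ^ 10) := by
      have : t.factorial ≤ (n ^ 10) ^ (n ^ 10) :=
        (Nat.factorial_le ht).trans (Nat.factorial_le_pow _)
      exact_mod_cast this
    refine h1.trans (pow_le_exp_of_le (s := 10 * n) (by positivity) ?_ _ ?_)
    · have := mul_pow_le_exp (κ := 0) le_rfl 10 hn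
      push_cast
      refine pow_le_exp_of_le (by positivity) (le_exp_self (n : ℝ)) 10 (by norm_num)
    · push_cast
      exact le_of_eq (by ring)
  have hρt : (ρ ^ t)⁻¹ ≤ exp (ρ⁻¹ * n ^ 11) := by
    rw [← inv_pow]
    refine pow_le_exp_of_le (by positivity) (le_exp_self _) t ?_
    rw [mul_comm]
    gcongr
    exact ht'.trans h1011
  have hr : ((c₀ * M : ℕ) : ℝ) ^ (C * n ^ 8 * (c₀ * M) ^ 2) ≤ exp (n ^ 10 * M ^ 2 / 4) := by
    refine pow_le_exp_of_le (s := (c₀ + (8 : ℕ)) * n) (by positivity) ?_ _ ?_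
    · refine le_trans ?_ (mul_pow_le_exp (κ := c₀) (by positivity) 8 hn)
      push_cast
      gcongr
    · have hnC' : (4 * (C * c₀ ^ 2 * (c₀ + 8)) : ℝ) ≤ n := by exact_mod_cast hnC
      push_cast
      calc (C * n ^ 8 * (c₀ * M) ^ 2 * ((c₀ + 8) * n) : ℝ)
          = (4 * (C * c₀ ^ 2 * (c₀ + 8))) * (n ^ 9 * M ^ 2 / 4) := by ring
        _ ≤ n * (n ^ 9 * M ^ 2 / 4) := by gcongr
        _ = _ := by ring
  have h2 : (2⁻¹ : ℝ) ^ (n ^ 10 * M ^ 2) ≤ exp (-(n ^ 10 * M ^ 2 / 2)) := by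
    refine pow_le_exp_of_le (s := -(1 / 2)) (by norm_num) ?_ _ ?_
    · have := add_one_le_exp (-(1 / 2) : ℝ)
      norm_num at this ⊢
      linarith
    · push_cast
      exact le_of_eq (by ring)
  have hq : 0 < q := by
    rcases Nat.eq_zero_or_pos q with rfl | h
    · have := Nat.pow_pos (n := 6) hn
      simp at hnM
      omega
    · exact h
  have hq' : (0 : ℝ) < q := by exact_mod_cast hq
  have hbig : (n : ℝ) ^ 22 / (256 * q ^ 2) ≤ n ^ 10 * M ^ 2 / 4 := by
    have h3 : (n : ℝ) ^ 6 ≤ 8 * q * M := by exact_mod_cast hnM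
    rw [div_le_div_iff₀ (by positivity) (by norm_num)]
    calc (n : ℝ) ^ 22 * 4 = 4 * (n : ℝ) ^ 10 * ((n : ℝ) ^ 6) ^ 2 := by ring
      _ ≤ 4 * (n : ℝ) ^ 10 * (8 * q * M : ℝ) ^ 2 := by gcongr
      _ = _ := by ring
  have h3 := mul_le_exp_of_le (r := A * n ^ 11 + n ^ 10 * M ^ 2 / 4) (by positivity) hH hr le_rfl
  have h4 := mul_le_exp_of_le (r := A * n ^ 11 - n ^ 10 * M ^ 2 / 4) (by positivity) h3 h2
    (by linarith)
  have h5 := mul_le_exp_of_le (r := (10 + A) * n ^ 11 - n ^ 10 * M ^ 2 / 4) (by positivity) hfac h4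
    (by linarith)
  rw [div_eq_mul_inv]
  exact mul_le_exp_of_le (by positivity) h5 hρt (by linarith)

set_option maxHeartbeats 1000000 in
open Polynomial IntermediateField in
/-- **Chudnovsky's theorem** in the form of a lower bound for a transcendence degree. -/
theorem _root_.ZetaLike.false_of_isAlgebraic {L : PeriodPair} {Z : ℂ → ℂ} {y : ℂ} (h : ZetaLike L Z y)
    {θ : ℂ} (hθ : Transcendental ℤ θ)
    (he : IsAlgebraic ℚ⟮θ⟯ (L.weierstrassP (L.ω₁ / 2)))
    (hx : IsAlgebraic ℚ⟮θ⟯ (2 * Real.pi * Complex.I / L.ω₁))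
    (ha : IsAlgebraic ℚ⟮θ⟯ (L.g₂ / 2)) (hy : IsAlgebraic ℚ⟮θ⟯ y) : False := by
  obtain ⟨q, hq, e, hpe, d, hd0, δ, H₀, hH₀, hd, hγ⟩ := h.exists_matRep_zetaSystem hθ he hx ha hy
  obtain ⟨k, hk1, hk⟩ := h.exists_iteratedDeriv_polyComb_ne_zero
  obtain ⟨ρ, hρ, C, c₀, hc₀, hext⟩ := h.exists_norm_iteratedDeriv_polyComb_le
  set Θ : ℝ := max 1 ‖θ‖ with hΘ
  have hΘ1 : 1 ≤ Θ := le_max_left _ _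
  set A₁ : ℝ := 31 + 3 * (H₀ + 8) with hA₁
  set A₂ : ℝ := 2 * (3 * δ + 11) + 16 + A₁ with hA₂
  set A₃ : ℝ := A₂ + 3 * δ * Θ with hA₃
  set A₄ : ℝ := 10 + ρ⁻¹ + A₃ + 3 * ‖d‖ with hA₄
  have hA₁0 : 0 ≤ A₁ := by positivity
  have hA₂0 : 0 ≤ A₂ := by positivity
  have hA₃0 : 0 ≤ A₃ := by positivity
  have hA₄0 : 0 ≤ A₄ := by positivity
  have hq1 : (1 : ℝ) ≤ q := by exact_mod_cast hq
  refine false_of_small_values hθ hpe hq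
    (C := 256 * q ^ 2 + 6 * δ + (16 + A₂ + A₁) + A₄) (by nlinarith [sq_nonneg (q - 1 : ℝ)])
    (k + 4 * q + 4 * (C * c₀ ^ 2 * (c₀ + 8))) fun n hn => ?_
  have hn1 : 1 ≤ n := by omega
  have hn' : (1 : ℝ) ≤ n := by exact_mod_cast hn1
  have hnk : k * n ^ 8 ≤ n ^ 10 := by
    calc k * n ^ 8 ≤ n * n ^ 8 := by gcongr; omega
      _ = n ^ 9 := by ring
      _ ≤ n ^ 10 := Nat.pow_le_pow_right hn1 (by norm_num)
  have h1011 : (n : ℝ) ^ 10 ≤ (n : ℝ) ^ 11 := pow_le_pow_right₀ hn' (by norm_num)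
  have hn11 : (n : ℝ) ≤ (n : ℝ) ^ 11 := le_self_pow₀ hn' (by norm_num)
  set S := 2 * n ^ 8 + n ^ 10 with hS
  have hS3 : S ≤ 3 * n ^ 10 := by
    have : n ^ 8 ≤ n ^ 10 := Nat.pow_le_pow_right hn1 (by norm_num)
    omega
  have hS3' : (S : ℝ) ≤ 3 * n ^ 10 := by exact_mod_cast hS3
  have hHn : (1 : ℝ) ≤ (n ^ 8 : ℕ) * H₀ := by
    have : (1 : ℝ) ≤ (n ^ 8 : ℕ) := by exact_mod_cast Nat.pow_pos hn1
    nlinarith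
  have hdn : MatRep θ e d δ ((n ^ 8 : ℕ) * H₀) := hd.mono le_rfl (by
    have : (1 : ℝ) ≤ (n ^ 8 : ℕ) := by exact_mod_cast Nat.pow_pos hn1
    nlinarith)
  have hmem : ∀ m : ℕ, L.ω₁ / 2 + m * L.ω₂ ∉ L.lattice := fun m => by
    have := L.half_add_notMem 0 m
    simpa using this
  have hN6 : n ^ 6 / (4 * q) ≤ n ^ 6 := Nat.div_le_self _ _
  have h68 : n ^ 6 ≤ n ^ 8 := Nat.pow_le_pow_right hn1 (by norm_num)
  have hqn : 4 * q ≤ n ^ 6 := (by omega : 4 * q ≤ n).trans (Nat.le_self_pow (by norm_num) n)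
  have hN0 : 0 < n ^ 6 / (4 * q) := Nat.div_pos hqn (by omega)
  obtain ⟨c, hc0, hcD, hcP, hczero⟩ := exists_polyComb_zeros (M := n ^ 6 / (4 * q))
    (w := fun m => L.ω₁ / 2 + (m : ℕ) * L.ω₂) (N := n ^ 8) (T := n ^ 10) (U := (L.lattice : Set ℂ)ᶜ)
    (φ := zetaSystem L Z y) hpe hq
    monoBound_zetaField (by norm_num) L.isOpen_compl_lattice
    (fun z hz i => h.hasDerivAt_zetaSystem hz i) hHn hd0 hdn (fun m => hmem m)
    (fun m i => hγ (n ^ 8) m (Nat.pow_pos hn1) (by have := m.2; omega) i) 0 2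
    (fun m => analyticAt_weierstrassP (hmem m)) (fun m => h.analytic _ (hmem m))
    (Nat.pow_pos hn1) (Nat.pow_pos hn1) hN0 (by
      calc 4 * q * (n ^ 10 * (n ^ 6 / (4 * q))) = n ^ 10 * ((n ^ 6 / (4 * q)) * (4 * q)) := by ring
        _ ≤ n ^ 10 * n ^ 6 := Nat.mul_le_mul_left _ (Nat.div_mul_le_self _ _)
        _ = _ := by ring)
  change ∀ m : Fin (n ^ 6 / (4 * q)), ∀ t < n ^ 10, iteratedDeriv t
    (polyComb L.weierstrassP Z fun b => aeval θ (c b)) (L.ω₁ / 2 + (m : ℕ) * L.ω₂) = 0 at hczero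
  set V : ℝ := ((S * 7 : ℕ) : ℝ) ^ (n ^ 10) * (((n ^ 8 : ℕ) : ℝ) * H₀) ^ S with hV
  have hV0 : 0 ≤ V := by positivity
  have hVle : V ≤ exp (A₁ * n ^ 11) := system_height_le hn1 hS3 hH₀
  set P : ℝ := ((S * δ : ℕ) + 1) * (((n ^ 8) ^ 2 : ℕ) * ((S * δ : ℕ) + 1) * V) with hP
  have hP0 : 0 ≤ P := by positivity
  have hSδ : ((S * δ : ℕ) : ℝ) + 1 ≤ exp ((3 * δ + 11) * n ^ 11) := by
    have h1 : ((S * δ : ℕ) : ℝ) + 1 ≤ (3 * δ + 1) * n ^ 10 := by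
      push_cast
      have : (1 : ℝ) ≤ n ^ 10 := one_le_pow₀ hn'
      nlinarith [mul_le_mul_of_nonneg_right hS3' (Nat.cast_nonneg (α := ℝ) δ)]
    refine h1.trans ((mul_pow_le_exp (by positivity) 10 hn1).trans (exp_le_exp.2 ?_))
    calc ((3 * δ + 1 + (10 : ℕ)) * n : ℝ) = (3 * δ + 11) * n := by push_cast; ring
      _ ≤ _ := by gcongr
  have hn16 : (((n ^ 8) ^ 2 : ℕ) : ℝ) ≤ exp (16 * n ^ 11) := by
    have h1 : (((n ^ 8) ^ 2 : ℕ) : ℝ) = (n : ℝ) ^ 16 := by push_cast; ring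
    rw [h1]
    refine pow_le_exp_of_le (by positivity) (le_exp_self (n : ℝ)) 16 ?_
    push_cast
    gcongr
  have hPle : P ≤ exp (A₂ * n ^ 11) := by
    refine mul_le_exp_of_le (by positivity) hSδ (mul_le_exp_of_le hV0
      (mul_le_exp_of_le (by positivity) hn16 hSδ le_rfl) hVle le_rfl) (le_of_eq ?_)
    rw [hA₂]; ring
  have hcne : (fun b => aeval θ (c b)) ≠ 0 := fun h0 => hc0 (funext fun b =>
    (transcendental_iff.1 hθ) _ (congrFun h0 b))
  have hcnorm : ∀ b, ‖aeval θ (c b)‖ ≤ exp (A₃ * n ^ 11) := fun b => by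
    refine (norm_aeval_le_plen _ (hcD b) θ).trans (mul_le_exp_of_le (by positivity)
      ((hcP b).trans hPle) (pow_le_exp_of_le (t := 3 * δ * Θ * n ^ 11) (by positivity)
        (le_exp_self Θ) _ ?_) (le_of_eq ?_))
    · rw [← hS]
      push_cast
      calc (S * δ * Θ : ℝ) ≤ 3 * n ^ 10 * δ * Θ := by gcongr
        _ ≤ 3 * n ^ 11 * δ * Θ := by gcongr
        _ = _ := by ring
    · rw [hA₃]; ring
  obtain ⟨m₀, hm₀, t₀, ht₀, hne₀⟩ := hk (n ^ 8) _ hcne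
  classical
  have hex : ∃ m : ℕ, ∃ t < n ^ 10, iteratedDeriv t
      (polyComb L.weierstrassP Z fun b => aeval θ (c b)) (L.ω₁ / 2 + m * L.ω₂) ≠ 0 :=
    ⟨m₀, t₀, by omega, hne₀⟩
  set M := Nat.find hex with hM
  obtain ⟨t, ht, hne⟩ := Nat.find_spec hex
  rw [← hM] at hne
  have hMle : M ≤ n ^ 8 := (Nat.find_min' hex ⟨t₀, by omega, hne₀⟩).trans hm₀.le
  have hMge : n ^ 6 / (4 * q) ≤ M := by
    by_contra! hlt
    exact hne (hczero ⟨M, hlt⟩ t ht)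
  have hzero : ∀ m < M, ∀ t < n ^ 10, iteratedDeriv t
      (polyComb L.weierstrassP Z fun b => aeval θ (c b)) (L.ω₁ / 2 + m * L.ω₂) = 0 := by
    intro m hm s hs
    by_contra hcon
    exact Nat.find_min hex hm ⟨s, hs, hcon⟩
  have hnM : n ^ 6 ≤ 8 * q * M := by
    have h1 : n ^ 6 < 4 * q * (n ^ 6 / (4 * q) + 1) := Nat.lt_mul_div_succ _ (by omega)
    have h2 : 4 * q * (n ^ 6 / (4 * q) + 1) ≤ 4 * q * (M + M) :=
      Nat.mul_le_mul_left _ (by omega)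
    calc n ^ 6 ≤ 4 * q * (M + M) := h1.le.trans h2
      _ = _ := by ring
  have hsmall := (hext (n ^ 8) (n ^ 10) M _ _ t (Nat.pow_pos hn1) (by omega) (exp_pos _).le
    hcnorm hzero).trans (extrapolation_bound_le hn1 hρ (exp_pos _).le le_rfl hc₀ (by omega) hMle
      ht.le (by omega) hnM)
  have hval := matRep_iteratedDeriv_polyComb (U := (L.lattice : Set ℂ)ᶜ) (φ := zetaSystem L Z y)
    monoBound_zetaField (by norm_num)
    L.isOpen_compl_lattice (fun z hz i => h.hasDerivAt_zetaSystem hz i) hHn hdn (hmem M)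
    (fun i => hγ (n ^ 8) M (Nat.pow_pos hn1) hMle i) 0 2
    (analyticAt_weierstrassP (hmem M)) (h.analytic _ (hmem M)) ht.le hP0 hcD hcP
  rw [← hS, ← hV] at hval
  have hbound : ((n ^ 8 : ℕ) : ℝ) ^ 2 * (P * V) ≤
      exp ((256 * q ^ 2 + 6 * δ + (16 + A₂ + A₁) + A₄) * n ^ 11) := by
    have h1 := mul_le_exp_of_le (r := (16 + A₂ + A₁) * n ^ 11) (by positivity) hn16
      (mul_le_exp_of_le hV0 hPle hVle le_rfl) (le_of_eq (by ring))
    rw [Nat.cast_pow] at h1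
    refine h1.trans (exp_le_exp.2 (mul_le_mul_of_nonneg_right ?_ (by positivity)))
    have h2 : (0 : ℝ) ≤ 256 * q ^ 2 + 6 * δ := by positivity
    linarith
  have hval' := hval.mono le_rfl hbound
  refine ⟨_, mul_ne_zero (pow_ne_zero S hd0) hne, _, ?_, hval', ?_⟩
  · push_cast
    have : (S * δ + S * δ : ℝ) ≤ 6 * δ * n ^ 10 := by
      nlinarith [mul_le_mul_of_nonneg_right hS3' (Nat.cast_nonneg (α := ℝ) δ)]
    refine this.trans (mul_le_mul_of_nonneg_right ?_ (by positivity))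
    have h2 : (0 : ℝ) ≤ 256 * q ^ 2 := by positivity
    linarith
  · rw [norm_mul, norm_pow]
    have hdS : ‖d‖ ^ S ≤ exp (3 * ‖d‖ * n ^ 11) := by
      refine pow_le_exp_of_le (norm_nonneg d) (le_exp_self _) S ?_
      calc S * ‖d‖ ≤ 3 * n ^ 11 * ‖d‖ := by
            gcongr
            linarith
        _ = _ := by ring
    refine mul_le_exp_of_le (norm_nonneg _) hdS hsmall ?_
    have h1 : (n : ℝ) ^ 22 / (256 * q ^ 2 + 6 * δ + (16 + A₂ + A₁) + A₄) ≤
        n ^ 22 / (256 * q ^ 2) := by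
      refine div_le_div_of_nonneg_left (by positivity) (by positivity) ?_
      have h2 : (0 : ℝ) ≤ 6 * δ := by positivity
      linarith
    have h2 : A₄ * n ^ 11 ≤ (256 * q ^ 2 + 6 * δ + (16 + A₂ + A₁) + A₄) * n ^ 11 := by
      refine mul_le_mul_of_nonneg_right ?_ (by positivity)
      have h2 : (0 : ℝ) ≤ 256 * q ^ 2 + 6 * δ := by positivity
      linarith
    have h3 : A₄ * n ^ 11 = (10 + ρ⁻¹ + A₃) * n ^ 11 + 3 * ‖d‖ * n ^ 11 := by rw [hA₄]; ring
    linarith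

end PeriodPair

namespace PeriodPair

open Topology

theorem ω₁_half_notMem_of_eq {L L' : PeriodPair} (hω : L'.ω₂ = L.ω₁) : L.ω₁ / 2 ∉ L'.lattice := by
  rw [← hω]
  exact L'.ω₂_div_two_notMem_lattice

/-- Extrapolation for polynomial combinations of two Weierstrass functions with a common period. -/
theorem exists_norm_iteratedDeriv_polyComb_weierstrassP_le (L L' : PeriodPair)
    (hω : L'.ω₂ = L.ω₁) :
    ∃ ρ : ℝ, 0 < ρ ∧ ∃ C c₀ : ℕ, 2 ≤ c₀ ∧ ∀ (N T p : ℕ) (c : Fin N × Fin N → ℂ) (H : ℝ),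
      0 < T → 0 < p → 0 ≤ H → (∀ b, ‖c b‖ ≤ H) →
      (∀ t < T, iteratedDeriv t (polyComb L.weierstrassP L'.weierstrassP c) (L.ω₁ / 2) = 0) →
      ‖iteratedDeriv T (polyComb L.weierstrassP L'.weierstrassP c) (L.ω₁ / 2)‖ ≤
        T.factorial * (H * ((c₀ * p ^ 2 : ℕ) : ℝ) ^ (C * N * (c₀ * p ^ 2) ^ 2) *
          2⁻¹ ^ (T * p ^ 2)) / ρ ^ T := by
  classical
  obtain ⟨C₁, h₁⟩ := (quasiPeriodic_weierstrassP (L := L)).exists_poleGrowth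
    (fun z hz => analyticAt_weierstrassP hz) L.regularAt_sq_mul_weierstrassP
  obtain ⟨C₂, h₂⟩ := (quasiPeriodic_weierstrassP (L := L')).exists_poleGrowth
    (fun z hz => analyticAt_weierstrassP hz) L'.regularAt_sq_mul_weierstrassP
  have hg := h₁.doublePoleGrowth h₂
  have hu' := ω₁_half_notMem_of_eq hω
  obtain ⟨ρ₁, hρ₁, hρ₁1, hρ₁l⟩ := L.exists_le_norm_sub L.ω₁_div_two_notMem_lattice
  obtain ⟨ρ₂, hρ₂, hρ₂1, hρ₂l⟩ := L'.exists_le_norm_sub hu'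
  have hρ : 0 < min ρ₁ ρ₂ := lt_min hρ₁ hρ₂
  obtain ⟨C, hC⟩ := hg.exists_norm_iteratedDeriv_le hρ ((min_le_left _ _).trans hρ₁1)
  refine ⟨min ρ₁ ρ₂, hρ, C, max 2 ⌈2 * ‖L.ω₁‖⌉₊, le_max_left _ _,
    fun N T p c H hT hp hH hc hzero => ?_⟩
  set c₀ := max 2 ⌈2 * ‖L.ω₁‖⌉₊
  have hc₀ : 2 * ‖L.ω₁‖ ≤ c₀ := (Nat.le_ceil _).trans (by exact_mod_cast le_max_right _ _)
  have hp2 : 0 < p ^ 2 := by positivity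
  have hp1 : (1 : ℝ) ≤ (p ^ 2 : ℕ) := by exact_mod_cast hp2
  have hml : ∀ m : ℕ, m * L.ω₁ ∈ L.lattice := fun m => by simpa using L.int_coords_mem_lattice m 0
  have hml' : ∀ m : ℕ, m * L.ω₁ ∈ L'.lattice := fun m => by
    rw [← hω]; simpa using L'.int_coords_mem_lattice 0 m
  have hbound : ∀ m : ℕ, m ≤ p ^ 2 → ‖L.ω₁ / 2 + m * L.ω₁‖ ≤ (c₀ * p ^ 2 : ℕ) := fun m hm => by
    have hm' : (m : ℝ) ≤ (p ^ 2 : ℕ) := by exact_mod_cast hm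
    calc ‖L.ω₁ / 2 + m * L.ω₁‖ ≤ ‖L.ω₁ / 2‖ + ‖m * L.ω₁‖ := norm_add_le _ _
      _ = ‖L.ω₁‖ / 2 + m * ‖L.ω₁‖ := by simp
      _ ≤ (p ^ 2 : ℕ) * ‖L.ω₁‖ + (p ^ 2 : ℕ) * ‖L.ω₁‖ := by
          gcongr
          nlinarith [norm_nonneg L.ω₁]
      _ = (p ^ 2 : ℕ) * (2 * ‖L.ω₁‖) := by ring
      _ ≤ (p ^ 2 : ℕ) * c₀ := by gcongr
      _ = _ := by push_cast; ring
  let pt : ℕ → ℂ := fun m => L.ω₁ / 2 + m * L.ω₁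
  have hpt : Function.Injective pt := fun a b hab => by
    have := mul_right_cancel₀ L.ω₁_ne_zero (add_left_cancel hab)
    exact_mod_cast this
  let W : Finset ℂ := (Finset.range (p ^ 2)).image pt
  have hW : W.card = p ^ 2 := by
    rw [Finset.card_image_of_injective _ hpt, Finset.card_range]
  have hperiod : ∀ m t, iteratedDeriv t (polyComb L.weierstrassP L'.weierstrassP c) (pt m) =
      iteratedDeriv t (polyComb L.weierstrassP L'.weierstrassP c) (L.ω₁ / 2) := fun m t => by
    have h1 : (fun z => polyComb L.weierstrassP L'.weierstrassP c (z + m * L.ω₁)) =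
        polyComb L.weierstrassP L'.weierstrassP c := by
      funext z
      simp only [polyComb, weierstrassP_add_of_mem z (hml m), weierstrassP_add_of_mem z (hml' m)]
    conv_rhs => rw [← h1]
    rw [iteratedDeriv_comp_add_const]
  have key := hC N T (c₀ * p ^ 2) c H W (L.ω₁ / 2) T hT
    ((le_max_left 2 _).trans (Nat.le_mul_of_pos_right _ hp2)) hH hc ?_ ?_ ?_
  · rwa [hW] at key
  · intro w hw
    obtain ⟨m, hm, rfl⟩ := Finset.mem_image.1 hw
    rw [Finset.mem_range] at hm
    refine ⟨hbound m hm.le, ?_, fun t ht => ?_⟩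
    · rintro (h | h)
      · exact L.ω₁_div_two_notMem_lattice ((L.add_mem_lattice_iff (hml m)).1 h)
      · exact hu' ((L'.add_mem_lattice_iff (hml' m)).1 h)
    · rw [hperiod]
      exact hzero t ht
  · simpa using hbound 0 (Nat.zero_le _)
  · rintro l (hl | hl)
    · exact (mul_le_mul_of_nonneg_left (min_le_left _ _) zero_le_two).trans (hρ₁l l hl)
    · exact (mul_le_mul_of_nonneg_left (min_le_right _ _) zero_le_two).trans (hρ₂l l hl)

/-- Two Weierstrass functions, their derivatives and the constants `g₂ / 2` satisfy an algebraic
system of differential equations. -/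
noncomputable def pairSystem (L L' : PeriodPair) : Fin 6 → ℂ → ℂ :=
  ![L.weierstrassP, L'.weierstrassP, L.derivWeierstrassP, L'.derivWeierstrassP,
    fun _ => L.g₂ / 2, fun _ => L'.g₂ / 2]

open MvPolynomial in
/-- The right hand sides of the differential system of `pairSystem`. -/
noncomputable def pairField : Fin 6 → MvPolynomial (Fin 6) ℤ :=
  ![X 2, X 3, ((6 : ℕ) : MvPolynomial (Fin 6) ℤ) * X 0 ^ 2 - X 4,
    ((6 : ℕ) : MvPolynomial (Fin 6) ℤ) * X 1 ^ 2 - X 5, 0, 0]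

theorem monoBound_pairField (i : Fin 6) : MonoBound 2 7 (pairField i) := by
  have hX : ∀ i : Fin 6, MonoBound 2 1 (MvPolynomial.X i : MvPolynomial (Fin 6) ℤ) := fun i =>
    (MonoBound.of_X i).mono_deg (by norm_num)
  fin_cases i
  · exact (hX 2).mono_count (b := 7) (by norm_num)
  · exact (hX 3).mono_count (b := 7) (by norm_num)
  · exact (((MonoBound.of_X 0).pow 2).natMul 6).sub (hX 4)
  · exact (((MonoBound.of_X 1).pow 2).natMul 6).sub (hX 5)
  · exact MonoBound.zero.mono_count (b := 7) (Nat.zero_le _)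
  · exact MonoBound.zero.mono_count (b := 7) (Nat.zero_le _)

theorem hasDerivAt_pairSystem {L L' : PeriodPair} {z : ℂ} (hz : z ∉ L.lattice)
    (hz' : z ∉ L'.lattice) (i : Fin 6) : HasDerivAt (pairSystem L L' i)
      (MvPolynomial.aeval (fun j => pairSystem L L' j z) (pairField i)) z := by
  fin_cases i
  · simpa [pairSystem, pairField] using hasDerivAt_weierstrassP hz
  · simpa [pairSystem, pairField] using hasDerivAt_weierstrassP hz'
  · simpa [pairSystem, pairField] using hasDerivAt_derivWeierstrassP hz
  · simpa [pairSystem, pairField] using hasDerivAt_derivWeierstrassP hz'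
  · simpa [pairSystem, pairField] using hasDerivAt_const z (L.g₂ / 2)
  · simpa [pairSystem, pairField] using hasDerivAt_const z (L'.g₂ / 2)

theorem isAlgebraic_pairSystem {L L' : PeriodPair} (hω : L'.ω₂ = L.ω₁)
    (h₂ : IsAlgebraic ℚ L.g₂) (h₃ : IsAlgebraic ℚ L.g₃) (h₂' : IsAlgebraic ℚ L'.g₂)
    (h₃' : IsAlgebraic ℚ L'.g₃) (i : Fin 6) : IsAlgebraic ℚ (pairSystem L L' i (L.ω₁ / 2)) := by
  have hu' := ω₁_half_notMem_of_eq hω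
  have hm : 2 * (L.ω₁ / 2) ∈ L.lattice := by
    rw [mul_div_cancel₀ _ two_ne_zero]; exact L.ω₁_mem_lattice
  have hm' : 2 * (L.ω₁ / 2) ∈ L'.lattice := by
    rw [mul_div_cancel₀ _ two_ne_zero, ← hω]; exact L'.ω₂_mem_lattice
  have h2 : IsAlgebraic ℚ (2⁻¹ : ℂ) := (isAlgebraic_natCast 2).inv
  fin_cases i
  · exact isAlgebraic_weierstrassP_of_two_mul_mem h₂ h₃ L.ω₁_div_two_notMem_lattice hm
  · exact isAlgebraic_weierstrassP_of_two_mul_mem h₂' h₃' hu' hm'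
  · have : pairSystem L L' 2 (L.ω₁ / 2) = 0 := derivWeierstrassP_eq_zero_of_two_mul_mem hm
    exact this ▸ isAlgebraic_zero
  · have : pairSystem L L' 3 (L.ω₁ / 2) = 0 := derivWeierstrassP_eq_zero_of_two_mul_mem hm'
    exact this ▸ isAlgebraic_zero
  · exact h₂.mul h2
  · exact h₂'.mul h2

end PeriodPair

theorem exists_transcendental_int : ∃ θ : ℂ, Transcendental ℤ θ :=
  ⟨((liouvilleNumber (2 : ℕ) : ℝ) : ℂ), (transcendental_algebraMap_iff
    (R := ℤ) (S := ℝ) (A := ℂ) Complex.ofReal_injective).2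
    (transcendental_liouvilleNumber le_rfl)⟩

namespace PeriodPair

open Real

theorem exists_pow_eight_le_lt {T : ℕ} (p₀ : ℕ) (hT : (p₀ + 1) ^ 8 ≤ T) :
    ∃ p : ℕ, p₀ < p ∧ p ^ 8 ≤ T ∧ T < (p + 1) ^ 8 := by
  classical
  have hex : ∃ p : ℕ, T < (p + 1) ^ 8 :=
    ⟨T, (Nat.lt_succ_self T).trans_le (Nat.le_self_pow (by norm_num) _)⟩
  have hspec := Nat.find_spec hex
  set p := Nat.find hex with hp
  have hp0 : p₀ < p := by
    by_contra! hle
    have : (p + 1) ^ 8 ≤ (p₀ + 1) ^ 8 := Nat.pow_le_pow_left (by omega) 8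
    omega
  refine ⟨p, hp0, ?_, hspec⟩
  have := Nat.find_min hex (m := p - 1) (by omega)
  rw [not_lt, Nat.sub_add_cancel (by omega)] at this
  exact this

theorem natCast_le_exp_of_lt_pow_eight {T p : ℕ} (hp : 1 ≤ p) (hT : T < (p + 1) ^ 8) {κ : ℝ}
    (hκ : 0 ≤ κ) : κ * T ≤ exp ((256 * κ + 8) * p) := by
  have h1 : (T : ℝ) ≤ 256 * p ^ 8 := by
    have h2 : T ≤ (2 * p) ^ 8 := hT.le.trans (Nat.pow_le_pow_left (by omega) 8)
    calc (T : ℝ) ≤ ((2 * p) ^ 8 : ℕ) := by exact_mod_cast h2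
      _ = _ := by push_cast; ring
  calc κ * T ≤ κ * (256 * p ^ 8) := by gcongr
    _ = 256 * κ * p ^ 8 := by ring
    _ ≤ _ := by simpa using mul_pow_le_exp (κ := 256 * κ) (by positivity) 8 hp

/-- The height of the derivatives of the auxiliary function in the proof of Schneider's theorem. -/
theorem pair_height_le {S T p : ℕ} (hp : 1 ≤ p) (hS : S ≤ 3 * T) (hT : T < (p + 1) ^ 8) {t : ℕ}
    (ht : t ≤ T) {H : ℝ} (hH : 1 ≤ H) :
    ((S * 7 : ℕ) : ℝ) ^ t * H ^ S ≤ exp ((5384 + 3 * H) * (T * p)) := by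
  have hp' : (1 : ℝ) ≤ p := by exact_mod_cast hp
  have hS' : (S : ℝ) ≤ 3 * T := by exact_mod_cast hS
  have ht' : (t : ℝ) ≤ T := by exact_mod_cast ht
  have h1 : ((S * 7 : ℕ) : ℝ) ≤ exp (5384 * p) := by
    have := natCast_le_exp_of_lt_pow_eight hp hT (κ := 21) (by norm_num)
    norm_num at this ⊢
    linarith
  refine mul_le_exp_of_le (by positivity)
    (pow_le_exp_of_le (t := 5384 * (T * p)) (by positivity) h1 _ ?_)
    (pow_le_exp_of_le (t := 3 * H * (T * p)) (by positivity) (le_exp_self H) _ ?_)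
    (le_of_eq (by ring))
  · calc (t : ℝ) * (5384 * p) ≤ T * (5384 * p) := by gcongr
      _ = _ := by ring
  · calc (S : ℝ) * H ≤ 3 * T * H := by gcongr
      _ = 3 * H * (T * 1) := by ring
      _ ≤ _ := by gcongr

theorem pair_extrapolation_bound_le {n N T p c₀ C q : ℕ} {ρ H A : ℝ} (hp : 1 ≤ p) (hρ : 0 < ρ)
    (hH0 : 0 ≤ H) (hH : H ≤ exp (A * (T * p))) (hN : N = 4 * q * n) (hn : n ^ 2 ≤ T)
    (hpT : p ^ 8 ≤ T) (hT : T < (p + 1) ^ 8) :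
    T.factorial * (H * ((c₀ * p ^ 2 : ℕ) : ℝ) ^ (C * N * (c₀ * p ^ 2) ^ 2) *
          2⁻¹ ^ (T * p ^ 2)) / ρ ^ T ≤
      exp ((264 + ρ⁻¹ + A + 4 * q * C * c₀ ^ 2 * (c₀ + 2)) * (T * p) - T * p ^ 2 / 2) := by
  have hp' : (1 : ℝ) ≤ p := by exact_mod_cast hp
  have hfac : (T.factorial : ℝ) ≤ exp (264 * (T * p)) := by
    have h1 : (T.factorial : ℝ) ≤ (T : ℝ) ^ T := by exact_mod_cast Nat.factorial_le_pow T
    refine h1.trans (pow_le_exp_of_le (s := 264 * p) (by positivity) ?_ _ (le_of_eq (by ring)))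
    have := natCast_le_exp_of_lt_pow_eight hp hT (κ := 1) (by norm_num)
    norm_num at this
    exact this
  have hρt : (ρ ^ T)⁻¹ ≤ exp (ρ⁻¹ * (T * p)) := by
    rw [← inv_pow]
    refine pow_le_exp_of_le (by positivity) (le_exp_self _) T ?_
    calc T * ρ⁻¹ = ρ⁻¹ * (T * 1) := by ring
      _ ≤ _ := by gcongr
  have hnp : n * p ^ 4 ≤ T := by
    refine (Nat.pow_le_pow_iff_left (n := 2) (by norm_num)).1 ?_
    calc (n * p ^ 4) ^ 2 = n ^ 2 * p ^ 8 := by ring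
      _ ≤ T * T := Nat.mul_le_mul hn hpT
      _ = T ^ 2 := (sq T).symm
  have hnp' : (n * p ^ 4 : ℝ) ≤ T := by exact_mod_cast hnp
  have hr : ((c₀ * p ^ 2 : ℕ) : ℝ) ^ (C * N * (c₀ * p ^ 2) ^ 2) ≤
      exp (4 * q * C * c₀ ^ 2 * (c₀ + 2) * (T * p)) := by
    refine pow_le_exp_of_le (s := (c₀ + (2 : ℕ)) * p) (by positivity) ?_ _ ?_
    · have := mul_pow_le_exp (κ := c₀) (by positivity) 2 hp
      push_cast at this ⊢
      exact this
    · rw [hN]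
      push_cast
      calc (C * (4 * q * n) * (c₀ * p ^ 2) ^ 2 * ((c₀ + 2) * p) : ℝ)
          = 4 * q * C * c₀ ^ 2 * (c₀ + 2) * (n * p ^ 4 * p) := by ring
        _ ≤ _ := by gcongr
  have h2 : (2⁻¹ : ℝ) ^ (T * p ^ 2) ≤ exp (-(T * p ^ 2 / 2)) := by
    refine pow_le_exp_of_le (s := -(1 / 2)) (by norm_num) ?_ _ ?_
    · have := add_one_le_exp (-(1 / 2) : ℝ)
      norm_num at this ⊢
      linarith
    · push_cast
      exact le_of_eq (by ring)
  rw [div_eq_mul_inv]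
  refine mul_le_exp_of_le (by positivity) (mul_le_exp_of_le (by positivity) hfac
    (mul_le_exp_of_le (by positivity) (mul_le_exp_of_le (by positivity) hH hr le_rfl) h2 le_rfl)
    le_rfl) hρt (le_of_eq (by ring))

open Polynomial in
/-- An algebraic number with small conjugate matrix has a lower bound. -/
theorem one_le_of_matRep {θ : ℂ} {q : ℕ} {e : Fin q → ℂ} (he : PolyIndep θ e) (hq : 0 < q) :
    ∃ K : ℝ, 0 < K ∧ ∀ (v : ℂ) (H : ℝ), v ≠ 0 → 1 ≤ H → MatRep θ e v 0 H →
      1 ≤ K * H ^ q * ‖v‖ := by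
  obtain ⟨K, hK, hnorm⟩ := exists_norm_poly he hq
  refine ⟨K, hK, fun v H hv hH hm => ?_⟩
  obtain ⟨R, hR0, hRd, -, hR⟩ := hnorm v 0 H hv hH hm
  rw [pow_zero, mul_one] at hR
  refine le_trans ?_ hR
  have hRC := eq_C_of_natDegree_eq_zero (by simpa using hRd : R.natDegree = 0)
  have h0 : R.coeff 0 ≠ 0 := fun h => hR0 (by rw [hRC, h, C_0])
  rw [hRC, aeval_C, eq_intCast, Complex.norm_intCast]
  exact_mod_cast Int.one_le_abs h0

end PeriodPair

namespace PeriodPair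

open Real Polynomial

set_option maxHeartbeats 1000000 in
/-- The transcendence argument in **Schneider's theorem**. -/
theorem exists_forall_iteratedDeriv_polyComb_eq_zero {L L' : PeriodPair} (hω : L'.ω₂ = L.ω₁)
    (h₂ : IsAlgebraic ℚ L.g₂) (h₃ : IsAlgebraic ℚ L.g₃) (h₂' : IsAlgebraic ℚ L'.g₂)
    (h₃' : IsAlgebraic ℚ L'.g₃) :
    ∃ (N : ℕ) (c : Fin N × Fin N → ℂ), c ≠ 0 ∧
      ∀ t, iteratedDeriv t (polyComb L.weierstrassP L'.weierstrassP c) (L.ω₁ / 2) = 0 := by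
  by_contra! hcon
  obtain ⟨θ, hθ⟩ := exists_transcendental_int
  obtain ⟨q, hq, e, hpe, d, hd0, H₀, hH₀, hd, hγ⟩ := exists_matRep_of_isAlgebraic hθ
    (fun i => pairSystem L L' i (L.ω₁ / 2)) (isAlgebraic_pairSystem hω h₂ h₃ h₂' h₃')
  obtain ⟨K, hK, hlow⟩ := one_le_of_matRep hpe hq
  obtain ⟨ρ, hρ, C, c₀, hc₀, hext⟩ := exists_norm_iteratedDeriv_polyComb_weierstrassP_le L L' hω
  set A₁ : ℝ := 5384 + 3 * H₀ with hA₁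
  set A₂ : ℝ := 4 * q + A₁ with hA₂
  set A₃ : ℝ := 4 * q + A₂ + A₁ with hA₃
  set A₄ : ℝ := 264 + ρ⁻¹ + A₂ + 4 * q * C * c₀ ^ 2 * (c₀ + 2) with hA₄
  set A₅ : ℝ := K + q * A₃ + 3 * ‖d‖ + A₄ with hA₅
  set p₀ : ℕ := ⌈2 * A₅⌉₊ with hp₀
  set n : ℕ := (p₀ + 1) ^ 4 with hn
  have hn0 : 0 < n := by positivity
  set N : ℕ := 4 * q * n with hN
  have hN0 : 0 < N := by positivity
  set T₁ : ℕ := 4 * q * n ^ 2 with hT₁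
  have hT₁0 : 0 < T₁ := by positivity
  have hNT₁ : N ≤ T₁ := Nat.mul_le_mul_left _ (Nat.le_self_pow (by norm_num) n)
  set U : Set ℂ := (L.lattice : Set ℂ)ᶜ ∩ (L'.lattice : Set ℂ)ᶜ with hU
  have hUo : IsOpen U := L.isOpen_compl_lattice.inter L'.isOpen_compl_lattice
  have huU : L.ω₁ / 2 ∈ U := ⟨L.ω₁_div_two_notMem_lattice, ω₁_half_notMem_of_eq hω⟩
  obtain ⟨c, hc0, hcD, hcP, hczero⟩ := exists_polyComb_zeros (M := 1)
    (w := fun _ => L.ω₁ / 2) (N := N) (T := T₁) (U := U)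
    (φ := pairSystem L L') hpe hq monoBound_pairField (by norm_num) hUo
    (fun z hz i => hasDerivAt_pairSystem hz.1 hz.2 i) hH₀ hd0 hd (fun _ => huU)
    (fun _ i => hγ i) 0 1
    (fun _ => analyticAt_weierstrassP huU.1) (fun _ => analyticAt_weierstrassP huU.2)
    hN0 hT₁0 one_pos (le_of_eq (by rw [hN, hT₁]; ring))
  change ∀ m : Fin 1, ∀ t < T₁, iteratedDeriv t
    (polyComb L.weierstrassP L'.weierstrassP fun b => aeval θ (c b)) (L.ω₁ / 2) = 0 at hczero
  simp only [mul_zero, Nat.cast_zero, zero_add, one_mul, mul_one, Nat.le_zero] at hcP hcD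
  have hcne : (fun b => aeval θ (c b)) ≠ 0 := fun h0 => hc0 (funext fun b =>
    (transcendental_iff.1 hθ) _ (congrFun h0 b))
  classical
  have hex := hcon N _ hcne
  have hne := Nat.find_spec hex
  have hmin := fun t => Nat.find_min hex (m := t)
  set T := Nat.find hex with hT
  have hT₁T : T₁ ≤ T := by
    by_contra! hlt
    exact hne (hczero 0 T hlt)
  have hnT : n ^ 2 ≤ T := (Nat.le_mul_of_pos_left _ (by positivity)).trans hT₁T
  obtain ⟨p, hp₀p, hpT, hTp⟩ := exists_pow_eight_le_lt (T := T) p₀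
    (le_trans (le_of_eq (by rw [hn]; ring)) hnT)
  have hp : 1 ≤ p := by omega
  have hT0 : 0 < T := hT₁0.trans_le hT₁T
  have hp' : (1 : ℝ) ≤ p := by exact_mod_cast hp
  have hN2 : ((N ^ 2 : ℕ) : ℝ) ≤ exp (4 * q * (T * p)) := by
    have h1 : N ^ 2 ≤ 4 * q * T := by
      calc N ^ 2 = 4 * q * T₁ := by rw [hN, hT₁]; ring
        _ ≤ _ := Nat.mul_le_mul_left _ hT₁T
    calc ((N ^ 2 : ℕ) : ℝ) ≤ 4 * q * T := by exact_mod_cast h1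
      _ = 4 * q * (T * 1) := by ring
      _ ≤ 4 * q * (T * p) := by gcongr
      _ ≤ _ := le_exp_self _
  set V : ℝ := (((2 * N + T₁) * 7 : ℕ) : ℝ) ^ T₁ * H₀ ^ (2 * N + T₁) with hV
  set P : ℝ := ((N ^ 2 : ℕ) : ℝ) * V with hP
  have hV0 : 0 ≤ V := by positivity
  have hP0 : 0 ≤ P := by positivity
  have hVle : V ≤ exp (A₁ * (T * p)) := pair_height_le hp (by omega) hTp hT₁T hH₀
  have hPle : P ≤ exp (A₂ * (T * p)) := mul_le_exp_of_le hV0 hN2 hVle (le_of_eq (by ring))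
  have hcnorm : ∀ b, ‖aeval θ (c b)‖ ≤ exp (A₂ * (T * p)) := fun b => by
    have := norm_aeval_le_plen (c b) (hcD b).le θ
    rw [pow_zero, mul_one] at this
    exact this.trans ((hcP b).trans hPle)
  have hsmall := (hext N T p _ _ hT0 hp (exp_pos _).le hcnorm
    (fun t ht => not_not.1 (hmin t ht))).trans
    (pair_extrapolation_bound_le (q := q) hp hρ (exp_pos _).le le_rfl hN hnT hpT hTp)
  rw [← hA₄] at hsmall
  have hval := matRep_iteratedDeriv_polyComb (U := U) (φ := pairSystem L L') (T := T) (D := 0)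
    monoBound_pairField (by norm_num) hUo (fun z hz i => hasDerivAt_pairSystem hz.1 hz.2 i)
    hH₀ hd huU hγ 0 1 (analyticAt_weierstrassP huU.1) (analyticAt_weierstrassP huU.2) le_rfl hP0
    (fun b => (hcD b).le) hcP
  rw [mul_zero, add_zero] at hval
  set S := 2 * N + T with hS
  have hS3 : S ≤ 3 * T := by omega
  have hS3' : (S : ℝ) ≤ 3 * T := by exact_mod_cast hS3
  have hbound : (N : ℝ) ^ 2 * (P * (((S * 7 : ℕ) : ℝ) ^ T * H₀ ^ S)) ≤ exp (A₃ * (T * p)) := by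
    rw [Nat.cast_pow] at hN2
    exact mul_le_exp_of_le (by positivity) hN2
      (mul_le_exp_of_le (by positivity) hPle (pair_height_le hp hS3 hTp le_rfl hH₀) le_rfl)
      (le_of_eq (by ring))
  have hTp0 : (1 : ℝ) ≤ T * p := by
    have : (1 : ℝ) ≤ T := by exact_mod_cast hT0
    nlinarith
  have hA₃0 : 0 ≤ A₃ := by positivity
  have h1 := hlow _ _ (mul_ne_zero (pow_ne_zero S hd0) hne) (one_le_exp (by positivity))
    (hval.mono le_rfl hbound)
  rw [norm_mul, norm_pow] at h1
  have hdS : ‖d‖ ^ S ≤ exp (3 * ‖d‖ * (T * p)) := by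
    refine pow_le_exp_of_le (norm_nonneg d) (le_exp_self _) S ?_
    calc S * ‖d‖ ≤ 3 * T * ‖d‖ := by gcongr
      _ = 3 * ‖d‖ * (T * 1) := by ring
      _ ≤ _ := by gcongr
  have h2 : K * exp (A₃ * (T * p)) ^ q ≤ exp ((K + q * A₃) * (T * p)) := by
    refine mul_le_exp_of_le (by positivity) (le_exp_self K)
      (pow_le_exp_of_le (by positivity) le_rfl q le_rfl) ?_
    nlinarith
  have h3 := mul_le_exp_of_le (r := A₅ * (T * p) - T * p ^ 2 / 2) (by positivity) h2
    (mul_le_exp_of_le (norm_nonneg _) hdS hsmall le_rfl) (le_of_eq (by rw [hA₅]; ring))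
  have h4 : 0 ≤ A₅ * (T * p) - T * p ^ 2 / 2 := one_le_exp_iff.1 (h1.trans h3)
  have h5 : 2 * A₅ < p := (Nat.le_ceil _).trans_lt (by exact_mod_cast hp₀p)
  have h6 : (0 : ℝ) < T * p := by linarith
  nlinarith

end PeriodPair

namespace PeriodPair

open Topology Filter Polynomial

theorem countable_lattice (L : PeriodPair) : (L.lattice : Set ℂ).Countable := by
  have : (L.lattice : Set ℂ) = Set.range fun p : ℤ × ℤ => (p.1 * L.ω₁ + p.2 * L.ω₂ : ℂ) := by
    ext z
    rw [SetLike.mem_coe, mem_lattice]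
    simp
  rw [this]
  exact Set.countable_range _

/-- A nonzero polynomial in `℘` does not vanish locally. -/
theorem not_eventually_eval_weierstrassP_eq_zero {L : PeriodPair} {z : ℂ} (hz : z ∉ L.lattice)
    {p : ℂ[X]} (hp : p ≠ 0) : ¬ ∀ᶠ w in 𝓝 z, p.eval (L.weierstrassP w) = 0 := fun h => by
  obtain ⟨k, -, hk⟩ := exists_analyticOrderAt_polynomial_eval_lt (analyticAt_weierstrassP hz)
    (not_eventually_weierstrassP_eq hz _)
  have := hk (p.natDegree + 1) p hp (Nat.lt_succ_self _)
  rw [analyticOrderAt_eq_top.2 h] at this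
  exact not_top_lt this

theorem meromorphicAt_eval_weierstrassP (L : PeriodPair) (p : ℂ[X]) (z : ℂ) :
    MeromorphicAt (fun w => p.eval (L.weierstrassP w)) z := by
  simp only [eval_eq_sum_range]
  refine MeromorphicAt.fun_sum fun i _ => ?_
  exact (MeromorphicAt.const _ z).mul ((L.meromorphic_weierstrassP z).pow i)

/-- A nonzero polynomial in `℘` has only finitely many zeros modulo the lattice. -/
theorem exists_sub_mem_lattice_of_forall_eval_eq_zero {L : PeriodPair} {p : ℂ[X]} (hp : p ≠ 0)
    (z : ℕ → ℂ) (hz : ∀ k, p.eval (L.weierstrassP (z k)) = 0) :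
    ∃ k k', k ≠ k' ∧ z k - z k' ∈ L.lattice := by
  by_contra! hcon
  choose y hy m n hmn using fun k => L.exists_cell_add (z k)
  have hinj : Function.Injective y := fun k k' hkk => by
    by_contra hne
    refine hcon k k' hne ?_
    have := sub_mem (L.int_coords_mem_lattice (m k) (n k)) (L.int_coords_mem_lattice (m k') (n k'))
    rw [hmn k, hmn k', hkk]
    convert this using 1
    ring
  have hy0 : ∀ k, p.eval (L.weierstrassP (y k)) = 0 := fun k => by
    rw [← weierstrassP_add_of_mem (y k) (L.int_coords_mem_lattice (m k) (n k)), ← hmn]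
    exact hz k
  obtain ⟨a, -, ha⟩ := (Set.infinite_range_of_injective hinj).exists_accPt_of_subset_isCompact
    L.isCompact_cell (Set.range_subset_iff.2 hy)
  rw [accPt_iff_frequently_nhdsNE] at ha
  have h1 : ∀ᶠ w in 𝓝[≠] a, p.eval (L.weierstrassP w) = 0 := by
    refine (L.meromorphicAt_eval_weierstrassP p a).eventually_eq_zero_or_eventually_ne_zero.resolve_right
      fun h => ?_
    obtain ⟨w, ⟨k, rfl⟩, hw⟩ := (ha.and_eventually h).exists
    exact hw (hy0 k)
  obtain ⟨w, hw, hwL, hwa⟩ := ((eventually_eventually_nhdsWithin.2 h1).and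
    ((L.eventually_notMem_lattice a).and self_mem_nhdsWithin)).exists
  rw [isOpen_compl_singleton.nhdsWithin_eq hwa] at hw
  exact not_eventually_eval_weierstrassP_eq_zero hwL hp hw

theorem tendsto_sq_mul_weierstrassP (L : PeriodPair) {l : ℂ} (hl : l ∈ L.lattice) :
    Tendsto (fun z => (z - l) ^ 2 * L.weierstrassP z) (𝓝[≠] l) (𝓝 1) := by
  obtain ⟨F, hF, hFP⟩ := L.exists_analyticAt_weierstrassP_zero
  have h1 : Tendsto (fun z => (z - l) ^ 2 * F (z - l) + 1) (𝓝[≠] l) (𝓝 1) := by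
    have hc : ContinuousAt (fun z => (z - l) ^ 2 * F (z - l) + 1) l := by
      have : ContinuousAt F (l - l) := by rw [sub_self]; exact hF.continuousAt
      have h2 : ContinuousAt (fun z => F (z - l)) l :=
        ContinuousAt.comp (f := fun z => z - l) this (by fun_prop)
      fun_prop
    have := hc.tendsto
    rw [sub_self] at this
    simpa using this.mono_left nhdsWithin_le_nhds
  refine h1.congr' ?_
  filter_upwards [self_mem_nhdsWithin] with z hz
  have hz' : z - l ≠ 0 := sub_ne_zero.2 hz
  rw [← weierstrassP_add_of_mem z (neg_mem hl), ← sub_eq_add_neg, hFP (z - l)]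
  field_simp

/-- If two Weierstrass functions are algebraically dependent then their lattices are
commensurable. -/
theorem exists_mul_mem_lattice_of_polyComb {L L' : PeriodPair} {N : ℕ} {c : Fin N × Fin N → ℂ}
    (hc : c ≠ 0) {u : ℂ} (hu : u ∉ L.lattice) (hu' : u ∉ L'.lattice)
    (h : ∀ᶠ z in 𝓝 u, polyComb L.weierstrassP L'.weierstrassP c z = 0) {l : ℂ}
    (hl : l ∈ L'.lattice) : ∃ k : ℤ, k ≠ 0 ∧ k * l ∈ L.lattice := by
  by_contra! hcon
  have hconn : IsPreconnected ((L.lattice : Set ℂ) ∪ L'.lattice)ᶜ :=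
    (Set.Countable.isConnected_compl_of_one_lt_rank (by simp)
      (L.countable_lattice.union L'.countable_lattice)).2
  have han : AnalyticOnNhd ℂ (polyComb L.weierstrassP L'.weierstrassP c)
      ((L.lattice : Set ℂ) ∪ L'.lattice)ᶜ := fun z hz => by
    rw [Set.mem_compl_iff, Set.mem_union, not_or] at hz
    have h1 := analyticAt_weierstrassP hz.1
    have h2 := analyticAt_weierstrassP hz.2
    unfold polyComb
    fun_prop
  have hzero : ∀ z, z ∉ L.lattice → z ∉ L'.lattice →
      polyComb L.weierstrassP L'.weierstrassP c z = 0 := fun z hz hz' =>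
    han.eqOn_zero_of_preconnected_of_eventuallyEq_zero hconn
      (show u ∈ _ from fun h => h.elim hu hu') h (show z ∈ _ from fun h => h.elim hz hz')
  let p : Fin N → ℂ[X] := fun j => ∑ i : Fin N, C (c (i, j)) * X ^ (i : ℕ)
  have hpcoeff : ∀ i j, (p j).coeff (i : Fin N) = c (i, j) := fun i j => by
    simp only [p, finsetSum_coeff, coeff_C_mul, coeff_X_pow]
    simp [Fin.val_inj]
  obtain ⟨j₀, hj₀⟩ : ∃ j, p j ≠ 0 := by
    by_contra! hp
    exact hc (funext fun b => by rw [← hpcoeff b.1 b.2, hp]; simp)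
  classical
  obtain ⟨J, hJ, hJmax⟩ := (Finset.univ.filter fun j => p j ≠ 0).exists_max_image id
    ⟨j₀, by simpa using hj₀⟩
  simp only [Finset.mem_filter, Finset.mem_univ, true_and, id] at hJ hJmax
  have hcomb : ∀ z, polyComb L.weierstrassP L'.weierstrassP c z =
      ∑ j, (p j).eval (L.weierstrassP z) * L'.weierstrassP z ^ (j : ℕ) := fun z => by
    rw [polyComb, Fintype.sum_prod_type, Finset.sum_comm]
    simp only [p, eval_finsetSum, eval_mul, eval_C, eval_pow, eval_X, Finset.sum_mul, mul_assoc]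
  have key : ∀ l' ∈ L'.lattice, l' ∉ L.lattice → (p J).eval (L.weierstrassP l') = 0 := by
    intro l' hl' hlL
    have hlim : Tendsto (fun z => ∑ j, (p j).eval (L.weierstrassP z) *
        (((z - l') ^ 2) ^ ((J : ℕ) - j) * ((z - l') ^ 2 * L'.weierstrassP z) ^ (j : ℕ)))
        (𝓝[≠] l') (𝓝 (∑ j, (p j).eval (L.weierstrassP l') * (0 ^ ((J : ℕ) - j) * 1 ^ (j : ℕ)))) := by
      refine tendsto_finsetSum _ fun j _ => ?_
      have h1 : Tendsto (fun z => (p j).eval (L.weierstrassP z)) (𝓝[≠] l')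
          (𝓝 ((p j).eval (L.weierstrassP l'))) :=
        (((p j).continuous.continuousAt.comp
          (analyticAt_weierstrassP hlL).continuousAt).tendsto).mono_left nhdsWithin_le_nhds
      have h2 : Tendsto (fun z : ℂ => (z - l') ^ 2) (𝓝[≠] l') (𝓝 0) := by
        have : ContinuousAt (fun z : ℂ => (z - l') ^ 2) l' := by fun_prop
        simpa using this.tendsto.mono_left nhdsWithin_le_nhds
      exact h1.mul ((h2.pow _).mul ((L'.tendsto_sq_mul_weierstrassP hl').pow _))
    have hsum : (∑ j, (p j).eval (L.weierstrassP l') * (0 ^ ((J : ℕ) - j) * 1 ^ (j : ℕ))) =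
        (p J).eval (L.weierstrassP l') := by
      rw [Finset.sum_eq_single J]
      · simp
      · intro j _ hj
        by_cases hpj : p j = 0
        · simp [hpj]
        · have h1 : (j : ℕ) ≤ J := hJmax j hpj
          have h2 : (j : ℕ) ≠ J := fun h => hj (Fin.ext h)
          rw [zero_pow (by omega)]
          ring
      · simp
    rw [hsum] at hlim
    refine tendsto_nhds_unique hlim (tendsto_const_nhds.congr' ?_)
    filter_upwards [L'.eventually_notMem_lattice l',
      nhdsWithin_le_nhds (L.isOpen_compl_lattice.mem_nhds hlL)] with z hz' hz
    have h0 := hzero z hz hz'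
    rw [hcomb] at h0
    calc (0 : ℂ) = ((z - l') ^ 2) ^ (J : ℕ) *
          ∑ j, (p j).eval (L.weierstrassP z) * L'.weierstrassP z ^ (j : ℕ) := by rw [h0, mul_zero]
      _ = _ := by
        rw [Finset.mul_sum]
        refine Finset.sum_congr rfl fun j _ => ?_
        by_cases hpj : p j = 0
        · simp [hpj]
        · have h1 : (j : ℕ) ≤ J := hJmax j hpj
          rw [mul_pow]
          conv_lhs => rw [← Nat.sub_add_cancel h1, pow_add]
          ring
  obtain ⟨k, k', hkk, hmem⟩ := exists_sub_mem_lattice_of_forall_eval_eq_zero (L := L) hJ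
    (fun k => ((k + 1 : ℕ) : ℤ) * l) fun k => key _ (by
      rw [← zsmul_eq_mul]; exact zsmul_mem hl _) (hcon _ (by exact_mod_cast Nat.succ_ne_zero k))
  refine hcon ((k + 1 : ℕ) - (k' + 1 : ℕ) : ℤ) (by omega) ?_
  rw [← sub_mul] at hmem
  exact_mod_cast hmem

/-- **Schneider's theorem** for two Weierstrass functions with a common period. -/
theorem exists_mul_mem_lattice {L L' : PeriodPair} (hω : L'.ω₂ = L.ω₁)
    (h₂ : IsAlgebraic ℚ L.g₂) (h₃ : IsAlgebraic ℚ L.g₃) (h₂' : IsAlgebraic ℚ L'.g₂)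
    (h₃' : IsAlgebraic ℚ L'.g₃) {l : ℂ} (hl : l ∈ L'.lattice) :
    ∃ k : ℤ, k ≠ 0 ∧ k * l ∈ L.lattice := by
  obtain ⟨N, c, hc, hzero⟩ := exists_forall_iteratedDeriv_polyComb_eq_zero hω h₂ h₃ h₂' h₃'
  have hu := L.ω₁_div_two_notMem_lattice
  have hu' := ω₁_half_notMem_of_eq hω
  refine exists_mul_mem_lattice_of_polyComb hc hu hu' ?_ hl
  have h1 := analyticAt_weierstrassP hu
  have h2 := analyticAt_weierstrassP hu'
  have han : AnalyticAt ℂ (polyComb L.weierstrassP L'.weierstrassP c) (L.ω₁ / 2) := by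
    unfold polyComb
    fun_prop
  rw [← analyticOrderAt_eq_top, ENat.eq_top_iff_forall_ge]
  exact fun m => (natCast_le_analyticOrderAt_iff_iteratedDeriv_eq_zero han).2 fun t _ => hzero t

end PeriodPair

namespace PeriodPair

/-- A lattice divided by the ratio of its two generators. -/
noncomputable def divRatio (L : PeriodPair) : PeriodPair where
  ω₁ := L.ω₁ / (L.ω₂ / L.ω₁)
  ω₂ := L.ω₁
  indep := by
    have h1 := L.ω₁_ne_zero
    have h2 := L.ω₂_ne_zero
    have hτ : L.ω₂ / L.ω₁ ≠ 0 := div_ne_zero h2 h1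
    rw [LinearIndependent.pair_iff]
    intro s t hst
    refine LinearIndependent.pair_iff.1 L.indep s t ?_
    calc s • L.ω₁ + t • L.ω₂
        = (L.ω₂ / L.ω₁) * (s • (L.ω₁ / (L.ω₂ / L.ω₁)) + t • L.ω₁) := by
          simp only [Complex.real_smul]
          field_simp
      _ = 0 := by rw [hst, mul_zero]

theorem mul_mem_lattice_iff_mem_divRatio (L : PeriodPair) (z : ℂ) :
    L.ω₂ / L.ω₁ * z ∈ L.lattice ↔ z ∈ L.divRatio.lattice := by
  have h1 := L.ω₁_ne_zero
  have h2 := L.ω₂_ne_zero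
  have hτ : L.ω₂ / L.ω₁ ≠ 0 := div_ne_zero h2 h1
  rw [mem_lattice, mem_lattice]
  refine exists_congr fun m => exists_congr fun n => ?_
  rw [← mul_right_inj' hτ (b := _)]
  rw [show (L.ω₂ / L.ω₁) * (m * L.ω₁ + n * L.ω₂) = (L.ω₂ / L.ω₁) * ((L.ω₂ / L.ω₁) *
    (m * L.divRatio.ω₁ + n * L.divRatio.ω₂)) by simp only [divRatio]; field_simp]
  rw [mul_right_inj' hτ, mul_right_inj' hτ]

theorem G_divRatio (L : PeriodPair) (n : ℕ) : L.divRatio.G n = (L.ω₂ / L.ω₁) ^ n * L.G n := by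
  have hτ : L.ω₂ / L.ω₁ ≠ 0 := div_ne_zero L.ω₂_ne_zero L.ω₁_ne_zero
  let e : L.divRatio.lattice ≃ L.lattice :=
    { toFun := fun z => ⟨L.ω₂ / L.ω₁ * z, (L.mul_mem_lattice_iff_mem_divRatio z).2 z.2⟩
      invFun := fun z => ⟨(L.ω₂ / L.ω₁)⁻¹ * z, (L.mul_mem_lattice_iff_mem_divRatio _).1 (by
        rw [mul_inv_cancel_left₀ hτ]; exact z.2)⟩
      left_inv := fun z => Subtype.ext (inv_mul_cancel_left₀ hτ _)
      right_inv := fun z => Subtype.ext (mul_inv_cancel_left₀ hτ _) }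
  rw [G, G, ← e.tsum_eq, ← tsum_mul_left]
  refine tsum_congr fun z => ?_
  simp only [e, Equiv.coe_fn_mk]
  rw [mul_pow, mul_inv, mul_inv_cancel_left₀ (pow_ne_zero n hτ)]

/-- **Schneider's theorem**: if the invariants of a lattice and the ratio of its periods are
algebraic, then this ratio is quadratic. -/
theorem exists_quadratic_relation {L : PeriodPair} (h₂ : IsAlgebraic ℚ L.g₂)
    (h₃ : IsAlgebraic ℚ L.g₃) (hτ : IsAlgebraic ℚ (L.ω₂ / L.ω₁)) :
    ∃ k a b : ℤ, b ≠ 0 ∧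
      k * L.ω₁ = a * L.ω₂ + b * (L.ω₂ / L.ω₁ * L.ω₂) := by
  have hτ0 : L.ω₂ / L.ω₁ ≠ 0 := div_ne_zero L.ω₂_ne_zero L.ω₁_ne_zero
  obtain ⟨k, hk, hmem⟩ := exists_mul_mem_lattice (L := L) (L' := L.divRatio) rfl h₂ h₃
    (by
      have : L.divRatio.g₂ = (L.ω₂ / L.ω₁) ^ 4 * L.g₂ := by
        rw [g₂, g₂, G_divRatio]; ring
      rw [this]
      exact (hτ.pow 4).mul h₂)
    (by
      have : L.divRatio.g₃ = (L.ω₂ / L.ω₁) ^ 6 * L.g₃ := by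
        rw [g₃, g₃, G_divRatio]; ring
      rw [this]
      exact (hτ.pow 6).mul h₃) L.divRatio.ω₁_mem_lattice
  obtain ⟨a, b, hab⟩ := mem_lattice.1 hmem
  have hrel : k * L.ω₁ = a * L.ω₂ + b * (L.ω₂ / L.ω₁ * L.ω₂) := by
    calc k * L.ω₁ = L.ω₂ / L.ω₁ * (k * L.divRatio.ω₁) := by
          have := L.ω₂_ne_zero
          simp only [divRatio]
          field_simp
      _ = L.ω₂ / L.ω₁ * (a * L.ω₁ + b * L.ω₂) := by rw [hab]
      _ = _ := by
          have := L.ω₁_ne_zero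
          field_simp
  refine ⟨k, a, b, fun hb => hk ?_, hrel⟩
  refine (L.int_coords_injective (m := k) (n := 0) (m' := 0) (n' := a) ?_).1
  rw [hrel, hb]
  simp

end PeriodPair

section EvenElliptic

open Filter Topology Polynomial

theorem AnalyticAt.regularAt_inv_sq_mul_of_even {G : ℂ → ℂ} (hG : AnalyticAt ℂ G 0)
    (he : ∀ᶠ w in 𝓝 (0 : ℂ), G (-w) = G w) (h0 : G 0 = 0) :
    RegularAt (fun w => G w * (w ^ 2)⁻¹) 0 := by
  have hd : deriv G 0 = 0 := by
    have h1 : deriv (fun w => G (-w)) 0 = deriv G 0 := Filter.EventuallyEq.deriv_eq he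
    rw [deriv_comp_neg, neg_zero] at h1
    linear_combination (-1 / 2 : ℂ) * h1
  have := regularAt_mul_inv_pow (T := 2) hG fun t ht => by
    interval_cases t
    · simpa using h0
    · simpa using hd
  simpa using this

theorem RegularAt.exists_analyticAt {f : ℂ → ℂ} {z : ℂ} (h : RegularAt f z) :
    ∃ F : ℂ → ℂ, AnalyticAt ℂ F z ∧ f =ᶠ[𝓝[≠] z] F := by
  refine ⟨toMeromorphicNFAt f z, ?_, h.1.eq_nhdsNE_toMeromorphicNFAt⟩
  rw [← meromorphicNFAt_toMeromorphicNFAt.meromorphicOrderAt_nonneg_iff_analyticAt,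
    meromorphicOrderAt_congr h.1.eq_nhdsNE_toMeromorphicNFAt.symm]
  exact h.2

namespace PeriodPair

/-- An even elliptic function without poles off the lattice is a polynomial in `℘`. -/
theorem QuasiPeriodic.exists_eq_eval_weierstrassP {L : PeriodPair} (k : ℕ) :
    ∀ {E : ℂ → ℂ}, L.QuasiPeriodic E 0 0 → (∀ z ∉ L.lattice, AnalyticAt ℂ E z) →
      (∀ z ∉ L.lattice, E (-z) = E z) → RegularAt (fun w => w ^ (2 * k) * E w) 0 →
      ∃ B : ℂ[X], ∀ z ∉ L.lattice, E z = B.eval (L.weierstrassP z) := by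
  induction k with
  | zero =>
    intro E hq ha _ h0
    obtain ⟨c, hc⟩ := hq.exists_eq_const ha (by simpa using h0)
    exact ⟨C c, fun z hz => by simp [hc z hz]⟩
  | succ k ih =>
    intro E hq ha he h0
    obtain ⟨F, hF, hFP⟩ := L.exists_analyticAt_weierstrassP_zero
    obtain ⟨G, hG, hGE⟩ := h0.exists_analyticAt
    set c := G 0
    set H : ℂ → ℂ := fun w => G w - c * (w ^ 2 * F w + 1) ^ (k + 1) with hH
    have hHan : AnalyticAt ℂ H 0 := by fun_prop
    have hHE : ∀ᶠ w in 𝓝[≠] (0 : ℂ),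
        H w = w ^ (2 * (k + 1)) * (E w - c * L.weierstrassP w ^ (k + 1)) := by
      filter_upwards [hGE, self_mem_nhdsWithin] with w hw hw0
      have hw0' : w ≠ 0 := hw0
      have h1 : w ^ 2 * F w + 1 = w ^ 2 * L.weierstrassP w := by
        rw [hFP]
        field_simp
      simp only [hH]
      rw [h1, ← hw, mul_pow, ← pow_mul]
      ring
    have heven : ∀ᶠ w in 𝓝 (0 : ℂ), H (-w) = H w := by
      have hneg : Tendsto (fun w : ℂ => -w) (𝓝[≠] 0) (𝓝[≠] 0) := by
        refine tendsto_nhdsWithin_iff.2 ⟨?_, ?_⟩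
        · have : Tendsto (fun w : ℂ => -w) (𝓝 0) (𝓝 (-0)) := tendsto_id.neg
          rw [neg_zero] at this
          exact this.mono_left nhdsWithin_le_nhds
        · filter_upwards [self_mem_nhdsWithin] with w hw
          simpa using hw
      have h1 : ∀ᶠ w in 𝓝[≠] (0 : ℂ), H (-w) = H w := by
        filter_upwards [hHE, hneg.eventually hHE, L.eventually_notMem_lattice 0] with w h1 h2 h3
        rw [h1, h2, he w h3, L.weierstrassP_neg, Even.neg_pow (by simp)]
      rw [eventually_nhdsWithin_iff] at h1
      filter_upwards [h1] with w hw
      by_cases hw0 : w = 0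
      · simp [hw0]
      · exact hw hw0
    have hreg := hHan.regularAt_inv_sq_mul_of_even heven (by simp [hH, c])
    obtain ⟨B, hB⟩ := ih (E := fun z => E z - c * L.weierstrassP z ^ (k + 1))
      (fun z hz => by
        have h1 := hq z hz
        have h2 := quasiPeriodic_weierstrassP (L := L) z hz
        simp only [h1.1, h1.2, h2.1, h2.2, add_zero, and_self])
      (fun z hz => (ha z hz).sub
        (analyticAt_const.mul ((analyticAt_weierstrassP hz).pow _)))
      (fun z hz => by rw [he z hz, L.weierstrassP_neg])
      (hreg.congr (by
        filter_upwards [hHE, self_mem_nhdsWithin] with w hw hw0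
        have hw0' : w ≠ 0 := hw0
        rw [hw]
        field_simp
        ring))
    exact ⟨B + C c * X ^ (k + 1), fun z hz => by simp [← hB z hz]⟩

end PeriodPair

end EvenElliptic

section LinearRelations

open Filter Topology Polynomial

/-- A linear relation between analytic functions whose derivatives at a point lie in a subfield
can be transported by functionals which are linear over the subfield. -/
theorem eventually_sum_dual_mul_eq_zero {K ι : Type*} [Field K] [Algebra K ℂ] {s : Finset ι}
    {φ : ι → ℂ → ℂ} {u : ℂ} (hφ : ∀ i ∈ s, AnalyticAt ℂ (φ i) u)
    (hK : ∀ i ∈ s, ∀ t, iteratedDeriv t (φ i) u ∈ (algebraMap K ℂ).range) {c : ι → ℂ}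
    (h : ∀ᶠ z in 𝓝 u, ∑ i ∈ s, c i * φ i z = 0) (ℓ : ℂ →ₗ[K] K) :
    ∀ᶠ z in 𝓝 u, ∑ i ∈ s, algebraMap K ℂ (ℓ (c i)) * φ i z = 0 := by
  have hsum : ∀ (d : ι → ℂ) (t : ℕ), iteratedDeriv t (fun z => ∑ i ∈ s, d i * φ i z) u =
      ∑ i ∈ s, d i * iteratedDeriv t (φ i) u := fun d t => by
    rw [iteratedDeriv_fun_sum (f := fun i z => d i * φ i z)
      fun i hi => (analyticAt_const.mul (hφ i hi)).contDiffAt]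
    exact Finset.sum_congr rfl fun i _ => iteratedDeriv_const_mul_field _ _
  have han : AnalyticAt ℂ (fun z => ∑ i ∈ s, algebraMap K ℂ (ℓ (c i)) * φ i z) u :=
    Finset.analyticAt_fun_sum _ fun i hi => analyticAt_const.mul (hφ i hi)
  change ∀ᶠ z in 𝓝 u, (fun z => ∑ i ∈ s, algebraMap K ℂ (ℓ (c i)) * φ i z) z = 0
  rw [← analyticOrderAt_eq_top, ENat.eq_top_iff_forall_ge]
  refine fun m => (natCast_le_analyticOrderAt_iff_iteratedDeriv_eq_zero han).2 fun t _ => ?_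
  have h0 : ∑ i ∈ s, c i * iteratedDeriv t (φ i) u = 0 := by
    rw [← hsum, Filter.EventuallyEq.iteratedDeriv_eq t (g := fun _ => (0 : ℂ)) h]
    simp
  rw [hsum]
  choose! k hk using hK
  have h1 : ∑ i ∈ s, ℓ (c i) * k i t = 0 := by
    rw [← map_zero ℓ, ← h0, map_sum]
    refine Finset.sum_congr rfl fun i hi => ?_
    rw [← hk i hi t, mul_comm (c i), ← Algebra.smul_def, map_smul, smul_eq_mul, mul_comm]
  calc _ = ∑ i ∈ s, algebraMap K ℂ (ℓ (c i) * k i t) :=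
        Finset.sum_congr rfl fun i hi => by rw [map_mul, hk i hi t]
    _ = 0 := by rw [← map_sum, h1, map_zero]

/-- Descent of a fractional linear relation `P(g) f = B(g)` to a field containing the derivatives
of the monomials `g ^ i * f ^ j` at a point. -/
theorem exists_aeval_mul_eq_aeval {K : Type*} [Field K] [Algebra K ℂ] {f g : ℂ → ℂ} {u : ℂ}
    (hf : AnalyticAt ℂ f u) (hg : AnalyticAt ℂ g u)
    (hK : ∀ i j t, iteratedDeriv t (fun z => g z ^ i * f z ^ j) u ∈ (algebraMap K ℂ).range)
    {P B : ℂ[X]} (hP : P ≠ 0) (h : ∀ᶠ z in 𝓝 u, P.eval (g z) * f z = B.eval (g z)) :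
    ∃ P' B' : K[X], P' ≠ 0 ∧ ∀ᶠ z in 𝓝 u, aeval (g z) P' * f z = aeval (g z) B' := by
  obtain ⟨ℓ, hℓ⟩ : ∃ ℓ : ℂ →ₗ[K] K, ℓ P.leadingCoeff ≠ 0 := by
    by_contra! hcon
    exact hP (leadingCoeff_eq_zero.1 ((Module.forall_dual_apply_eq_zero_iff K _).1 hcon))
  set n := max P.natDegree B.natDegree + 1 with hn
  have hev : ∀ (Q : ℂ[X]) (z : ℂ), Q.natDegree < n →
      Q.eval z = ∑ i ∈ Finset.range n, Q.coeff i * z ^ i := fun Q z hQ =>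
    eval_eq_sum_range' hQ z
  have hrel := eventually_sum_dual_mul_eq_zero (K := K) (u := u)
    (s := Finset.range n ×ˢ (Finset.univ : Finset Bool))
    (φ := fun p z => g z ^ p.1 * f z ^ (if p.2 then 1 else 0))
    (c := fun p => if p.2 then P.coeff p.1 else -B.coeff p.1)
    (fun p _ => (hg.pow _).mul (hf.pow _)) (fun p _ t => hK _ _ t)
    (by
      filter_upwards [h] with z hz
      rw [Finset.sum_product]
      simp only [Fintype.sum_bool, if_true, Bool.false_eq_true, if_false, pow_one, pow_zero,
        mul_one, neg_mul, ← sub_eq_add_neg]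
      rw [Finset.sum_sub_distrib, ← hev B (g z) (by omega), ← hz, hev P (g z) (by omega),
        Finset.sum_mul, sub_eq_zero]
      exact Finset.sum_congr rfl fun i _ => by ring) ℓ
  refine ⟨∑ i ∈ Finset.range n, monomial i (ℓ (P.coeff i)),
    ∑ i ∈ Finset.range n, monomial i (ℓ (B.coeff i)), fun h0 => hℓ ?_, ?_⟩
  · have := congrArg (fun Q => coeff Q P.natDegree) h0
    simp only [finsetSum_coeff, coeff_monomial, coeff_zero] at this
    rw [Finset.sum_ite_eq' , if_pos (by simp [hn])] at this
    exact this
  · filter_upwards [hrel] with z hz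
    rw [Finset.sum_product] at hz
    simp only [Fintype.sum_bool, if_true, Bool.false_eq_true, if_false, pow_one, pow_zero,
      mul_one, map_neg, neg_mul, ← sub_eq_add_neg] at hz
    rw [Finset.sum_sub_distrib, sub_eq_zero] at hz
    simp only [map_sum, aeval_monomial]
    rw [← hz, Finset.sum_mul]
    exact Finset.sum_congr rfl fun i _ => by ring

end LinearRelations

namespace PeriodPair

open Filter Topology Polynomial

/-- The lattice `α⁻¹ L`. -/
noncomputable def invSMul (L : PeriodPair) {α : ℂ} (hα : α ≠ 0) : PeriodPair where
  ω₁ := α⁻¹ * L.ω₁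
  ω₂ := α⁻¹ * L.ω₂
  indep := by
    rw [LinearIndependent.pair_iff]
    intro s t hst
    refine LinearIndependent.pair_iff.1 L.indep s t ?_
    calc s • L.ω₁ + t • L.ω₂ = α * (s • (α⁻¹ * L.ω₁) + t • (α⁻¹ * L.ω₂)) := by
          simp only [Complex.real_smul]
          field_simp
      _ = 0 := by rw [hst, mul_zero]

theorem mem_lattice_invSMul {L : PeriodPair} {α : ℂ} (hα : α ≠ 0) {z : ℂ} :
    z ∈ (L.invSMul hα).lattice ↔ α * z ∈ L.lattice := by
  rw [mem_lattice, mem_lattice]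
  refine exists_congr fun m => exists_congr fun n => ?_
  rw [← mul_right_inj' hα (c := z)]
  simp only [invSMul]
  rw [show α * (m * (α⁻¹ * L.ω₁) + n * (α⁻¹ * L.ω₂)) = m * L.ω₁ + n * L.ω₂ by field_simp]

theorem eventually_mul_notMem_lattice (L : PeriodPair) {α : ℂ} (hα : α ≠ 0) (z : ℂ) :
    ∀ᶠ w in 𝓝[≠] z, α * w ∉ L.lattice := by
  filter_upwards [(L.invSMul hα).eventually_notMem_lattice z] with w hw
  rwa [mem_lattice_invSMul] at hw

/-- Finitely many representatives of `α⁻¹ L` modulo `L`. -/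
theorem exists_finset_representatives (L : PeriodPair) {α : ℂ} (hα : α ≠ 0)
    (hαL : ∀ l ∈ L.lattice, α * l ∈ L.lattice) :
    ∃ S : Finset ℂ, (∀ t ∈ S, α * t ∈ L.lattice) ∧
      ∀ t, α * t ∈ L.lattice → ∃ s ∈ S, t - s ∈ L.lattice := by
  obtain ⟨M, hM⟩ := L.isCompact_cell.isBounded.exists_norm_le
  obtain ⟨C, -, hC⟩ := (L.invSMul hα).exists_card_lattice_inter_closedBall_le
  obtain ⟨S, hS, -⟩ := hC (max M 1) (le_max_right _ _)
  have hS' : ∀ t, t ∈ S ↔ α * t ∈ L.lattice ∧ ‖t‖ ≤ max M 1 := fun t => by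
    rw [← Finset.mem_coe, hS, Set.mem_inter_iff, SetLike.mem_coe, mem_lattice_invSMul,
      mem_closedBall_zero_iff]
  refine ⟨S, fun t ht => ((hS' t).1 ht).1, fun t ht => ?_⟩
  obtain ⟨s, hs, m, n, rfl⟩ := L.exists_cell_add t
  have hmn := L.int_coords_mem_lattice m n
  refine ⟨s, (hS' s).2 ⟨?_, (hM s hs).trans (le_max_left _ _)⟩, by rwa [add_sub_cancel_left]⟩
  rwa [mul_add, L.add_mem_lattice_iff (hαL _ hmn)] at ht

/-- `℘(z)`, `℘(αz)` and their derivatives as solutions of a differential system. -/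
noncomputable def mulSystem (L : PeriodPair) (α : ℂ) : Fin 6 → ℂ → ℂ :=
  ![L.weierstrassP, fun z => L.weierstrassP (α * z), L.derivWeierstrassP,
    fun z => L.derivWeierstrassP (α * z), fun _ => L.g₂ / 2, fun _ => α]

open MvPolynomial in
/-- The right hand sides of the differential system of `mulSystem`. -/
noncomputable def mulField : Fin 6 → MvPolynomial (Fin 6) ℤ :=
  ![X 2, X 5 * X 3, ((6 : ℕ) : MvPolynomial (Fin 6) ℤ) * X 0 ^ 2 - X 4, X 5 * (((6 : ℕ) : MvPolynomial (Fin 6) ℤ) * X 1 ^ 2 - X 4), 0, 0]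

theorem hasDerivAt_mulSystem {L : PeriodPair} {α z : ℂ} (hz : z ∉ L.lattice)
    (hz' : α * z ∉ L.lattice) (i : Fin 6) : HasDerivAt (mulSystem L α i)
      (MvPolynomial.aeval (fun j => mulSystem L α j z) (mulField i)) z := by
  have hm : HasDerivAt (fun z => α * z) α z := by simpa using (hasDerivAt_id z).const_mul α
  fin_cases i
  · simpa [mulSystem, mulField] using hasDerivAt_weierstrassP hz
  · simpa [mulSystem, mulField, mul_comm, Function.comp_def] using (hasDerivAt_weierstrassP hz').comp z hm
  · simpa [mulSystem, mulField] using hasDerivAt_derivWeierstrassP hz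
  · simpa [mulSystem, mulField, mul_comm, Function.comp_def] using (hasDerivAt_derivWeierstrassP hz').comp z hm
  · simpa [mulSystem, mulField] using hasDerivAt_const z (L.g₂ / 2)
  · simpa [mulSystem, mulField] using hasDerivAt_const z α

theorem isAlgebraic_iteratedDeriv_weierstrassP_mul {L : PeriodPair} (h₂ : IsAlgebraic ℚ L.g₂)
    (h₃ : IsAlgebraic ℚ L.g₃) {α u : ℂ} (hα0 : α ≠ 0) (hα : IsAlgebraic ℚ α) (hu : u ∉ L.lattice)
    (hu' : α * u ∉ L.lattice) (h2u : 2 * u ∈ L.lattice) (h2u' : 2 * (α * u) ∈ L.lattice)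
    (i j t : ℕ) : IsAlgebraic ℚ
      (iteratedDeriv t (fun z => L.weierstrassP z ^ i * L.weierstrassP (α * z) ^ j) u) := by
  have hU : IsOpen ((L.lattice : Set ℂ)ᶜ ∩ ((L.invSMul hα0).lattice : Set ℂ)ᶜ) :=
    L.isOpen_compl_lattice.inter (L.invSMul hα0).isOpen_compl_lattice
  have hz' : ∀ z ∈ ((L.lattice : Set ℂ)ᶜ ∩ ((L.invSMul hα0).lattice : Set ℂ)ᶜ),
      z ∉ L.lattice ∧ α * z ∉ L.lattice := fun z hz =>
    ⟨hz.1, fun h => hz.2 ((mem_lattice_invSMul hα0).2 h)⟩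
  have hd := iteratedDeriv_aeval (φ := mulSystem L α) (f := mulField) hU
    (fun z hz => hasDerivAt_mulSystem (hz' z hz).1 (hz' z hz).2) t
    (MvPolynomial.X 0 ^ i * MvPolynomial.X 1 ^ j) u
    ⟨hu, fun h => hu' ((mem_lattice_invSMul hα0).1 h)⟩
  simp only [map_mul, map_pow, MvPolynomial.aeval_X] at hd
  have hs : ∀ k, mulSystem L α k u ∈ integralClosure ℚ ℂ := fun k => by
    rw [mem_integralClosure_iff, ← isAlgebraic_iff_isIntegral]
    fin_cases k
    · exact isAlgebraic_weierstrassP_of_two_mul_mem h₂ h₃ hu h2u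
    · exact isAlgebraic_weierstrassP_of_two_mul_mem h₂ h₃ hu' h2u'
    · change IsAlgebraic ℚ (L.derivWeierstrassP u)
      rw [derivWeierstrassP_eq_zero_of_two_mul_mem h2u]
      exact isAlgebraic_zero
    · change IsAlgebraic ℚ (L.derivWeierstrassP (α * u))
      rw [derivWeierstrassP_eq_zero_of_two_mul_mem h2u']
      exact isAlgebraic_zero
    · simpa [mulSystem, div_eq_mul_inv] using h₂.mul (isAlgebraic_natCast 2).inv
    · exact hα
  change IsAlgebraic ℚ (iteratedDeriv t (fun z => mulSystem L α 0 z ^ i * mulSystem L α 1 z ^ j) u)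
  rw [hd, isAlgebraic_iff_isIntegral, ← mem_integralClosure_iff, MvPolynomial.aeval_def,
    MvPolynomial.eval₂_eq]
  refine sum_mem fun d _ => mul_mem ?_ (prod_mem fun k _ => pow_mem (hs k) _)
  simp

end PeriodPair

namespace PeriodPair

open Filter Topology Polynomial

theorem analyticAt_weierstrassP_mul {L : PeriodPair} {α z : ℂ} (hz : α * z ∉ L.lattice) :
    AnalyticAt ℂ (fun w => L.weierstrassP (α * w)) z :=
  AnalyticAt.fun_comp (f := fun w => α * w) (analyticAt_weierstrassP hz) (by fun_prop)

theorem regularAt_sub_sq_mul_weierstrassP_mul {L : PeriodPair} {α t : ℂ} (hα : α ≠ 0)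
    (ht : α * t ∈ L.lattice) :
    RegularAt (fun w => (w - t) ^ 2 * L.weierstrassP (α * w)) t := by
  obtain ⟨F, hF, hFP⟩ := L.exists_analyticAt_weierstrassP_zero
  have h1 : AnalyticAt ℂ (fun w => F (α * (w - t))) t :=
    AnalyticAt.fun_comp (f := fun w => α * (w - t)) (by simpa using hF) (by fun_prop)
  have h0 : AnalyticAt ℂ (fun w => (w - t) ^ 2) t := by fun_prop
  have h2 : AnalyticAt ℂ (fun w => (w - t) ^ 2 * F (α * (w - t)) + (α ^ 2)⁻¹) t :=
    (h0.mul h1).add analyticAt_const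
  refine h2.regularAt.congr ?_
  filter_upwards [self_mem_nhdsWithin] with w hw
  have hw0 : w - t ≠ 0 := sub_ne_zero.2 hw
  rw [show α * w = α * (w - t) + α * t by ring, weierstrassP_add_of_mem _ ht, hFP]
  field_simp

/-- Multiplying by a suitable polynomial in `℘` clears the poles of `℘(αz)`. -/
theorem exists_eval_mul_weierstrassP_mul_eq {L : PeriodPair} {α : ℂ} (hα : α ≠ 0)
    (hαL : ∀ l ∈ L.lattice, α * l ∈ L.lattice) :
    ∃ P B : ℂ[X], P ≠ 0 ∧ ∀ z, α * z ∉ L.lattice →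
      P.eval (L.weierstrassP z) * L.weierstrassP (α * z) = B.eval (L.weierstrassP z) := by
  obtain ⟨S, hS, hS'⟩ := L.exists_finset_representatives hα hαL
  set P : ℂ[X] := ∏ s ∈ S, (X - C (L.weierstrassP s)) ^ 2 with hP
  have hP0 : P ≠ 0 := Finset.prod_ne_zero_iff.2 fun s _ => pow_ne_zero _ (X_sub_C_ne_zero _)
  have hnot : ∀ z, α * z ∉ L.lattice → z ∉ L.lattice := fun z hz h => hz (hαL z h)
  set E : ℂ → ℂ := fun z => P.eval (L.weierstrassP z) * L.weierstrassP (α * z) with hE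
  have hEadd : ∀ z, ∀ l ∈ L.lattice, E (z + l) = E z := fun z l hl => by
    simp only [hE]
    rw [weierstrassP_add_of_mem z hl, mul_add, weierstrassP_add_of_mem _ (hαL l hl)]
  have hEneg : ∀ z, E (-z) = E z := fun z => by
    simp only [hE]
    rw [mul_neg, L.weierstrassP_neg, L.weierstrassP_neg]
  have han : ∀ (Q : ℂ[X]) z, z ∉ L.lattice →
      AnalyticAt ℂ (fun w => Q.eval (L.weierstrassP w)) z := fun Q z hz => by
    simpa [aeval_def] using (analyticAt_weierstrassP hz).aeval_polynomial Q
  have hEan : ∀ z, α * z ∉ L.lattice → AnalyticAt ℂ E z := fun z hz =>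
    (han P z (hnot z hz)).mul (analyticAt_weierstrassP_mul hz)
  have hreg : ∀ z ∈ (L.lattice : Set ℂ)ᶜ, RegularAt E z := fun z hz => by
    have hz' : z ∉ L.lattice := hz
    by_cases hzα : α * z ∈ L.lattice
    · obtain ⟨s, hs, hsz⟩ := hS' z hzα
      have hps : L.weierstrassP s = L.weierstrassP z := by
        rw [← weierstrassP_add_of_mem s hsz, add_sub_cancel]
      obtain ⟨Q, hQ⟩ : (X - C (L.weierstrassP z)) ^ 2 ∣ P := by
        rw [← hps]
        exact Finset.dvd_prod_of_mem (fun s => (X - C (L.weierstrassP s)) ^ 2) hs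
      have h1 := regularAt_mul_inv_pow (T := 1) ((analyticAt_weierstrassP hz').sub
        (analyticAt_const (v := L.weierstrassP z))) fun t ht => by
          interval_cases t
          simp
      refine ((((h1.pow 2).mul (han Q z hz').regularAt)).mul
        (regularAt_sub_sq_mul_weierstrassP_mul hα hzα)).congr ?_
      filter_upwards [self_mem_nhdsWithin] with w hw
      have hw0 : w - z ≠ 0 := sub_ne_zero.2 hw
      simp only [hE, hQ, eval_mul, eval_pow, eval_sub, eval_X, eval_C, Pi.sub_apply]
      field_simp
    · exact (hEan z hzα).regularAt
  obtain ⟨F, hF, hFE⟩ := exists_analyticOnNhd_of_regularAt hreg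
  have hFE' : ∀ z, α * z ∉ L.lattice → F z = E z := fun z hz => hFE z (hnot z hz) (hEan z hz)
  have hext : ∀ φ : ℂ → ℂ, (∀ z, AnalyticAt ℂ φ z) → (∀ z, φ z ∈ L.lattice ↔ z ∈ L.lattice) →
      (∀ z, α * φ z ∈ L.lattice ↔ α * z ∈ L.lattice) → (∀ z, E (φ z) = E z) →
      ∀ z ∉ L.lattice, F (φ z) = F z := fun φ hφ hφL hφα hφE z hz => by
    have h1 : AnalyticAt ℂ (fun w => F (φ w)) z :=
      AnalyticAt.fun_comp (hF _ fun h => hz ((hφL z).1 h)) (hφ z)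
    have h2 : ∀ᶠ w in 𝓝[≠] z, F (φ w) = F w := by
      filter_upwards [L.eventually_mul_notMem_lattice hα z] with w hw
      rw [hFE' w hw, hFE' (φ w) fun h => hw ((hφα w).1 h), hφE]
    exact ((h1.continuousAt.eventuallyEq_nhds_iff_eventuallyEq_nhdsNE
      (hF z hz).continuousAt).1 h2).eq_of_nhds
  have hFadd : ∀ l ∈ L.lattice, ∀ z ∉ L.lattice, F (z + l) = F z := fun l hl =>
    hext (fun z => z + l) (fun z => by fun_prop) (fun z => L.add_mem_lattice_iff hl)
      (fun z => by rw [mul_add, L.add_mem_lattice_iff (hαL l hl)]) (fun z => hEadd z l hl)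
  have hFneg : ∀ z ∉ L.lattice, F (-z) = F z :=
    hext (fun z => -z) (fun z => by fun_prop) (fun z => neg_mem_iff)
      (fun z => by rw [mul_neg, neg_mem_iff]) hEneg
  have hpole : RegularAt (fun w => w ^ (2 * (P.natDegree + 1)) * F w) 0 := by
    have h1 : RegularAt (fun w => w ^ (2 * P.natDegree) * P.eval (L.weierstrassP w)) 0 := by
      have h2 : (fun w => w ^ (2 * P.natDegree) * P.eval (L.weierstrassP w)) = fun w =>
          ∑ i ∈ Finset.range (P.natDegree + 1), P.coeff i * w ^ (2 * (P.natDegree - i)) *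
            (w ^ 2 * L.weierstrassP w) ^ i := by
        ext w
        rw [eval_eq_sum_range, Finset.mul_sum]
        refine Finset.sum_congr rfl fun i hi => ?_
        have hi' : i ≤ P.natDegree := Nat.lt_succ_iff.1 (Finset.mem_range.1 hi)
        rw [show 2 * P.natDegree = 2 * (P.natDegree - i) + 2 * i by omega, pow_add, mul_pow,
          ← pow_mul]
        ring
      rw [h2]
      refine RegularAt.sum _ fun i _ => RegularAt.mul ?_ (L.regularAt_sq_mul_weierstrassP.pow i)
      exact AnalyticAt.regularAt (by fun_prop)
    have h3 := h1.mul (regularAt_sub_sq_mul_weierstrassP_mul (L := L) (t := 0) hα (by simp))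
    refine h3.congr ?_
    filter_upwards [L.eventually_mul_notMem_lattice hα 0] with w hw
    rw [hFE' w hw]
    simp only [hE, sub_zero]
    ring
  obtain ⟨B, hB⟩ := QuasiPeriodic.exists_eq_eval_weierstrassP (L := L) (P.natDegree + 1) (E := F)
    (fun z hz => by
      simpa using ⟨hFadd _ L.ω₁_mem_lattice z hz, hFadd _ L.ω₂_mem_lattice z hz⟩)
    hF hFneg hpole
  exact ⟨P, B, hP0, fun z hz => by rw [← hB z (hnot z hz), hFE' z hz]⟩

end PeriodPair

theorem IsAlgebraic.of_algebraicClosure {F E : Type*} [Field F] [Field E] [Algebra F E] {x : E}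
    (hx : IsAlgebraic (algebraicClosure F E) x) : IsAlgebraic F x :=
  haveI := algebraicClosure.isAlgebraic F E
  hx.restrictScalars F

namespace PeriodPair

open Filter Topology Polynomial

/-- The value of `℘` at a pole `t` of `℘(αz)` is algebraic over a field containing the derivatives
at a point of the monomials in `℘(z)` and `℘(αz)`. -/
theorem exists_aeval_weierstrassP_eq_zero {K : Type*} [Field K] [Algebra K ℂ] {L : PeriodPair}
    {α u t : ℂ} (hα : α ≠ 0) (hαL : ∀ l ∈ L.lattice, α * l ∈ L.lattice) (hu : α * u ∉ L.lattice)
    (hK : ∀ i j n, iteratedDeriv n (fun z => L.weierstrassP z ^ i * L.weierstrassP (α * z) ^ j) u ∈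
      (algebraMap K ℂ).range)
    (ht : t ∉ L.lattice) (hαt : α * t ∈ L.lattice) : IsAlgebraic K (L.weierstrassP t) := by
  obtain ⟨P, B, hP, hPB⟩ := exists_eval_mul_weierstrassP_mul_eq hα hαL
  have hnot : ∀ z, α * z ∉ L.lattice → z ∉ L.lattice := fun z hz h => hz (hαL z h)
  have hopen : IsOpen ((L.invSMul hα).lattice : Set ℂ)ᶜ := (L.invSMul hα).isOpen_compl_lattice
  have hmem : ∀ z, z ∈ ((L.invSMul hα).lattice : Set ℂ)ᶜ ↔ α * z ∉ L.lattice := fun z =>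
    not_congr (mem_lattice_invSMul hα)
  obtain ⟨P', B', hP', hPB'⟩ := exists_aeval_mul_eq_aeval (analyticAt_weierstrassP_mul hu)
    (analyticAt_weierstrassP (hnot u hu)) hK hP (by
      filter_upwards [hopen.mem_nhds ((hmem u).2 hu)] with z hz using hPB z ((hmem z).1 hz))
  have han : ∀ (Q : K[X]) z, z ∉ L.lattice →
      AnalyticAt ℂ (fun w => aeval (L.weierstrassP w) Q) z := fun Q z hz => by
    have := (analyticAt_weierstrassP hz).aeval_polynomial (Q.map (algebraMap K ℂ))
    simpa [aeval_map_algebraMap] using this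
  have hall : ∀ z, α * z ∉ L.lattice →
      aeval (L.weierstrassP z) P' * L.weierstrassP (α * z) = aeval (L.weierstrassP z) B' :=
    fun z hz => by
      have h1 : ∀ z ∉ (L.invSMul hα).lattice, AnalyticAt ℂ (fun z => aeval (L.weierstrassP z) P' *
          L.weierstrassP (α * z) - aeval (L.weierstrassP z) B') z := fun z hz => by
        have hz' := (hmem z).1 hz
        exact ((han P' z (hnot z hz')).mul (analyticAt_weierstrassP_mul hz')).sub
          (han B' z (hnot z hz'))
      exact sub_eq_zero.1 ((L.invSMul hα).eq_zero_of_eventually_eq_zero h1 ((hmem u).2 hu)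
        (by filter_upwards [hPB'] with w hw using sub_eq_zero.2 hw) z ((hmem z).2 hz))
  refine ⟨P', hP', ?_⟩
  have hmap : Tendsto (fun w => α * w) (𝓝[≠] t) (𝓝[≠] (α * t)) := by
    refine tendsto_nhdsWithin_iff.2 ⟨?_, ?_⟩
    · exact (continuous_const_mul α).continuousAt.tendsto.mono_left nhdsWithin_le_nhds
    · filter_upwards [self_mem_nhdsWithin] with w hw h
      exact hw (mul_left_cancel₀ hα h)
  have hlim : Tendsto (fun w => aeval (L.weierstrassP w) P' *
      ((α * w - α * t) ^ 2 * L.weierstrassP (α * w))) (𝓝[≠] t)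
      (𝓝 (aeval (L.weierstrassP t) P' * 1)) :=
    ((han P' t ht).continuousAt.tendsto.mono_left nhdsWithin_le_nhds).mul
      ((L.tendsto_sq_mul_weierstrassP hαt).comp hmap)
  have hlim' : Tendsto (fun w => (α * w - α * t) ^ 2 * aeval (L.weierstrassP w) B') (𝓝[≠] t)
      (𝓝 ((α * t - α * t) ^ 2 * aeval (L.weierstrassP t) B')) := by
    have h1 : ContinuousAt (fun w => (α * w - α * t) ^ 2) t := by fun_prop
    exact (h1.mul (han B' t ht).continuousAt).tendsto.mono_left nhdsWithin_le_nhds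
  have heq := tendsto_nhds_unique (hlim.congr' (by
    filter_upwards [L.eventually_mul_notMem_lattice hα t] with w hw
    rw [← hall w hw]
    ring)) hlim'
  simpa using heq

theorem isAlgebraic_weierstrassP_of_mul_mem {L : PeriodPair} (h₂ : IsAlgebraic ℚ L.g₂)
    (h₃ : IsAlgebraic ℚ L.g₃) {α u t : ℂ} (hα : α ≠ 0) (hαa : IsAlgebraic ℚ α)
    (hαL : ∀ l ∈ L.lattice, α * l ∈ L.lattice) (hu : α * u ∉ L.lattice)
    (h2u : 2 * u ∈ L.lattice) (ht : t ∉ L.lattice) (hαt : α * t ∈ L.lattice) :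
    IsAlgebraic ℚ (L.weierstrassP t) := by
  have h1 := isAlgebraic_iteratedDeriv_weierstrassP_mul h₂ h₃ hα hαa (fun h => hu (hαL u h)) hu h2u
    (by rw [mul_left_comm]; exact hαL _ h2u)
  have h2 : IsAlgebraic (algebraicClosure ℚ ℂ) (L.weierstrassP t) :=
    exists_aeval_weierstrassP_eq_zero hα hαL hu (fun i j n =>
      ⟨⟨_, (mem_algebraicClosure_iff).2 (h1 i j n)⟩, rfl⟩) ht hαt
  exact h2.of_algebraicClosure

end PeriodPair

namespace PeriodPair

open Filter Topology

/-- Representatives of `α⁻¹ L` modulo `L`, indexed by a finite group. -/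
theorem exists_representatives (L : PeriodPair) {α : ℂ} (hα : α ≠ 0)
    (hαL : ∀ l ∈ L.lattice, α * l ∈ L.lattice) :
    ∃ (Q : Type) (_ : AddCommGroup Q) (_ : Fintype Q) (t : Q → ℂ), t 0 = 0 ∧
      (∀ q, α * t q ∈ L.lattice) ∧ (∀ q, q ≠ 0 → t q ∉ L.lattice) ∧
      ∀ a, α * a ∈ L.lattice → ∃ p, ∀ q, t q - a - t (q - p) ∈ L.lattice := by
  classical
  set Λ := (L.invSMul hα).lattice with hΛ
  set B : Submodule ℤ Λ := L.lattice.comap Λ.subtype with hB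
  have hmk : ∀ x y : Λ, (B.mkQ x = B.mkQ y ↔ (x : ℂ) - y ∈ L.lattice) := fun x y => by
    rw [Submodule.mkQ_apply, Submodule.mkQ_apply, Submodule.Quotient.eq]
    rfl
  have hout : ∀ q : Λ ⧸ B, ∃ x : Λ, B.mkQ x = q ∧ (q = 0 → x = 0) := fun q => by
    by_cases hq : q = 0
    · exact ⟨0, by simp [hq], fun _ => rfl⟩
    · obtain ⟨x, hx⟩ := B.mkQ_surjective q
      exact ⟨x, hx, fun h => absurd h hq⟩
  choose r hr hr0 using hout
  obtain ⟨S, hS, hS'⟩ := L.exists_finset_representatives hα hαL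
  have hfin : Finite (Λ ⧸ B) := by
    refine Finite.of_surjective
      (fun s : S => B.mkQ ⟨s, (mem_lattice_invSMul hα).2 (hS s s.2)⟩) fun q => ?_
    obtain ⟨s, hs, hrs⟩ := hS' (r q) ((mem_lattice_invSMul hα).1 (r q).2)
    refine ⟨⟨s, hs⟩, ?_⟩
    rw [← hr q, eq_comm]
    exact (hmk _ _).2 hrs
  refine ⟨Λ ⧸ B, inferInstance, Fintype.ofFinite _, fun q => r q, by simp [hr0 0 rfl],
    fun q => (mem_lattice_invSMul hα).1 (r q).2, fun q hq hmem => hq ?_, fun a ha =>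
    ⟨B.mkQ ⟨a, (mem_lattice_invSMul hα).2 ha⟩, fun q => ?_⟩⟩
  · rw [← hr q, ← map_zero B.mkQ, hmk]
    simpa using hmem
  · have := (hmk (r q - ⟨a, (mem_lattice_invSMul hα).2 ha⟩)
      (r (q - B.mkQ ⟨a, (mem_lattice_invSMul hα).2 ha⟩))).1 (by rw [map_sub, hr, hr])
    simpa using this

/-- The multiplication formula `α² ℘(αz) = ∑ ℘(z - t) - ∑ ℘(t)`. -/
theorem sq_mul_weierstrassP_mul {L : PeriodPair} {α : ℂ} (hα : α ≠ 0)
    (hαL : ∀ l ∈ L.lattice, α * l ∈ L.lattice) {Q : Type} [AddCommGroup Q] [Fintype Q]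
    [DecidableEq Q] {t : Q → ℂ} (h0 : t 0 = 0) (ht : ∀ q, α * t q ∈ L.lattice)
    (htL : ∀ q, q ≠ 0 → t q ∉ L.lattice)
    (hp : ∀ a, α * a ∈ L.lattice → ∃ p, ∀ q, t q - a - t (q - p) ∈ L.lattice) {z : ℂ}
    (hz : α * z ∉ L.lattice) :
    α ^ 2 * L.weierstrassP (α * z) - ∑ q, L.weierstrassP (z - t q) =
      -∑ q ∈ Finset.univ.erase 0, L.weierstrassP (t q) := by
  set D : ℂ → ℂ := fun z => α ^ 2 * L.weierstrassP (α * z) - ∑ q, L.weierstrassP (z - t q) with hD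
  have hsub : ∀ z, α * z ∉ L.lattice → ∀ q, z - t q ∉ L.lattice := fun z hz q h => by
    have := hαL _ h
    rw [mul_sub] at this
    exact hz (by simpa using add_mem this (ht q))
  have hadd : ∀ a, α * a ∈ L.lattice → ∀ z, D (z + a) = D z := fun a ha z => by
    obtain ⟨p, hp⟩ := hp a ha
    simp only [hD]
    rw [mul_add, weierstrassP_add_of_mem _ ha]
    congr 1
    refine Fintype.sum_equiv (Equiv.subRight p) _ _ fun q => ?_
    rw [Equiv.subRight_apply, ← weierstrassP_add_of_mem _ (hp q)]
    ring_nf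
  have hq : (L.invSMul hα).QuasiPeriodic D 0 0 := fun z _ => by
    rw [add_zero, hadd _ ((mem_lattice_invSMul hα).1 (L.invSMul hα).ω₁_mem_lattice),
      hadd _ ((mem_lattice_invSMul hα).1 (L.invSMul hα).ω₂_mem_lattice)]
    exact ⟨rfl, rfl⟩
  have hsubt : ∀ q z, z - t q ∉ L.lattice → AnalyticAt ℂ (fun w => L.weierstrassP (w - t q)) z :=
    fun q z h => AnalyticAt.fun_comp (f := fun w => w - t q) (analyticAt_weierstrassP h)
      (by fun_prop)
  have han : ∀ z ∉ (L.invSMul hα).lattice, AnalyticAt ℂ D z := fun z hz => by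
    have hz' : α * z ∉ L.lattice := fun h => hz ((mem_lattice_invSMul hα).2 h)
    exact (analyticAt_const.mul (analyticAt_weierstrassP_mul hz')).sub
      (Finset.analyticAt_fun_sum _ fun q _ => hsubt q z (hsub z hz' q))
  set F := L.weierstrassPExcept 0 with hF
  have hFan : AnalyticAt ℂ F 0 := L.analyticAt_weierstrassPExcept 0
  have hF0 : F 0 = 0 := L.weierstrassPExcept_zero 0
  have hFP : ∀ z, L.weierstrassP z = F z + 1 / z ^ 2 := fun z => by
    rw [← L.weierstrassPExcept_add 0 z]
    simp [hF]
  set D' : ℂ → ℂ := fun z => α ^ 2 * F (α * z) - F z -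
    ∑ q ∈ Finset.univ.erase 0, L.weierstrassP (z - t q) with hD'
  have hD'an : AnalyticAt ℂ D' 0 := by
    have h1 : AnalyticAt ℂ (fun z => F (α * z)) 0 :=
      AnalyticAt.fun_comp (f := fun w => α * w) (by simpa using hFan) (by fun_prop)
    refine ((analyticAt_const.mul h1).sub hFan).sub (Finset.analyticAt_fun_sum _ fun q hq =>
      hsubt q 0 ?_)
    rw [zero_sub, neg_mem_iff]
    exact htL q (Finset.ne_of_mem_erase hq)
  have hDD' : ∀ᶠ z in 𝓝[≠] (0 : ℂ), D' z = D z := by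
    filter_upwards [self_mem_nhdsWithin] with z hz
    have hz0 : z ≠ 0 := hz
    simp only [hD, hD']
    rw [← Finset.add_sum_erase _ _ (Finset.mem_univ (0 : Q)), h0, sub_zero, hFP (α * z), hFP z]
    field_simp
    ring
  obtain ⟨c, hc⟩ := hq.exists_eq_const han (hD'an.regularAt.congr hDD')
  have hc0 : D' 0 = c := by
    refine tendsto_nhds_unique (hD'an.continuousAt.tendsto.mono_left nhdsWithin_le_nhds)
      (Tendsto.congr' ?_ (tendsto_const_nhds (f := 𝓝[≠] (0 : ℂ))))
    filter_upwards [hDD', (L.invSMul hα).eventually_notMem_lattice 0] with z hz hz'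
    rw [hz, hc z hz']
  calc _ = c := hc z fun h => hz ((mem_lattice_invSMul hα).1 h)
    _ = _ := by simp [← hc0, hD', hF0, L.weierstrassP_neg]

end PeriodPair

namespace PeriodPair

open Filter Topology

/-- The relation between the quasi-period constants of a zeta function of a lattice `L` with
`αL ⊆ L`. -/
theorem _root_.ZetaLike.mul_ω₁_eq {L : PeriodPair} {Z : ℂ → ℂ} {y : ℂ} (h : ZetaLike L Z y)
    {α : ℂ} (hα : α ≠ 0) (hαL : ∀ l ∈ L.lattice, α * l ∈ L.lattice) {a b : ℤ}
    (hab : α * L.ω₁ = a * L.ω₁ + b * L.ω₂) {Q : Type} [AddCommGroup Q] [Fintype Q] {t : Q → ℂ}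
    (ht : ∀ q, α * t q ∈ L.lattice) {c : ℂ}
    (hc : ∀ z, α * z ∉ L.lattice →
      α ^ 2 * L.weierstrassP (α * z) - ∑ q, L.weierstrassP (z - t q) = c) :
    ((Fintype.card Q - α ^ 2) * y - c) * L.ω₁ = -(α * b * (2 * Real.pi * Complex.I / L.ω₁)) := by
  set x := 2 * Real.pi * Complex.I / L.ω₁ with hx
  set κ := (Fintype.card Q - α ^ 2) * y - c with hκ
  have hsub : ∀ z, α * z ∉ L.lattice → ∀ q, z - t q ∉ L.lattice := fun z hz q h => by
    have := hαL _ h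
    rw [mul_sub] at this
    exact hz (by simpa using add_mem this (ht q))
  set W : ℂ → ℂ := fun z => α * Z (α * z) - ∑ q, Z (z - t q) - κ * z with hW
  have hd : ∀ z, α * z ∉ L.lattice → HasDerivAt W 0 z := fun z hz => by
    have hm : HasDerivAt (fun z => α * z) α z := by simpa using (hasDerivAt_id z).const_mul α
    have h1 : HasDerivAt (fun z => Z (α * z)) ((-L.weierstrassP (α * z) - y) * α) z :=
      (h.hasDeriv _ hz).comp z hm
    have h2 : ∀ q, HasDerivAt (fun z => Z (z - t q)) (-L.weierstrassP (z - t q) - y) z := fun q => by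
      simpa [Function.comp_def] using
        (h.hasDeriv _ (hsub z hz q)).comp z ((hasDerivAt_id z).sub_const (t q))
    have h3 := ((h1.const_mul α).sub (HasDerivAt.fun_sum fun q (_ : q ∈ Finset.univ) => h2 q)).sub
      ((hasDerivAt_id z).const_mul κ)
    refine h3.congr_deriv ?_
    rw [hκ, ← hc z hz, Finset.sum_sub_distrib, Finset.sum_neg_distrib, Finset.sum_const,
      Finset.card_univ, nsmul_eq_mul]
    ring
  have hopen : IsOpen ((L.invSMul hα).lattice : Set ℂ)ᶜ := (L.invSMul hα).isOpen_compl_lattice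
  have hmem : ∀ z, z ∈ ((L.invSMul hα).lattice : Set ℂ)ᶜ ↔ α * z ∉ L.lattice := fun z =>
    not_congr (mem_lattice_invSMul hα)
  obtain ⟨k, hk⟩ := hopen.exists_is_const_of_deriv_eq_zero
    (L.invSMul hα).isPreconnected_compl_lattice
    (fun z hz => (hd z ((hmem z).1 hz)).differentiableAt.differentiableWithinAt)
    (fun z hz => (hd z ((hmem z).1 hz)).deriv)
  obtain ⟨z, hz⟩ : ∃ z, α * z ∉ L.lattice :=
    ⟨α⁻¹ * (L.ω₁ / 2), by rw [mul_inv_cancel_left₀ hα]; exact L.ω₁_div_two_notMem_lattice⟩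
  have hz' : α * (z + L.ω₁) ∉ L.lattice := by
    rwa [mul_add, L.add_mem_lattice_iff (hαL _ L.ω₁_mem_lattice)]
  have heq : W (z + L.ω₁) = W z := by rw [hk _ ((hmem _).2 hz'), hk _ ((hmem _).2 hz)]
  simp only [hW] at heq
  rw [mul_add, hab, h.quasi.add_int hz] at heq
  have hs : ∑ q, Z (z + L.ω₁ - t q) = ∑ q, Z (z - t q) := Finset.sum_congr rfl fun q _ => by
    rw [add_sub_right_comm, (h.quasi _ (hsub z hz q)).1, add_zero]
  rw [hs] at heq
  linear_combination -heq

/-- In the presence of complex multiplication, the constant `y` of a zeta function is an affine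
function of `2πi / ω₁²` with algebraic coefficients. -/
theorem _root_.ZetaLike.exists_eq_add_mul {L : PeriodPair} {Z : ℂ → ℂ} {y : ℂ}
    (h : ZetaLike L Z y) (h₂ : IsAlgebraic ℚ L.g₂) (h₃ : IsAlgebraic ℚ L.g₃)
    (hτ : IsAlgebraic ℚ (L.ω₂ / L.ω₁)) :
    ∃ β γ : ℂ, IsAlgebraic ℚ β ∧ IsAlgebraic ℚ γ ∧
      y = β + γ * (2 * Real.pi * Complex.I / L.ω₁ / L.ω₁) := by
  classical
  obtain ⟨k, a, b, hb, hrel⟩ := exists_quadratic_relation h₂ h₃ hτ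
  have hω := L.ω₁_ne_zero
  set τ := L.ω₂ / L.ω₁ with hτd
  have hτω : τ * L.ω₁ = L.ω₂ := div_mul_cancel₀ _ hω
  set α := 1 + 2 * b * τ with hαd
  have h1 : α * L.ω₁ = (1 : ℤ) * L.ω₁ + (2 * b : ℤ) * L.ω₂ := by
    rw [hαd, ← hτω]; push_cast; ring
  have h2 : α * L.ω₂ = (2 * k : ℤ) * L.ω₁ + (1 - 2 * a : ℤ) * L.ω₂ := by
    rw [hαd]; push_cast; linear_combination -2 * hrel
  have hαsq : ∀ n : ℕ, (n : ℂ) - α ^ 2 ≠ 0 := fun n hn => by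
    have h3 : (α - (√n : ℝ)) * (α + (√n : ℝ)) = 0 := by
      have : ((√n : ℝ) : ℂ) ^ 2 = n := by
        rw [← Complex.ofReal_pow, Real.sq_sqrt n.cast_nonneg, Complex.ofReal_natCast]
      linear_combination -hn - this
    have h4 : ∃ r : ℝ, α = r := by
      rcases mul_eq_zero.1 h3 with h4 | h4
      · exact ⟨_, sub_eq_zero.1 h4⟩
      · exact ⟨-√n, by push_cast; linear_combination h4⟩
    obtain ⟨r, hr⟩ := h4
    have h5 := LinearIndependent.pair_iff.1 L.indep (1 - r) (2 * b) (by
      simp only [Complex.real_smul]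
      rw [hr] at h1
      push_cast at h1 ⊢
      linear_combination -h1)
    simp [hb] at h5
  have hα0 : α ≠ 0 := fun h0 => hαsq 0 (by simp [h0])
  have hαa : IsAlgebraic ℚ α :=
    isAlgebraic_one.add (((isAlgebraic_natCast 2).mul (isAlgebraic_intCast b)).mul hτ)
  have hαL : ∀ l ∈ L.lattice, α * l ∈ L.lattice := fun l hl => by
    obtain ⟨m, n, rfl⟩ := mem_lattice.1 hl
    rw [mul_add, mul_left_comm, mul_left_comm α, h1, h2]
    refine mem_lattice.2 ⟨m * 1 + n * (2 * k), m * (2 * b) + n * (1 - 2 * a), ?_⟩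
    push_cast
    ring
  obtain ⟨Q, _, _, t, ht0, ht, htL, hp⟩ := L.exists_representatives hα0 hαL
  set c := -∑ q ∈ Finset.univ.erase 0, L.weierstrassP (t q) with hc
  have hca : IsAlgebraic ℚ c := by
    rw [isAlgebraic_iff_isIntegral, ← mem_integralClosure_iff]
    refine neg_mem (sum_mem fun q hq => ?_)
    rw [mem_integralClosure_iff, ← isAlgebraic_iff_isIntegral]
    refine isAlgebraic_weierstrassP_of_mul_mem h₂ h₃ (u := L.ω₁ / 2) hα0 hαa hαL ?_ ?_
      (htL q (Finset.ne_of_mem_erase hq)) (ht q)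
    · have := L.half_add_notMem 0 b
      convert this using 1
      rw [mul_div_assoc', h1]
      push_cast
      ring_nf
    · rw [mul_div_cancel₀ _ two_ne_zero]
      exact L.ω₁_mem_lattice
  have key := h.mul_ω₁_eq hα0 hαL h1 ht fun z hz =>
    sq_mul_weierstrassP_mul hα0 hαL ht0 ht htL hp hz
  have hN := hαsq (Fintype.card Q)
  have hNa : IsAlgebraic ℚ (((Fintype.card Q : ℂ) - α ^ 2)⁻¹) :=
    ((isAlgebraic_natCast _).sub (hαa.pow 2)).inv
  refine ⟨((Fintype.card Q : ℂ) - α ^ 2)⁻¹ * c,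
    -(((Fintype.card Q : ℂ) - α ^ 2)⁻¹ * (α * (2 * b : ℤ))), hNa.mul hca,
    (hNa.mul (hαa.mul (isAlgebraic_intCast _))).neg, ?_⟩
  have key' : (Fintype.card Q - α ^ 2) * y - c =
      -(α * (2 * b : ℤ) * (2 * Real.pi * Complex.I / L.ω₁)) / L.ω₁ := by
    rw [eq_div_iff hω]
    exact key
  have h5 : (Fintype.card Q - α ^ 2) * y =
      c - (α * (2 * b : ℤ) * (2 * Real.pi * Complex.I / L.ω₁ / L.ω₁)) := by
    rw [sub_eq_iff_eq_add.1 key']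
    ring
  calc y = (Fintype.card Q - α ^ 2)⁻¹ * ((Fintype.card Q - α ^ 2) * y) := by
        rw [inv_mul_cancel_left₀ hN]
    _ = _ := by
        rw [h5]
        ring

end PeriodPair

namespace Complex

open IntermediateField

/-- Two algebraically dependent complex numbers are algebraic over a purely transcendental
extension of `ℚ` generated by one number. -/
theorem exists_transcendental_isAlgebraic_pair {u v : ℂ} (h : ¬ AlgebraicIndependent ℚ ![u, v]) :
    ∃ θ : ℂ, Transcendental ℤ θ ∧ IsAlgebraic ℚ⟮θ⟯ u ∧ IsAlgebraic ℚ⟮θ⟯ v := by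
  have key : ∀ w : ℂ, Transcendental ℚ w → Transcendental ℤ w := fun w hw =>
    hw.restrictScalars (algebraMap ℤ ℚ).injective_int
  have hself : ∀ w : ℂ, IsAlgebraic ℚ⟮w⟯ w := fun w =>
    isAlgebraic_algebraMap (AdjoinSimple.gen ℚ w)
  by_cases hv : IsAlgebraic ℚ v
  · by_cases hu : IsAlgebraic ℚ u
    · obtain ⟨θ, hθ⟩ := exists_transcendental_int
      exact ⟨θ, hθ, hu.tower_top _, hv.tower_top _⟩
    · exact ⟨u, key u hu, hself u, hv.tower_top _⟩
  · refine ⟨v, key v hv, ?_, hself v⟩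
    by_contra hu
    refine h ((AlgebraicIndependent.iff_transcendental_adjoin_image (0 : Fin 2)).2 ⟨?_, ?_⟩)
    · have : Subsingleton {j : Fin 2 // j ≠ 0} :=
        ⟨fun ⟨a, ha⟩ ⟨b, hb⟩ => Subtype.ext (by lia)⟩
      exact (algebraicIndependent_singleton_iff (⟨1, by simp⟩ : {j : Fin 2 // j ≠ 0})).2 hv
    · have hs : ![u, v] '' {0}ᶜ = {v} := by
        ext z
        simp [Fin.exists_fin_two, eq_comm]
      rw [hs]
      exact fun halg => hu (isAlgebraic_adjoin_iff.2 halg)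

end Complex

namespace PeriodPair

open IntermediateField

/-- Chudnovsky's theorem for a positively oriented pair of periods. -/
theorem algebraicIndependent_pi_ω₁ (L : PeriodPair) (hpos : 0 < (L.ω₂ / L.ω₁).im)
    (h₂ : IsAlgebraic ℚ L.g₂) (h₃ : IsAlgebraic ℚ L.g₃) (hτ : IsAlgebraic ℚ (L.ω₂ / L.ω₁)) :
    AlgebraicIndependent ℚ ![(Real.pi : ℂ), L.ω₁] := by
  by_contra hdep
  obtain ⟨θ, hθ, hpi, hω⟩ := Complex.exists_transcendental_isAlgebraic_pair hdep
  obtain ⟨Z, y, h⟩ := exists_zetaLike L hpos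
  obtain ⟨β, γ, hβ, hγ, hy⟩ := h.exists_eq_add_mul h₂ h₃ hτ
  have hI : IsAlgebraic ℚ⟮θ⟯ Complex.I :=
    IsAlgebraic.tower_top (K := ℚ) _ Complex.isIntegral_rat_I.isAlgebraic
  have h2 : IsAlgebraic ℚ⟮θ⟯ (2 : ℂ) := by exact_mod_cast isAlgebraic_natCast 2
  have hx : IsAlgebraic ℚ⟮θ⟯ (2 * Real.pi * Complex.I / L.ω₁) := by
    rw [div_eq_mul_inv]
    exact ((h2.mul hpi).mul hI).mul hω.inv
  refine h.false_of_isAlgebraic hθ ?_ hx ?_ ?_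
  · refine (isAlgebraic_weierstrassP_of_two_mul_mem h₂ h₃ L.ω₁_div_two_notMem_lattice ?_).tower_top _
    rw [mul_div_cancel₀ _ two_ne_zero]
    exact L.ω₁_mem_lattice
  · rw [div_eq_mul_inv]
    exact (h₂.tower_top _).mul h2.inv
  · rw [hy, div_eq_mul_inv _ L.ω₁]
    exact (hβ.tower_top _).add ((hγ.tower_top _).mul (hx.mul hω.inv))

/-- The Eisenstein sum of a lattice as a sum over its nonzero points. -/
theorem tsum_ne_zero_eq_G (P : PeriodPair) (L : AddSubgroup ℂ)
    (hL : ∀ z, z ∈ L ↔ z ∈ P.lattice) {n : ℕ} (hn : n ≠ 0) :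
    ∑' w : {z : ℂ // z ∈ L ∧ z ≠ 0}, ((w : ℂ) ^ n)⁻¹ = P.G n := by
  let i : {z : ℂ // z ∈ L ∧ z ≠ 0} → P.lattice := fun w => ⟨w, (hL _).1 w.2.1⟩
  have hi : Function.Injective i := fun a b hab =>
    Subtype.ext (congrArg (fun l : P.lattice => (l : ℂ)) hab)
  refine hi.tsum_eq (f := fun l : P.lattice => ((l : ℂ) ^ n)⁻¹) fun l hl => ?_
  have hl0 : (l : ℂ) ≠ 0 := fun h0 => hl (by simp [h0, hn])
  exact ⟨⟨l, (hL _).2 l.2, hl0⟩, rfl⟩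

end PeriodPair

/-- `ω₂ / ω₁` is not real when `ω₁`, `ω₂` are linearly independent over `ℝ`. -/
theorem LinearIndependent.im_div_ne_zero {ω₁ ω₂ : ℂ} (h : LinearIndependent ℝ ![ω₁, ω₂]) :
    (ω₂ / ω₁).im ≠ 0 := fun h0 => by
  rw [LinearIndependent.pair_iff] at h
  have h1 : ω₁ ≠ 0 := fun h1 => by simpa using (h 1 0 (by simp [h1])).1
  have hr : (((ω₂ / ω₁).re : ℝ) : ℂ) = ω₂ / ω₁ := Complex.ext rfl (by simp [h0])
  have := h (ω₂ / ω₁).re (-1) (by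
    rw [Complex.real_smul, hr, div_mul_cancel₀ _ h1]
    simp)
  simpa using this.2

open IntermediateField in
/-- If `u`, `v` are algebraically independent and `w / v` is algebraic, then `u`, `v` form a
transcendence basis of `ℚ(u, v, w)`. -/
theorem AlgebraicIndependent.exists_isTranscendenceBasis_adjoin_triple {u v w : ℂ}
    (h : AlgebraicIndependent ℚ ![u, v]) (hw : IsAlgebraic ℚ (w / v)) :
    ∃ b : Fin 2 → (adjoin ℚ {u, v, w} : IntermediateField ℚ ℂ), IsTranscendenceBasis ℚ b := by
  set E : IntermediateField ℚ ℂ := adjoin ℚ {u, v, w} with hE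
  have hu : u ∈ E := subset_adjoin _ _ (by simp)
  have hv : v ∈ E := subset_adjoin _ _ (by simp)
  have hb : E.val ∘ ![⟨u, hu⟩, ⟨v, hv⟩] = ![u, v] := by
    ext i
    fin_cases i <;> rfl
  have hind : AlgebraicIndependent ℚ ![(⟨u, hu⟩ : E), ⟨v, hv⟩] := by
    rw [← hb] at h
    exact h.of_comp E.val
  refine ⟨![⟨u, hu⟩, ⟨v, hv⟩], hind.isTranscendenceBasis_iff_isAlgebraic.2 ?_⟩
  rw [← isAlgebraic_adjoin_iff_top]
  set F : IntermediateField ℚ E := adjoin ℚ (Set.range ![(⟨u, hu⟩ : E), ⟨v, hv⟩]) with hF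
  have huF : IsAlgebraic F (⟨u, hu⟩ : E) :=
    isAlgebraic_algebraMap (⟨_, subset_adjoin _ _ ⟨0, rfl⟩⟩ : F)
  have hvF : IsAlgebraic F (⟨v, hv⟩ : E) :=
    isAlgebraic_algebraMap (⟨_, subset_adjoin _ _ ⟨1, rfl⟩⟩ : F)
  have hv0 : v ≠ 0 := fun h0 => h.transcendental 1 (by simpa [h0] using isAlgebraic_zero)
  refine ⟨fun z => ?_⟩
  obtain ⟨z, hz⟩ := z
  refine adjoin_induction ℚ (p := fun z hz => IsAlgebraic F (⟨z, hz⟩ : E)) ?_ ?_ ?_ ?_ ?_ hz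
  · rintro z (rfl | rfl | rfl)
    · exact huF
    · exact hvF
    · have hwE : z / v ∈ E := div_mem (subset_adjoin _ _ (by simp)) hv
      have hwF : IsAlgebraic ℚ (⟨z / v, hwE⟩ : E) :=
        (isAlgebraic_algHom_iff E.val E.val.injective).1 hw
      have heq : (⟨z, subset_adjoin _ _ (by simp)⟩ : E) = ⟨z / v, hwE⟩ * ⟨v, hv⟩ :=
        Subtype.ext (div_mul_cancel₀ z hv0).symm
      rw [heq]
      exact (hwF.tower_top F).mul hvF
  · exact fun q => (isAlgebraic_algebraMap (A := E) q).tower_top F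
  · exact fun _ _ _ _ ha hb => ha.add hb
  · exact fun _ _ ha => ha.inv
  · exact fun _ _ _ _ ha hb => ha.mul hb

/-- (Chudnovsky) If the Eisenstein invariants `g₂`, `g₃` of the lattice `L = ℤω₁ + ℤω₂`
are algebraic and `ω₂/ω₁` is algebraic over `ℚ` (the CM case), then `π` and `ω₁` are
algebraically independent over `ℚ`; consequently the field `ℚ(π, ω₁, ω₂)` has
transcendence degree `2` over `ℚ` (it admits a transcendence basis with two elements). -/
theorem chudnovsky_cm_periods (ω₁ ω₂ : ℂ)
    (hindep : LinearIndependent ℝ ![ω₁, ω₂])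
    (L : AddSubgroup ℂ) (hL : L = AddSubgroup.closure {ω₁, ω₂})
    (hg₂ : IsAlgebraic ℚ ((60 : ℂ) * ∑' w : {z : ℂ // z ∈ L ∧ z ≠ 0}, ((w : ℂ) ^ 4)⁻¹))
    (hg₃ : IsAlgebraic ℚ ((140 : ℂ) * ∑' w : {z : ℂ // z ∈ L ∧ z ≠ 0}, ((w : ℂ) ^ 6)⁻¹))
    (hCM : IsAlgebraic ℚ (ω₂ / ω₁)) :
    AlgebraicIndependent ℚ ![(Real.pi : ℂ), ω₁] ∧
    ∃ b : Fin 2 → (IntermediateField.adjoin ℚ {(Real.pi : ℂ), ω₁, ω₂} : IntermediateField ℚ ℂ),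
      IsTranscendenceBasis ℚ b := by
  suffices h : AlgebraicIndependent ℚ ![(Real.pi : ℂ), ω₁] from
    ⟨h, h.exists_isTranscendenceBasis_adjoin_triple hCM⟩
  have main : ∀ P : PeriodPair, (∀ z, z ∈ L ↔ z ∈ P.lattice) → P.ω₁ = ω₁ →
      0 < (P.ω₂ / P.ω₁).im → IsAlgebraic ℚ (P.ω₂ / P.ω₁) →
      AlgebraicIndependent ℚ ![(Real.pi : ℂ), ω₁] := by
    rintro P hP rfl hpos hτ
    rw [P.tsum_ne_zero_eq_G L hP (by norm_num)] at hg₂ hg₃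
    exact P.algebraicIndependent_pi_ω₁ hpos hg₂ hg₃ hτ
  have hmem : ∀ z, z ∈ L ↔ ∃ m n : ℤ, m * ω₁ + n * ω₂ = z := fun z => by
    rw [hL, AddSubgroup.mem_closure_pair]
    simp only [zsmul_eq_mul]
  rcases hindep.im_div_ne_zero.lt_or_gt with hneg | hpos
  · have hindep' : LinearIndependent ℝ ![ω₁, -ω₂] := by
      rw [LinearIndependent.pair_iff] at hindep ⊢
      intro s t hst
      have := hindep s (-t) (by simpa using hst)
      simpa using this
    refine main ⟨ω₁, -ω₂, hindep'⟩ (fun z => ?_) rfl (by simpa [neg_div] using hneg)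
      (by simpa [neg_div] using hCM.neg)
    rw [hmem, PeriodPair.mem_lattice]
    refine exists_congr fun m => ⟨fun ⟨n, hn⟩ => ⟨-n, ?_⟩, fun ⟨n, hn⟩ => ⟨-n, ?_⟩⟩ <;>
    · rw [← hn]
      push_cast
      ring
  · exact main ⟨ω₁, ω₂, hindep⟩ (fun z => by rw [hmem, PeriodPair.mem_lattice]) rfl hpos hCM
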